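/- arXiv:1210.5270 — 3 statements merged into one kernel-verified Lean document; each statement's English description precedes it below -/
import Mathlib

section
/- For all nonnegative integers n and complex k with Re(k) ≥ 0, the Mehta integral identity holds: (2π)^{-n/2} ∫_{ℝ^n} ∏_{1≤i<j≤n} |x_i - x_j|^{2k} e^{-|x|²/2} dx = ∏_{j=1}^n Γ(1+kj)/Γ(1+k). -/
section MehtaAux

open MeasureTheory Set Filter Topology

/-- A profile on `ℝ` of polynomial growth times exponential decay, used as a dominating function. -/
noncomputable def expProfile (s t : ℝ) : ℝ := (1 + |t|) ^ s * Real.exp (-|t| / 2)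

lemma expProfile_nonneg (s t : ℝ) : 0 ≤ expProfile s t := by
  unfold expProfile; positivity

lemma exists_rpow_le_exp_half (p : ℝ) : ∃ C : ℝ, ∀ v : ℝ, 1 ≤ v → v ^ p ≤ C * Real.exp (v / 2) := by
  refine ⟨2 ^ ⌈p⌉₊ * (⌈p⌉₊.factorial : ℝ), fun v hv => ?_⟩
  have h1 : v ^ p ≤ v ^ ⌈p⌉₊ := by
    rw [← Real.rpow_natCast]
    exact Real.rpow_le_rpow_of_exponent_le hv (Nat.le_ceil p)
  have h2 := Real.pow_div_factorial_le_exp (v / 2) (by linarith) ⌈p⌉₊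
  rw [div_pow, div_div, div_le_iff₀ (by positivity)] at h2
  linarith

lemma integrable_expProfile (s : ℝ) : Integrable (expProfile s) := by
  obtain ⟨C, hC⟩ := exists_rpow_le_exp_half (s + 2)
  refine (integrable_inv_one_add_sq.const_mul (C * Real.exp (1 / 2))).mono' ?_ ?_
  · unfold expProfile
    exact (by fun_prop : Measurable fun t : ℝ => (1 + |t|) ^ s * Real.exp (-|t| / 2)).aestronglyMeasurable
  · refine Eventually.of_forall fun t => ?_
    rw [Real.norm_of_nonneg (expProfile_nonneg s t), ← div_eq_mul_inv, le_div_iff₀ (by positivity)]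
    have h0 := abs_nonneg t
    have h1 := hC (1 + |t|) (by linarith)
    rw [Real.rpow_add (by positivity), Real.rpow_two] at h1
    have h2 : 1 + t ^ 2 ≤ (1 + |t|) ^ 2 := by nlinarith [sq_abs t]
    calc expProfile s t * (1 + t ^ 2)
        ≤ (1 + |t|) ^ s * Real.exp (-|t| / 2) * (1 + |t|) ^ 2 :=
          mul_le_mul_of_nonneg_left h2 (expProfile_nonneg s t)
      _ = (1 + |t|) ^ s * (1 + |t|) ^ 2 * Real.exp (-|t| / 2) := by ring
      _ ≤ C * Real.exp ((1 + |t|) / 2) * Real.exp (-|t| / 2) := by gcongr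
      _ = C * Real.exp (1 / 2) := by
          rw [mul_assoc, ← Real.exp_add]; congr 2; ring

lemma integrable_prod_expProfile {ι : Type*} [Fintype ι] (s : ℝ) :
    Integrable (fun x : ι → ℝ => ∏ i, expProfile s (x i)) :=
  Integrable.fintype_prod fun _ => integrable_expProfile s

/-- The product of the quantities `1 + |x i|`. -/
noncomputable def prodOneAddAbs {ι : Type*} [Fintype ι] (x : ι → ℝ) : ℝ := ∏ i, (1 + |x i|)

lemma one_add_abs_le_prodOneAddAbs {ι : Type*} [Fintype ι] (x : ι → ℝ) (i : ι) :
    1 + |x i| ≤ prodOneAddAbs x := by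
  classical
  rw [prodOneAddAbs, ← Finset.mul_prod_erase _ _ (Finset.mem_univ i)]
  refine le_mul_of_one_le_right (by positivity) (Finset.one_le_prod fun j _ => ?_)
  linarith [abs_nonneg (x j)]

lemma one_le_prodOneAddAbs {ι : Type*} [Fintype ι] (x : ι → ℝ) : 1 ≤ prodOneAddAbs x :=
  Finset.one_le_prod fun j _ => by linarith [abs_nonneg (x j)]

lemma prodOneAddAbs_rpow_mul {ι : Type*} [Fintype ι] (s : ℝ) (x : ι → ℝ) :
    prodOneAddAbs x ^ s * ∏ i, Real.exp (-|x i| / 2) = ∏ i, expProfile s (x i) := by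
  unfold prodOneAddAbs expProfile
  rw [Finset.prod_mul_distrib, Real.finsetProd_rpow _ _ fun i _ => by positivity]

/-- The product of `|x i - x j| ^ γ` over all ordered pairs of distinct indices. -/
noncomputable def pairProd {ι : Type*} [Fintype ι] [DecidableEq ι] (γ : ℝ) (x : ι → ℝ) : ℝ :=
  ∏ i, ∏ j, if i = j then 1 else |x i - x j| ^ γ

variable {ι : Type*} [Fintype ι] [DecidableEq ι]

lemma pairProd_nonneg (γ : ℝ) (x : ι → ℝ) : 0 ≤ pairProd γ x :=
  Finset.prod_nonneg fun i _ => Finset.prod_nonneg fun j _ => by split_ifs <;> positivity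

lemma measurable_pairProd (γ : ℝ) : Measurable (pairProd γ : (ι → ℝ) → ℝ) := by
  unfold pairProd
  refine Finset.measurable_prod _ fun i _ => Finset.measurable_prod _ fun j _ => ?_
  split_ifs <;> fun_prop

lemma pairProd_comp_perm (γ : ℝ) (x : ι → ℝ) (σ : Equiv.Perm ι) :
    pairProd γ (x ∘ σ) = pairProd γ x := by
  unfold pairProd
  rw [← Equiv.prod_comp σ (fun i => ∏ j, if i = j then 1 else |x i - x j| ^ γ)]
  refine Finset.prod_congr rfl fun i _ => ?_
  rw [← Equiv.prod_comp σ (fun j => if σ i = j then 1 else |x (σ i) - x j| ^ γ)]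
  simp

lemma pairProd_eq_zero {γ : ℝ} (hγ : 0 < γ) {x : ι → ℝ} {i j : ι} (hij : i ≠ j) (h : x i = x j) :
    pairProd γ x = 0 :=
  Finset.prod_eq_zero (Finset.mem_univ i) <| Finset.prod_eq_zero (Finset.mem_univ j) <| by
    simp [hij, h, hγ.ne']

omit [DecidableEq ι] in
lemma abs_sub_le_prodOneAddAbs_sq (x : ι → ℝ) (i j : ι) : |x i - x j| ≤ prodOneAddAbs x ^ 2 := by
  have h1 := one_add_abs_le_prodOneAddAbs x i
  have h2 := one_add_abs_le_prodOneAddAbs x j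
  have h3 := abs_sub (x i) (x j)
  nlinarith [abs_nonneg (x i), abs_nonneg (x j)]

omit [DecidableEq ι] in
lemma abs_prod_prod_le {γ : ℝ} (x : ι → ℝ) (f : ι → ι → ℝ)
    (hf : ∀ i j, |f i j| ≤ (prodOneAddAbs x ^ 2) ^ γ) :
    |∏ i, ∏ j, f i j| ≤ prodOneAddAbs x ^ (2 * γ * (Fintype.card ι * Fintype.card ι : ℕ)) := by
  have h0 : 0 ≤ prodOneAddAbs x := zero_le_one.trans (one_le_prodOneAddAbs x)
  calc |∏ i, ∏ j, f i j| = ∏ i, ∏ j, |f i j| := by simp_rw [Finset.abs_prod]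
    _ ≤ ∏ _i : ι, ∏ _j : ι, (prodOneAddAbs x ^ 2) ^ γ :=
      Finset.prod_le_prod (fun _ _ => Finset.prod_nonneg fun _ _ => abs_nonneg _) fun i _ =>
        Finset.prod_le_prod (fun _ _ => abs_nonneg _) fun j _ => hf i j
    _ = _ := by
      rw [Finset.prod_const, Finset.prod_const, Finset.card_univ, ← pow_mul, Real.rpow_mul h0,
        Real.rpow_natCast, Real.rpow_mul h0, Real.rpow_two]

omit [DecidableEq ι] in
lemma one_le_prodOneAddAbs_sq_rpow {γ : ℝ} (hγ : 0 ≤ γ) (x : ι → ℝ) :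
    1 ≤ (prodOneAddAbs x ^ 2) ^ γ :=
  Real.one_le_rpow (one_le_pow₀ (one_le_prodOneAddAbs x)) hγ

lemma pairProd_le {γ : ℝ} (hγ : 0 ≤ γ) (x : ι → ℝ) :
    pairProd γ x ≤ prodOneAddAbs x ^ (2 * γ * (Fintype.card ι * Fintype.card ι : ℕ)) := by
  refine (le_abs_self _).trans (abs_prod_prod_le x _ fun i j => ?_)
  split_ifs
  · simpa using one_le_prodOneAddAbs_sq_rpow hγ x
  · rw [abs_of_nonneg (by positivity)]
    exact Real.rpow_le_rpow (abs_nonneg _) (abs_sub_le_prodOneAddAbs_sq x i j) hγ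

/-- One factor of `pairProd` may even be divided by the corresponding difference. -/
lemma abs_pairProd_div_le {γ : ℝ} (hγ : 1 < γ) (x : ι → ℝ) {i j : ι} (hij : i ≠ j) :
    |pairProd γ x / (x i - x j)| ≤
      prodOneAddAbs x ^ (2 * γ * (Fintype.card ι * Fintype.card ι : ℕ)) := by
  have key : pairProd γ x / (x i - x j) = ∏ a, ∏ b, (if a = b then 1 else |x a - x b| ^ γ) *
      (if a = i then (if b = j then (x i - x j)⁻¹ else 1) else 1) := by
    simp_rw [Finset.prod_mul_distrib]
    rw [div_eq_mul_inv, pairProd]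
    congr 1
    rw [Finset.prod_eq_single i (fun a _ ha => by simp [ha]) (by simp)]
    simp
  have hB := one_le_prodOneAddAbs_sq_rpow (zero_le_one.trans hγ.le) x
  rw [key]
  refine abs_prod_prod_le x _ fun a b => ?_
  have hW : |if a = b then 1 else |x a - x b| ^ γ| ≤ (prodOneAddAbs x ^ 2) ^ γ := by
    split_ifs
    · simpa using hB
    · rw [abs_of_nonneg (by positivity)]
      exact Real.rpow_le_rpow (abs_nonneg _) (abs_sub_le_prodOneAddAbs_sq x a b) (by linarith)
  by_cases ha : a = i <;> by_cases hb : b = j <;> simp only [ha, hb, if_true, if_false, mul_one]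
  · subst ha hb
    rw [if_neg hij, abs_mul, abs_inv, abs_of_nonneg (by positivity : 0 ≤ |x a - x b| ^ γ)]
    rcases eq_or_ne (x a - x b) 0 with h | h
    · rw [h]; simp; positivity
    rw [← Real.rpow_neg_one, ← Real.rpow_add (abs_pos.mpr h)]
    refine (Real.rpow_le_rpow (abs_nonneg _) (abs_sub_le_prodOneAddAbs_sq x a b)
      (by linarith)).trans ?_
    exact Real.rpow_le_rpow_of_exponent_le (one_le_pow₀ (one_le_prodOneAddAbs x)) (by linarith)
  all_goals simpa only [ha, hb] using hW

/-- Lebesgue measure on the open positive orthant. -/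
noncomputable def orthant (ι : Type*) [Fintype ι] : Measure (ι → ℝ) :=
  Measure.pi fun _ => volume.restrict (Ioi 0)

omit [DecidableEq ι] in
lemma orthant_eq_restrict : orthant ι = volume.restrict (univ.pi fun _ => Ioi 0) :=
  (Measure.restrict_pi_pi _ _).symm

omit [DecidableEq ι] in
lemma measurableSet_posOrthant : MeasurableSet (univ.pi fun _ : ι => Ioi (0 : ℝ)) :=
  MeasurableSet.univ_pi fun _ => measurableSet_Ioi

omit [DecidableEq ι] in
lemma ae_orthant_pos : ∀ᵐ x ∂orthant ι, ∀ i, 0 < x i := by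
  rw [orthant_eq_restrict]
  filter_upwards [ae_restrict_mem measurableSet_posOrthant] with x hx i using hx i (mem_univ i)

omit [DecidableEq ι] in
lemma integral_orthant_comp_perm (σ : Equiv.Perm ι) (F : (ι → ℝ) → ℝ) :
    ∫ x, F (x ∘ σ) ∂orthant ι = ∫ x, F x ∂orthant ι := by
  have h := (measurePreserving_piCongrLeft
    (fun _ : ι => (volume : Measure ℝ).restrict (Ioi 0)) σ.symm).integral_comp' F
  rw [orthant, ← h]
  refine integral_congr_ae (Eventually.of_forall fun x => ?_)
  dsimp only
  congr 1
  ext i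
  conv_rhs => rw [← σ.symm_apply_apply i]
  exact (Equiv.piCongrLeft_apply_apply (fun _ : ι => ℝ) σ.symm x (σ i)).symm

omit [DecidableEq ι] in
lemma integrable_orthant_of_le {F : (ι → ℝ) → ℝ} (hF : Measurable F) (s : ℝ)
    (h : ∀ x, (∀ i, 0 < x i) → |F x| ≤ prodOneAddAbs x ^ s * ∏ i, Real.exp (-|x i| / 2)) :
    Integrable F (orthant ι) := by
  have h1 : Integrable (fun x : ι → ℝ => ∏ i, expProfile s (x i)) (orthant ι) := by
    rw [orthant_eq_restrict]
    exact (integrable_prod_expProfile s).restrict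
  refine h1.mono' hF.aestronglyMeasurable ?_
  filter_upwards [ae_orthant_pos] with x hx
  rw [← prodOneAddAbs_rpow_mul]
  exact h x hx

/-- The integrand of the Laguerre-type Selberg integral, with individual exponents. -/
noncomputable def lagWeight (γ : ℝ) (b x : ι → ℝ) : ℝ :=
  (∏ i, x i ^ b i * Real.exp (-x i)) * pairProd γ x

lemma measurable_lagWeight (γ : ℝ) (b : ι → ℝ) : Measurable (lagWeight γ b) := by
  unfold lagWeight
  exact (Finset.measurable_prod _ fun i _ => by fun_prop).mul (measurable_pairProd γ)

lemma lagWeight_comp_perm (γ : ℝ) (b x : ι → ℝ) (σ : Equiv.Perm ι) :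
    lagWeight γ (b ∘ σ) (x ∘ σ) = lagWeight γ b x := by
  simp only [lagWeight, pairProd_comp_perm, Function.comp_apply]
  rw [Equiv.prod_comp σ fun i => x i ^ b i * Real.exp (-x i)]

omit [DecidableEq ι] in
lemma prod_rpow_mul_exp_le {b x : ι → ℝ} (hb : ∀ i, 0 ≤ b i) (hx : ∀ i, 0 < x i) :
    ∏ i, x i ^ b i * Real.exp (-x i) ≤
      prodOneAddAbs x ^ (∑ i, b i) * ∏ i, Real.exp (-|x i| / 2) := by
  have h0 : 0 < prodOneAddAbs x := zero_lt_one.trans_le (one_le_prodOneAddAbs x)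
  rw [Real.rpow_sum_of_pos h0, ← Finset.prod_mul_distrib]
  refine Finset.prod_le_prod (fun i _ => ?_) fun i _ => ?_
  · have := hx i
    positivity
  · have h1 := one_add_abs_le_prodOneAddAbs x i
    have h2 := abs_of_pos (hx i)
    have := hx i
    gcongr
    · exact hb i
    · linarith
    · linarith

lemma integrable_lagWeight {γ : ℝ} (hγ : 0 ≤ γ) {b : ι → ℝ} (hb : ∀ i, 0 ≤ b i) :
    Integrable (lagWeight γ b) (orthant ι) := by
  refine integrable_orthant_of_le (measurable_lagWeight γ b) (∑ i, b i + 2 * γ *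
    (Fintype.card ι * Fintype.card ι : ℕ)) fun x hx => ?_
  have h0 : 0 < prodOneAddAbs x := zero_lt_one.trans_le (one_le_prodOneAddAbs x)
  have h1 : 0 ≤ ∏ i, x i ^ b i * Real.exp (-x i) :=
    Finset.prod_nonneg fun i _ => by have := hx i; positivity
  rw [lagWeight, abs_mul, abs_of_nonneg h1, abs_of_nonneg (pairProd_nonneg _ _),
    Real.rpow_add h0, mul_right_comm]
  exact mul_le_mul (prod_rpow_mul_exp_le hb hx) (pairProd_le hγ x) (pairProd_nonneg _ _)
    (by positivity)

lemma integrable_lagWeight_div {γ : ℝ} (hγ : 1 < γ) {b : ι → ℝ} (hb : ∀ i, 0 ≤ b i) {i j : ι}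
    (hij : i ≠ j) : Integrable (fun x => lagWeight γ b x / (x i - x j)) (orthant ι) := by
  refine integrable_orthant_of_le ((measurable_lagWeight γ b).div (by fun_prop))
    (∑ i, b i + 2 * γ * (Fintype.card ι * Fintype.card ι : ℕ)) fun x hx => ?_
  have h0 : 0 < prodOneAddAbs x := zero_lt_one.trans_le (one_le_prodOneAddAbs x)
  have h1 : 0 ≤ ∏ i, x i ^ b i * Real.exp (-x i) :=
    Finset.prod_nonneg fun i _ => by have := hx i; positivity
  rw [lagWeight, mul_div_assoc, abs_mul, abs_of_nonneg h1, Real.rpow_add h0, mul_right_comm]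
  exact mul_le_mul (prod_rpow_mul_exp_le hb hx) (abs_pairProd_div_le hγ x hij) (abs_nonneg _)
    (by positivity)

/-- A repulsion term with equal exponents vanishes by antisymmetry. -/
lemma integral_lagWeight_div_of_eq {γ : ℝ} {b : ι → ℝ} {i j : ι} (h : b i = b j) :
    ∫ x, lagWeight γ b x / (x i - x j) ∂orthant ι = 0 := by
  have hb : b ∘ Equiv.swap i j = b := by
    ext k
    rcases eq_or_ne k i with rfl | hi
    · simp [h]
    rcases eq_or_ne k j with rfl | hj
    · simp [h]
    simp [Equiv.swap_apply_of_ne_of_ne hi hj]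
  have h1 := integral_orthant_comp_perm (Equiv.swap i j) fun x => lagWeight γ b x / (x i - x j)
  have h2 : ∀ x : ι → ℝ, lagWeight γ b (x ∘ Equiv.swap i j) = lagWeight γ b x := fun x => by
    conv_lhs => rw [← hb]
    exact lagWeight_comp_perm γ b x _
  simp only [h2, Function.comp_apply, Equiv.swap_apply_left, Equiv.swap_apply_right] at h1
  have h3 : ∀ x : ι → ℝ, lagWeight γ b x / (x j - x i) = -(lagWeight γ b x / (x i - x j)) :=
    fun x => by rw [← neg_sub (x i), div_neg]
  simp only [h3, integral_neg] at h1
  linarith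

lemma lagWeight_add_one {γ : ℝ} {b x : ι → ℝ} {i : ι} (hx : 0 < x i) :
    lagWeight γ (Function.update b i (b i + 1)) x = x i * lagWeight γ b x := by
  unfold lagWeight
  rw [← Finset.mul_prod_erase _ _ (Finset.mem_univ i),
    ← Finset.mul_prod_erase _ (fun k => x k ^ b k * _) (Finset.mem_univ i)]
  have : ∏ k ∈ Finset.univ.erase i, x k ^ (Function.update b i (b i + 1) k) * Real.exp (-x k) =
      ∏ k ∈ Finset.univ.erase i, x k ^ b k * Real.exp (-x k) :=
    Finset.prod_congr rfl fun k hk => by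
      rw [Function.update_of_ne (Finset.ne_of_mem_erase hk)]
  rw [this, Function.update_self, Real.rpow_add hx, Real.rpow_one]
  ring

/-- A repulsion term with exponents differing by one, by symmetrization. -/
lemma integral_lagWeight_div_of_eq_add_one {γ : ℝ} (hγ : 1 < γ) {b : ι → ℝ} (hb : ∀ i, 0 ≤ b i)
    {i j : ι} (hij : i ≠ j) (h : b i = b j) :
    ∫ x, lagWeight γ (Function.update b i (b i + 1)) x / (x i - x j) ∂orthant ι =
      (∫ x, lagWeight γ b x ∂orthant ι) / 2 := by
  set b' := Function.update b i (b i + 1) with hb'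
  have hb'0 : ∀ k, 0 ≤ b' k := fun k => by
    rcases eq_or_ne k i with rfl | hk
    · rw [hb', Function.update_self]; linarith [hb k]
    · rw [hb', Function.update_of_ne hk]; exact hb k
  have hswap : ∀ k, b (Equiv.swap i j k) = b k := fun k => by
    rcases eq_or_ne k i with rfl | hi
    · simp [h]
    rcases eq_or_ne k j with rfl | hj
    · simp [h]
    simp [Equiv.swap_apply_of_ne_of_ne hi hj]
  have hbs : Function.update b j (b j + 1) ∘ Equiv.swap i j = b' := by
    ext k
    rcases eq_or_ne k i with rfl | hi
    · simp [hb', h]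
    · rw [Function.comp_apply, hb', Function.update_of_ne hi, Function.update_of_ne, hswap]
      rwa [Ne, Equiv.swap_apply_eq_iff, Equiv.swap_apply_right]
  have h1 := integral_orthant_comp_perm (Equiv.swap i j) fun x => lagWeight γ b' x / (x i - x j)
  have h2 : ∀ x : ι → ℝ, lagWeight γ b' (x ∘ Equiv.swap i j) =
      lagWeight γ (Function.update b j (b j + 1)) x := fun x => by
    conv_lhs => rw [← hbs]
    exact lagWeight_comp_perm γ _ x _
  simp only [h2, Function.comp_apply, Equiv.swap_apply_left, Equiv.swap_apply_right] at h1
  have hjb : ∀ k, 0 ≤ Function.update b j (b j + 1) k := fun k => by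
    rcases eq_or_ne k j with rfl | hk
    · rw [Function.update_self]; linarith [hb k]
    · rw [Function.update_of_ne hk]; exact hb k
  have h4 : ∫ x, lagWeight γ b x ∂orthant ι = ∫ x, (lagWeight γ b' x / (x i - x j) +
      lagWeight γ (Function.update b j (b j + 1)) x / (x j - x i)) ∂orthant ι := by
    refine integral_congr_ae ?_
    filter_upwards [ae_orthant_pos] with x hx
    rw [hb', lagWeight_add_one (hx i), lagWeight_add_one (hx j), ← neg_sub (x i), div_neg]
    rcases eq_or_ne (x i) (x j) with hxe | hxe
    · simp [lagWeight, pairProd_eq_zero (zero_lt_one.trans hγ) hij hxe]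
    · have : x i - x j ≠ 0 := sub_ne_zero.mpr hxe
      field_simp
      ring
  rw [h4, integral_add (integrable_lagWeight_div hγ hb'0 hij)
    (integrable_lagWeight_div hγ hjb hij.symm), h1]
  ring

lemma hasDerivAt_finset_prod_of_logDeriv {κ : Type*} (s : Finset κ) {f : κ → ℝ → ℝ} {c : κ → ℝ}
    {t : ℝ} (h : ∀ a ∈ s, HasDerivAt (f a) (f a t * c a) t) :
    HasDerivAt (fun u => ∏ a ∈ s, f a u) ((∏ a ∈ s, f a t) * ∑ a ∈ s, c a) t := by
  classical
  induction s using Finset.induction_on with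
  | empty => simpa using hasDerivAt_const t (1 : ℝ)
  | insert a s ha ih =>
    simp only [Finset.prod_insert ha, Finset.sum_insert ha]
    have h1 := (h a (Finset.mem_insert_self a s)).mul
      (ih fun b hb => h b (Finset.mem_insert_of_mem hb))
    convert! h1 using 1
    ring

lemma hasDerivAt_abs_rpow_logDeriv {γ : ℝ} (hγ : 1 < γ) (s : ℝ) :
    HasDerivAt (fun u : ℝ => |u| ^ γ) (|s| ^ γ * (γ / s)) s := by
  convert! hasDerivAt_abs_rpow s hγ using 1
  rcases eq_or_ne s 0 with rfl | hs
  · simp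
  · rw [Real.rpow_sub (abs_pos.mpr hs), Real.rpow_two, sq_abs]
    field_simp

omit [Fintype ι] in
lemma hasDerivAt_update_apply (x : ι → ℝ) (i k : ι) (t : ℝ) :
    HasDerivAt (fun u => Function.update x i u k) (if k = i then 1 else 0) t := by
  rcases eq_or_ne k i with rfl | h
  · simpa using hasDerivAt_id' t
  · simpa [h] using hasDerivAt_const t (x k)

lemma hasDerivAt_pairProd {γ : ℝ} (hγ : 1 < γ) (x : ι → ℝ) (i : ι) :
    HasDerivAt (fun t => pairProd γ (Function.update x i t))
      (pairProd γ x * ∑ j, 2 * γ / (x i - x j)) (x i) := by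
  have h : ∀ a b : ι, HasDerivAt (fun t => if a = b then 1 else
      |Function.update x i t a - Function.update x i t b| ^ γ)
      ((if a = b then 1 else |Function.update x i (x i) a - Function.update x i (x i) b| ^ γ) *
        (γ / (x a - x b) * ((if a = i then 1 else 0) - (if b = i then 1 else 0)))) (x i) := by
    intro a b
    rcases eq_or_ne a b with rfl | hab
    · simpa using hasDerivAt_const (x i) (1 : ℝ)
    have h1 := (hasDerivAt_update_apply x i a (x i)).sub (hasDerivAt_update_apply x i b (x i))
    have h2 := HasDerivAt.comp (x i) (hasDerivAt_abs_rpow_logDeriv hγ _) h1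
    simp only [if_neg hab]
    convert! h2 using 1
    simp [mul_assoc]
  have h2 := hasDerivAt_finset_prod_of_logDeriv Finset.univ fun a _ =>
    hasDerivAt_finset_prod_of_logDeriv Finset.univ fun b _ => h a b
  unfold pairProd
  convert! h2 using 1
  simp only [Function.update_eq_self]
  congr 1
  simp only [mul_sub, Finset.sum_sub_distrib]
  rw [Finset.sum_comm (f := fun a b => γ / (x a - x b) * if b = i then 1 else 0)]
  simp only [mul_ite, mul_one, mul_zero, Finset.sum_ite_irrel, Finset.sum_const_zero,
    Finset.sum_ite_eq', Finset.mem_univ, if_true]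
  rw [← Finset.sum_sub_distrib]
  refine Finset.sum_congr rfl fun j _ => ?_
  rw [← neg_sub (x i) (x j), div_neg]
  ring

lemma hasDerivAt_lagWeight {γ : ℝ} (hγ : 1 < γ) (b x : ι → ℝ) {i : ι} (hx : 0 < x i) :
    HasDerivAt (fun t => lagWeight γ b (Function.update x i t))
      (lagWeight γ b x * (b i / x i - 1 + ∑ j, 2 * γ / (x i - x j))) (x i) := by
  have h : ∀ k, HasDerivAt (fun t => Function.update x i t k ^ b k *
      Real.exp (-Function.update x i t k)) (Function.update x i (x i) k ^ b k *
      Real.exp (-Function.update x i (x i) k) * if k = i then b i / x i - 1 else 0) (x i) := by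
    intro k
    rcases eq_or_ne k i with rfl | hk
    · have h1 := (Real.hasDerivAt_rpow_const (p := b k) (Or.inl hx.ne')).mul
        (hasDerivAt_neg (x k)).exp
      simp only [Function.update_self, if_true]
      convert! h1 using 1
      rw [Real.rpow_sub_one hx.ne']
      ring
    · simpa [hk] using hasDerivAt_const (x i) (x k ^ b k * Real.exp (-x k))
  have h1 := (hasDerivAt_finset_prod_of_logDeriv Finset.univ fun k _ => h k).mul
    (hasDerivAt_pairProd hγ x i)
  unfold lagWeight
  convert! h1 using 1
  simp only [Function.update_eq_self, Finset.sum_ite_eq', Finset.mem_univ, if_true]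
  ring

lemma continuous_pairProd {γ : ℝ} (hγ : 0 ≤ γ) : Continuous (pairProd γ : (ι → ℝ) → ℝ) := by
  unfold pairProd
  refine continuous_finsetProd _ fun i _ => continuous_finsetProd _ fun j _ => ?_
  split_ifs
  · exact continuous_const
  · exact Continuous.rpow_const (by fun_prop) fun _ => Or.inr hγ

lemma continuous_lagWeight {γ : ℝ} (hγ : 0 ≤ γ) {b : ι → ℝ} (hb : ∀ i, 0 ≤ b i) :
    Continuous (lagWeight γ b) := by
  unfold lagWeight
  refine (continuous_finsetProd _ fun i _ => ?_).mul (continuous_pairProd hγ)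
  exact (Continuous.rpow_const (by fun_prop) fun _ => Or.inr (hb i)).mul (by fun_prop)

/-- The fundamental theorem of calculus in one coordinate of the orthant. -/
lemma integral_orthant_of_hasDerivAt {n : ℕ} (i : Fin (n + 1)) {f f' : (Fin (n + 1) → ℝ) → ℝ}
    (hf : Integrable f (orthant (Fin (n + 1)))) (hf' : Integrable f' (orthant (Fin (n + 1))))
    (hc : Continuous f)
    (hd : ∀ x, (∀ k, 0 < x k) → HasDerivAt (fun t => f (Function.update x i t)) (f' x) (x i)) :
    ∫ x, f' x ∂orthant (Fin (n + 1)) = -∫ y, f (i.insertNth 0 y) ∂orthant (Fin n) := by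
  have he := (measurePreserving_piFinSuccAbove
    (fun _ : Fin (n + 1) => (volume : Measure ℝ).restrict (Ioi 0)) i).symm
  have hInt : ∀ g : (Fin (n + 1) → ℝ) → ℝ, Integrable g (orthant (Fin (n + 1))) →
      Integrable (fun z : ℝ × (Fin n → ℝ) => g (i.insertNth z.1 z.2))
        ((volume.restrict (Ioi 0)).prod (orthant (Fin n))) := fun g hg =>
    (he.integrable_comp_emb (MeasurableEquiv.measurableEmbedding _)).mpr hg
  have h1 : ∫ x, f' x ∂orthant (Fin (n + 1)) = ∫ z : ℝ × (Fin n → ℝ), f' (i.insertNth z.1 z.2)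
      ∂((volume.restrict (Ioi 0)).prod (orthant (Fin n))) := (he.integral_comp' f').symm
  have : SFinite (orthant (Fin n)) := by unfold orthant; infer_instance
  rw [h1, integral_prod_symm _ (hInt f' hf'), ← integral_neg]
  refine integral_congr_ae ?_
  filter_upwards [(hInt f hf).prod_left_ae, (hInt f' hf').prod_left_ae, ae_orthant_pos]
    with y hy hy' hpos
  have hder : ∀ t ∈ Ioi (0 : ℝ), HasDerivAt (fun t => f (i.insertNth t y))
      (f' (i.insertNth t y)) t := by
    intro t ht
    have h2 := hd (i.insertNth t y) (by
      intro k
      rcases Fin.eq_self_or_eq_succAbove i k with rfl | ⟨j, rfl⟩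
      · simpa using ht
      · simpa using hpos j)
    simpa using h2
  rw [integral_Ioi_of_hasDerivAt_of_tendsto (m := 0) _ hder hy'
    (tendsto_zero_of_hasDerivAt_of_integrableOn_Ioi hder hy' hy), zero_sub]
  refine Continuous.continuousWithinAt (hc.comp ?_)
  exact Continuous.finInsertNth i continuous_id continuous_const

lemma integral_lagWeight_mul_score {n : ℕ} {γ : ℝ} (hγ : 1 < γ) {b : Fin (n + 1) → ℝ}
    (hb : ∀ k, 0 ≤ b k) (i : Fin (n + 1))
    (hInt : Integrable (fun x => lagWeight γ b x * (b i / x i - 1)) (orthant (Fin (n + 1)))) :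
    ∫ x, lagWeight γ b x * (b i / x i - 1) ∂orthant (Fin (n + 1)) +
      ∑ j, 2 * γ * ∫ x, lagWeight γ b x / (x i - x j) ∂orthant (Fin (n + 1)) =
      -∫ y, lagWeight γ b (i.insertNth 0 y) ∂orthant (Fin n) := by
  have hj : ∀ j, Integrable (fun x => 2 * γ * (lagWeight γ b x / (x i - x j)))
      (orthant (Fin (n + 1))) := fun j => by
    rcases eq_or_ne i j with rfl | hij
    · simp
    · exact (integrable_lagWeight_div hγ hb hij).const_mul _
  have heq : ∀ x, lagWeight γ b x * (b i / x i - 1 + ∑ j, 2 * γ / (x i - x j)) =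
      lagWeight γ b x * (b i / x i - 1) + ∑ j, 2 * γ * (lagWeight γ b x / (x i - x j)) := fun x => by
    rw [mul_add, Finset.mul_sum]
    congr 1
    exact Finset.sum_congr rfl fun j _ => by ring
  have hsum := integrable_finsetSum Finset.univ fun j _ => hj j
  rw [← integral_orthant_of_hasDerivAt i (integrable_lagWeight (by linarith) hb)
    ((hInt.add hsum).congr (Eventually.of_forall fun x => (heq x).symm))
    (continuous_lagWeight (by linarith) hb) fun x hx => hasDerivAt_lagWeight hγ b x (hx i)]
  simp_rw [heq]
  rw [integral_add hInt hsum, integral_finsetSum _ fun j _ => hj j]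
  simp_rw [integral_const_mul]

/-- The Laguerre-type Selberg integral in `n` variables. -/
noncomputable def lagInt (n : ℕ) (γ a : ℝ) : ℝ :=
  ∫ x, lagWeight γ (fun _ => a) x ∂orthant (Fin n)

/-- The exponents `a + 1` on `S` and `a` elsewhere. -/
noncomputable def bumpExp (a : ℝ) (S : Finset ι) (j : ι) : ℝ := if j ∈ S then a + 1 else a

omit [Fintype ι] in
lemma bumpExp_insert (a : ℝ) {S : Finset ι} {i : ι} (hi : i ∉ S) :
    bumpExp a (insert i S) = Function.update (bumpExp a S) i (bumpExp a S i + 1) := by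
  ext j
  rcases eq_or_ne j i with rfl | hj <;> simp [bumpExp, *]

/-- Aomoto's recursion. -/
lemma integral_lagWeight_bumpExp_insert {n : ℕ} {γ a : ℝ} (hγ : 1 < γ) (ha : 0 ≤ a)
    {S : Finset (Fin (n + 1))} {i : Fin (n + 1)} (hi : i ∉ S) :
    ∫ x, lagWeight γ (bumpExp a (insert i S)) x ∂orthant (Fin (n + 1)) =
      (a + 1 + γ * (n - S.card)) * ∫ x, lagWeight γ (bumpExp a S) x ∂orthant (Fin (n + 1)) := by
  have hnn : ∀ (T : Finset (Fin (n + 1))) k, 0 ≤ bumpExp a T k := fun T k => by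
    unfold bumpExp; split_ifs <;> linarith
  have hbi : bumpExp a (insert i S) i = a + 1 := by simp [bumpExp]
  have hbS : bumpExp a S i = a := by simp [bumpExp, hi]
  have hI := integrable_lagWeight (zero_le_one.trans hγ.le) (hnn (insert i S))
  have hI' := integrable_lagWeight (zero_le_one.trans hγ.le) (hnn S)
  have hae : (fun x => lagWeight γ (bumpExp a (insert i S)) x *
      (bumpExp a (insert i S) i / x i - 1)) =ᵐ[orthant (Fin (n + 1))] fun x =>
      (a + 1) * lagWeight γ (bumpExp a S) x - lagWeight γ (bumpExp a (insert i S)) x := by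
    filter_upwards [ae_orthant_pos] with x hx
    rw [hbi, bumpExp_insert a hi, lagWeight_add_one (hx i)]
    have := (hx i).ne'
    field_simp
  have key := integral_lagWeight_mul_score hγ (hnn (insert i S)) i
    (((hI'.const_mul _).sub hI).congr hae.symm)
  rw [integral_congr_ae hae, integral_sub (hI'.const_mul _) hI, integral_const_mul] at key
  have hbd : ∀ y : Fin n → ℝ, lagWeight γ (bumpExp a (insert i S)) (i.insertNth 0 y) = 0 :=
    fun y => by
      rw [lagWeight, Finset.prod_eq_zero (Finset.mem_univ i), zero_mul]
      rw [Fin.insertNth_apply_same, hbi, Real.zero_rpow (by linarith), zero_mul]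
  have hT : ∀ j, 2 * γ * ∫ x, lagWeight γ (bumpExp a (insert i S)) x / (x i - x j)
      ∂orthant (Fin (n + 1)) = if j ∈ (insert i S)ᶜ then
        γ * ∫ x, lagWeight γ (bumpExp a S) x ∂orthant (Fin (n + 1)) else 0 := fun j => by
    by_cases hj : j ∈ insert i S
    · rw [if_neg fun h => Finset.mem_compl.mp h hj]
      rw [integral_lagWeight_div_of_eq (by rw [hbi, bumpExp, if_pos hj]), mul_zero]
    · rw [if_pos (Finset.mem_compl.mpr hj)]
      rw [Finset.mem_insert, not_or] at hj
      rw [bumpExp_insert a hi, integral_lagWeight_div_of_eq_add_one hγ (hnn S) (Ne.symm hj.1)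
        (by rw [hbS, bumpExp, if_neg hj.2])]
      ring
  simp_rw [hbd, hT] at key
  rw [Finset.sum_ite_mem, Finset.univ_inter, Finset.sum_const, Finset.card_compl,
    Finset.card_insert_of_notMem hi, Fintype.card_fin, nsmul_eq_mul, integral_zero, neg_zero] at key
  have hc : S.card + 1 ≤ n + 1 := by
    simpa [Finset.card_insert_of_notMem hi] using (insert i S).card_le_univ
  rw [Nat.cast_sub hc] at key
  push_cast at key
  linarith

lemma lagInt_add_one (n : ℕ) {γ a : ℝ} (hγ : 1 < γ) (ha : 0 ≤ a) :
    lagInt n γ (a + 1) = (∏ j ∈ Finset.range n, (a + 1 + γ * j)) * lagInt n γ a := by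
  rcases n with _ | n
  · simp [lagInt, lagWeight]
  have h : ∀ S : Finset (Fin (n + 1)), ∫ x, lagWeight γ (bumpExp a S) x ∂orthant (Fin (n + 1)) =
      (∏ r ∈ Finset.range S.card, (a + 1 + γ * (n - r))) * lagInt (n + 1) γ a := by
    intro S
    induction S using Finset.induction_on with
    | empty => simp [lagInt, show bumpExp a (∅ : Finset (Fin (n + 1))) = fun _ => a by ext; simp [bumpExp]]
    | insert i S hi ih =>
      rw [integral_lagWeight_bumpExp_insert hγ ha hi, ih, Finset.card_insert_of_notMem hi,
        Finset.prod_range_succ]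
      ring
  have h1 := h Finset.univ
  rw [show bumpExp a (Finset.univ : Finset (Fin (n + 1))) = fun _ => a + 1 by ext; simp [bumpExp],
    Finset.card_univ, Fintype.card_fin] at h1
  rw [lagInt, h1, ← Finset.prod_range_reflect]
  congr 1
  refine Finset.prod_congr rfl fun j hj => ?_
  rw [Finset.mem_range] at hj
  rw [Nat.add_sub_cancel, Nat.cast_sub (by omega)]
  ring

lemma pairProd_cons_zero {n : ℕ} {γ : ℝ} {y : Fin n → ℝ} (hy : ∀ k, 0 < y k) :
    pairProd γ ((0 : Fin (n + 1)).insertNth 0 y) = (∏ k, y k ^ (2 * γ)) * pairProd γ y := by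
  have h0 : ∀ k : Fin n, (Fin.succ k = 0) = False := fun k => by simp [Fin.succ_ne_zero]
  have h0' : ∀ k : Fin n, (0 = Fin.succ k) = False := fun k => by simp [(Fin.succ_ne_zero k).symm]
  simp only [pairProd, Fin.prod_univ_succ, Fin.insertNth_zero', Fin.cons_zero, Fin.cons_succ, h0,
    h0', if_true, if_false, Fin.succ_inj, one_mul, Finset.prod_mul_distrib, zero_sub, abs_neg,
    sub_zero]
  rw [← mul_assoc, ← Finset.prod_mul_distrib]
  congr 1
  refine Finset.prod_congr rfl fun k _ => ?_
  rw [abs_of_pos (hy k), ← Real.rpow_add (hy k), two_mul]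

/-- Integrating out the smallest scale: exponent `0` in `n + 1` variables reduces to `n`. -/
lemma lagInt_succ_zero (n : ℕ) {γ : ℝ} (hγ : 1 < γ) : lagInt (n + 1) γ 0 = lagInt n γ (2 * γ) := by
  have hI := integrable_lagWeight (ι := Fin (n + 1)) (zero_le_one.trans hγ.le)
    (b := fun _ => 0) fun _ => le_rfl
  have key := integral_lagWeight_mul_score hγ (b := fun _ : Fin (n + 1) => 0) (fun _ => le_rfl) 0
    (by simpa using hI.neg)
  simp only [integral_lagWeight_div_of_eq (b := fun _ : Fin (n + 1) => (0 : ℝ)) rfl, mul_zero,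
    Finset.sum_const_zero, zero_div, zero_sub, mul_neg, mul_one, integral_neg, add_zero,
    neg_inj] at key
  rw [lagInt, key, lagInt]
  refine integral_congr_ae ?_
  filter_upwards [ae_orthant_pos] with y hy
  rw [lagWeight, pairProd_cons_zero hy, lagWeight, Fin.prod_univ_succ, ← mul_assoc]
  simp [Finset.prod_mul_distrib, mul_comm]

lemma pairProd_add_mul {γ R : ℝ} (hR : 0 ≤ R) (c : ℝ) (y : ι → ℝ) :
    pairProd γ (fun i => c + R * y i) =
      (R ^ γ) ^ (Fintype.card ι * (Fintype.card ι - 1)) * pairProd γ y := by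
  have h : ∀ i j : ι, (if i = j then 1 else |c + R * y i - (c + R * y j)| ^ γ) =
      (if i = j then 1 else R ^ γ) * (if i = j then 1 else |y i - y j| ^ γ) := fun i j => by
    split_ifs
    · simp
    · rw [← Real.mul_rpow hR (abs_nonneg _)]
      congr 1
      rw [show c + R * y i - (c + R * y j) = R * (y i - y j) by ring, abs_mul, abs_of_nonneg hR]
  have h' : ∀ i : ι, ∏ j, (if i = j then 1 else R ^ γ) = (R ^ γ) ^ (Fintype.card ι - 1) :=
    fun i => by
      rw [← Finset.mul_prod_erase _ _ (Finset.mem_univ i), if_pos rfl, one_mul,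
        Finset.prod_congr rfl (g := fun _ => R ^ γ) fun j hj => if_neg
          (Finset.ne_of_mem_erase hj).symm, Finset.prod_const,
        Finset.card_erase_of_mem (Finset.mem_univ i), Finset.card_univ]
  simp only [pairProd, h, Finset.prod_mul_distrib, h', Finset.prod_const, Finset.card_univ]
  rw [← pow_mul, mul_comm (Fintype.card ι)]

/-- The rescaled Gamma density, up to a constant factor, centred at `m` with width `√m`. -/
noncomputable def scaledGamma (a : ℝ) (m : ℕ) (y : ℝ) : ℝ :=
  if 0 < 1 + y / √m then
    (1 + y / √m) ^ a * Real.exp (m * (Real.log (1 + y / √m) - y / √m)) else 0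

lemma scaledGamma_nonneg (a : ℝ) (m : ℕ) (y : ℝ) : 0 ≤ scaledGamma a m y := by
  unfold scaledGamma
  split_ifs <;> positivity

lemma measurable_scaledGamma (a : ℝ) (m : ℕ) : Measurable (scaledGamma a m) := by
  unfold scaledGamma
  exact Measurable.ite (measurableSet_lt (by fun_prop) (by fun_prop)) (by fun_prop) (by fun_prop)

lemma rpow_mul_exp_eq_scaledGamma (a : ℝ) {m : ℕ} (hm : 0 < m) (y : ℝ) :
    (if 0 < m + √m * y then (m + √m * y) ^ (a + m) * Real.exp (-(m + √m * y)) else 0) =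
      ((m : ℝ) ^ a * ((m : ℝ) ^ m * Real.exp (-m))) * scaledGamma a m y := by
  have hm' : (0 : ℝ) < m := Nat.cast_pos.mpr hm
  have hs : 0 < √(m : ℝ) := Real.sqrt_pos.mpr hm'
  have hss : √(m : ℝ) * √m = m := Real.mul_self_sqrt hm'.le
  have hu : (m : ℝ) * (y / √m) = √m * y := by
    rw [mul_div_assoc', div_eq_iff hs.ne', ← hss]; rw [hss]; linear_combination -y * hss
  have hfac : (m : ℝ) + √m * y = m * (1 + y / √m) := by rw [mul_add, hu, mul_one]
  unfold scaledGamma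
  rw [hfac]
  by_cases h : 0 < 1 + y / √(m : ℝ)
  · rw [if_pos h, if_pos (mul_pos hm' h), Real.mul_rpow hm'.le h.le, Real.rpow_add hm',
      Real.rpow_add h, Real.rpow_natCast, mul_sub, Real.exp_sub, Real.rpow_natCast,
      mul_comm (m : ℝ) (Real.log _), Real.exp_mul, Real.exp_log h, Real.rpow_natCast, mul_add,
      mul_one, neg_add, Real.exp_add, Real.exp_neg (_ * (y / √(m : ℝ)))]
    ring
  · rw [if_neg h, if_neg fun h' => h ((mul_pos_iff_of_pos_left hm').mp h'), mul_zero]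

lemma log_one_add_le {u : ℝ} (hu : 0 < 1 + u) :
    Real.log (1 + u) ≤ u - u ^ 2 / (2 * (2 + u)) := by
  set r := √(1 + u) with hr
  have hr0 : 0 < r := Real.sqrt_pos.mpr hu
  have hr2 : r ^ 2 = 1 + u := Real.sq_sqrt hu.le
  have h1 : Real.log (1 + u) = 2 * Real.log r := by rw [← hr2, Real.log_pow]; norm_num
  have h2 := Real.log_le_sub_one_of_pos hr0
  have h3 : u = r ^ 2 - 1 := by linarith
  have h4 : u ^ 2 / (2 * (2 + u)) ≤ (r - 1) ^ 2 := by
    rw [div_le_iff₀ (by linarith), h3]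
    nlinarith [sq_nonneg ((r - 1) ^ 2), sq_nonneg (r - 1)]
  rw [h1]
  nlinarith

lemma scaledGamma_le {a : ℝ} (ha : 0 ≤ a) {m : ℕ} (hm : 0 < m) (y : ℝ) :
    scaledGamma a m y ≤ Real.exp 1 * expProfile a y := by
  have hm' : (1 : ℝ) ≤ m := Nat.one_le_cast.mpr hm
  have hs : 1 ≤ √(m : ℝ) := Real.one_le_sqrt.mpr hm'
  have hss : √(m : ℝ) ^ 2 = m := Real.sq_sqrt (by linarith)
  unfold scaledGamma
  split_ifs with h
  · set u := y / √(m : ℝ) with hu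
    have hy : y = u * √(m : ℝ) := by rw [hu]; field_simp
    have hmu : (m : ℝ) * u ^ 2 = y ^ 2 := by rw [hy, mul_pow, hss]; ring
    have huy : |u| ≤ |y| := by
      rw [hu, abs_div, abs_of_nonneg (by linarith : 0 ≤ √(m : ℝ))]
      exact div_le_self (abs_nonneg y) hs
    have hu' := le_abs_self u
    have h0 := abs_nonneg y
    have hexp : m * (Real.log (1 + u) - u) ≤ 1 + -|y| / 2 := by
      calc m * (Real.log (1 + u) - u) ≤ m * (-(u ^ 2 / (2 * (2 + u)))) := by
            gcongr; linarith [log_one_add_le h]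
        _ = -(y ^ 2 / (2 * (2 + u))) := by rw [← hmu]; ring
        _ ≤ -(y ^ 2 / (2 * (2 + |y|))) := by
            gcongr
            · linarith
            · exact hu'.trans huy
        _ ≤ 1 + -|y| / 2 := by
            have : (|y| - 2) / 2 ≤ y ^ 2 / (2 * (2 + |y|)) := by
              rw [le_div_iff₀ (by positivity)]
              nlinarith [sq_abs y]
            linarith
    unfold expProfile
    calc (1 + u) ^ a * Real.exp (m * (Real.log (1 + u) - u))
        ≤ (1 + |y|) ^ a * Real.exp (1 + -|y| / 2) := by
          gcongr
          exact hu'.trans huy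
      _ = _ := by rw [Real.exp_add]; ring
  · have := expProfile_nonneg a y
    positivity

lemma tendsto_scaledGamma (a y : ℝ) :
    Tendsto (fun m : ℕ => scaledGamma a m y) atTop (𝓝 (Real.exp (-y ^ 2 / 2))) := by
  have hsq : Tendsto (fun m : ℕ => √(m : ℝ)) atTop atTop :=
    Real.tendsto_sqrt_atTop.comp tendsto_natCast_atTop_atTop
  have hu : Tendsto (fun m : ℕ => y / √(m : ℝ)) atTop (𝓝 0) := hsq.const_div_atTop y
  have hu1 : Tendsto (fun m : ℕ => 1 + y / √(m : ℝ)) atTop (𝓝 1) := by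
    simpa using hu.const_add 1
  have hua : Tendsto (fun m : ℕ => |y / √(m : ℝ)|) atTop (𝓝 0) := by simpa using hu.abs
  have hlog : Tendsto (fun m : ℕ => (m : ℝ) * (Real.log (1 + y / √m) - y / √m)) atTop
      (𝓝 (-y ^ 2 / 2)) := by
    rw [← tendsto_sub_nhds_zero_iff]
    have hb : Tendsto (fun m : ℕ => |y| ^ 3 / √(m : ℝ) / (1 - |y / √(m : ℝ)|)) atTop (𝓝 0) := by
      have h := (hsq.const_div_atTop (|y| ^ 3)).div (hua.const_sub 1) (by norm_num)
      rw [zero_div] at h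
      exact h
    refine squeeze_zero_norm' ?_ hb
    filter_upwards [hua.eventually_lt_const zero_lt_one, eventually_gt_atTop 0] with m hlt hm
    have hm' : (0 : ℝ) < m := Nat.cast_pos.mpr hm
    have hs : 0 < √(m : ℝ) := Real.sqrt_pos.mpr hm'
    have hss : √(m : ℝ) ^ 2 = m := Real.sq_sqrt hm'.le
    have h := Real.abs_log_sub_add_sum_range_le (x := -(y / √(m : ℝ))) (by simpa using hlt) 2
    rw [abs_neg] at h
    simp only [Finset.sum_range_succ, Finset.sum_range_zero] at h
    norm_num at h
    rw [Real.norm_eq_abs]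
    have he : (m : ℝ) * (Real.log (1 + y / √m) - y / √m) - -y ^ 2 / 2 =
        m * (-(y / √m) + (y / √m) ^ 2 / 2 + Real.log (1 + y / √m)) := by
      have : (m : ℝ) * (y / √m) ^ 2 = y ^ 2 := by
        rw [div_pow, hss]; field_simp
      linear_combination -this / 2
    rw [he, abs_mul, abs_of_pos hm']
    refine (mul_le_mul_of_nonneg_left h hm'.le).trans (le_of_eq ?_)
    rw [abs_div, abs_of_pos hs, ← mul_div_assoc]
    congr 1
    rw [div_pow, mul_div_assoc', div_eq_div_iff (by positivity) hs.ne']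
    linear_combination -(|y| ^ 3 * √(m : ℝ)) * hss
  have hrp : Tendsto (fun m : ℕ => (1 + y / √(m : ℝ)) ^ a) atTop (𝓝 1) := by
    simpa using hu1.rpow_const (p := a) (Or.inl one_ne_zero)
  have h := hrp.mul ((Real.continuous_exp.tendsto _).comp hlog)
  rw [one_mul] at h
  refine h.congr' ?_
  filter_upwards [hu1.eventually_const_lt zero_lt_one] with m hm
  rw [scaledGamma, if_pos hm]
  rfl

/-- The Mehta integral for a real exponent, without its normalization. -/
noncomputable def gaussInt (n : ℕ) (γ : ℝ) : ℝ :=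
  ∫ y : Fin n → ℝ, (∏ i, Real.exp (-y i ^ 2 / 2)) * pairProd γ y

lemma tendsto_integral_scaledGamma (n : ℕ) {γ a : ℝ} (hγ : 0 ≤ γ) (ha : 0 ≤ a) :
    Tendsto (fun m : ℕ => ∫ y : Fin n → ℝ, (∏ i, scaledGamma a m (y i)) * pairProd γ y) atTop
      (𝓝 (gaussInt n γ)) := by
  set N : ℝ := 2 * γ * (Fintype.card (Fin n) * Fintype.card (Fin n) : ℕ)
  refine tendsto_integral_filter_of_dominated_convergence
    (fun y => Real.exp 1 ^ n * ∏ i, expProfile (a + N) (y i)) ?_ ?_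
    ((integrable_prod_expProfile _).const_mul _) ?_
  · refine Eventually.of_forall fun m => Measurable.aestronglyMeasurable ?_
    exact (Finset.measurable_prod _ fun i _ =>
      (measurable_scaledGamma a m).comp (measurable_pi_apply i)).mul (measurable_pairProd γ)
  · filter_upwards [eventually_gt_atTop 0] with m hm
    refine Eventually.of_forall fun y => ?_
    have h0 : 0 < prodOneAddAbs y := zero_lt_one.trans_le (one_le_prodOneAddAbs y)
    rw [Real.norm_of_nonneg (mul_nonneg (Finset.prod_nonneg fun i _ => scaledGamma_nonneg a m _)
      (pairProd_nonneg _ _)), ← prodOneAddAbs_rpow_mul, Real.rpow_add h0]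
    calc (∏ i, scaledGamma a m (y i)) * pairProd γ y
        ≤ (∏ i, Real.exp 1 * expProfile a (y i)) * prodOneAddAbs y ^ N := by
          refine mul_le_mul ?_ (pairProd_le hγ y) (pairProd_nonneg _ _) ?_
          · exact Finset.prod_le_prod (fun i _ => scaledGamma_nonneg a m _) fun i _ =>
              scaledGamma_le ha hm _
          · exact Finset.prod_nonneg fun i _ => mul_nonneg (Real.exp_pos 1).le
              (expProfile_nonneg _ _)
      _ = _ := by
          rw [Finset.prod_mul_distrib, ← prodOneAddAbs_rpow_mul, Finset.prod_const,
            Finset.card_univ, Fintype.card_fin]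
          ring
  · refine Eventually.of_forall fun y => Tendsto.mul_const _ ?_
    exact tendsto_finsetProd _ fun i _ => tendsto_scaledGamma a (y i)

lemma lagInt_eq_scaled (n : ℕ) (γ a : ℝ) {m : ℕ} (hm : 0 < m) :
    lagInt n γ (a + m) = (√m * ((m : ℝ) ^ a * ((m : ℝ) ^ m * Real.exp (-m)))) ^ n *
      (√m ^ γ) ^ (n * (n - 1)) *
      ∫ y : Fin n → ℝ, (∏ i, scaledGamma a m (y i)) * pairProd γ y := by
  have hs : 0 < √(m : ℝ) := Real.sqrt_pos.mpr (Nat.cast_pos.mpr hm)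
  let F : (Fin n → ℝ) → ℝ := fun x =>
    (∏ i, if 0 < x i then x i ^ (a + m) * Real.exp (-x i) else 0) * pairProd γ x
  have h1 : lagInt n γ (a + m) = ∫ x, F x := by
    rw [lagInt, orthant_eq_restrict, ← integral_indicator measurableSet_posOrthant]
    congr 1
    ext x
    by_cases hx : ∀ i, 0 < x i
    · rw [indicator_of_mem (by simpa using hx)]
      simp [F, lagWeight, hx]
    · rw [indicator_of_notMem (by simpa using hx)]
      push Not at hx
      obtain ⟨i, hi⟩ := hx
      simp only [F]
      rw [Finset.prod_eq_zero (Finset.mem_univ i) (if_neg hi.not_gt), zero_mul]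
  have h2 : ∫ x, F x = √(m : ℝ) ^ n * ∫ y : Fin n → ℝ, F (fun i => m + √m * y i) := by
    have h3 := Measure.integral_comp_smul (volume : Measure (Fin n → ℝ))
      (fun x => F ((fun _ => (m : ℝ)) + x)) √(m : ℝ)
    rw [integral_add_left_eq_self F, Module.finrank_fintype_fun_eq_card, Fintype.card_fin,
      abs_of_pos (by positivity), smul_eq_mul] at h3
    have h4 : ∀ y : Fin n → ℝ, (fun i => (m : ℝ) + √m * y i) = (fun _ => (m : ℝ)) + √(m : ℝ) • y :=
      fun y => by ext i; simp
    simp_rw [h4, h3]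
    rw [mul_inv_cancel_left₀ (by positivity)]
  rw [h1, h2]
  simp only [F, rpow_mul_exp_eq_scaledGamma a hm, pairProd_add_mul hs.le, Fintype.card_fin,
    Finset.prod_mul_distrib, Finset.prod_const, Finset.card_univ]
  rw [mul_pow, mul_pow, mul_pow, ← integral_const_mul, ← integral_const_mul]
  congr 1
  ext y
  ring

lemma lagInt_add_natCast (n : ℕ) {γ a : ℝ} (hγ : 1 < γ) (ha : 0 ≤ a) (k : ℕ) :
    lagInt n γ (a + k) =
      (∏ j ∈ Finset.range n, ∏ i ∈ Finset.range k, (a + 1 + γ * j + i)) * lagInt n γ a := by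
  induction k with
  | zero => simp
  | succ k ih =>
    rw [Nat.cast_succ, ← add_assoc, lagInt_add_one n hγ (by positivity), ih, ← mul_assoc]
    simp_rw [Finset.prod_range_succ, Finset.prod_mul_distrib]
    rw [mul_comm (∏ j ∈ Finset.range n, _)]
    congr 2
    exact Finset.prod_congr rfl fun j _ => by ring

lemma lagInt_eq (n : ℕ) {γ a : ℝ} (hγ : 1 < γ) (ha : 0 ≤ a) :
    lagInt n γ a = (∏ j ∈ Finset.range n, Real.Gamma (a + 1 + γ * j)) *
      ((√(2 * Real.pi))⁻¹ ^ n * gaussInt n γ) := by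
  have hst : Tendsto (fun m : ℕ => (√2 * Stirling.stirlingSeq m)⁻¹) atTop
      (𝓝 (√(2 * Real.pi))⁻¹) := by
    rw [Real.sqrt_mul zero_le_two]
    exact (Stirling.tendsto_stirlingSeq_sqrt_pi.const_mul _).inv₀ (by positivity)
  have hG := tendsto_finsetProd (Finset.range n) fun j _ =>
    Real.GammaSeq_tendsto_Gamma (a + 1 + γ * j)
  have hlim := hG.mul ((hst.pow n).mul
    (tendsto_integral_scaledGamma n (zero_le_one.trans hγ.le) (by linarith : 0 ≤ a + 1)))
  refine tendsto_nhds_unique (tendsto_const_nhds.congr' ?_) hlim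
  filter_upwards [eventually_gt_atTop 0] with m hm
  have hm' : (0 : ℝ) < m := Nat.cast_pos.mpr hm
  have hs : 0 < √(m : ℝ) := Real.sqrt_pos.mpr hm'
  have h1 := lagInt_add_natCast n hγ ha (m + 1)
  rw [Nat.cast_succ, show a + ((m : ℝ) + 1) = a + 1 + m by ring, lagInt_eq_scaled n γ (a + 1) hm]
    at h1
  have hP : ∀ j : ℕ, 0 < ∏ i ∈ Finset.range (m + 1), (a + 1 + γ * j + i) := fun j =>
    Finset.prod_pos fun i _ => by positivity
  have hprod : ∏ j ∈ Finset.range n, Real.GammaSeq (a + 1 + γ * j) m =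
      ((m : ℝ) ^ (a + 1)) ^ n * (√m ^ γ) ^ (n * (n - 1)) * (m.factorial : ℝ) ^ n /
        ∏ j ∈ Finset.range n, ∏ i ∈ Finset.range (m + 1), (a + 1 + γ * j + i) := by
    have h2 : (√(m : ℝ) ^ γ) ^ 2 = (m : ℝ) ^ γ := by
      rw [← Real.rpow_natCast, ← Real.rpow_mul hs.le, mul_comm, Real.rpow_mul hs.le,
        Real.rpow_natCast, Real.sq_sqrt hm'.le]
    simp only [Real.GammaSeq, Finset.prod_div_distrib, Finset.prod_mul_distrib, Finset.prod_const,
      Finset.card_range, Real.rpow_add hm' _ (γ * _), Real.rpow_mul hm'.le γ, Real.rpow_natCast]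
    rw [Finset.prod_pow_eq_pow_sum, ← h2, ← pow_mul, mul_comm 2, Finset.sum_range_id_mul_two]
  have hst' : (√2 * Stirling.stirlingSeq m)⁻¹ =
      √m * ((m : ℝ) ^ m * Real.exp (-m)) / m.factorial := by
    rw [Stirling.stirlingSeq, Real.sqrt_mul zero_le_two, div_pow, ← Real.exp_nat_mul, mul_one,
      Real.exp_neg]
    field_simp
  have hPn : ∏ j ∈ Finset.range n, ∏ i ∈ Finset.range (m + 1), (a + 1 + γ * j + i) ≠ 0 :=
    (Finset.prod_pos fun j _ => hP j).ne'
  have hf : (m.factorial : ℝ) ^ n * (√m * ((m : ℝ) ^ m * Real.exp (-m)) / m.factorial) ^ n =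
      (√m * ((m : ℝ) ^ m * Real.exp (-m))) ^ n := by
    rw [← mul_pow, mul_div_cancel₀ _ (by positivity)]
  rw [hprod, hst', eq_comm, div_mul_eq_mul_div, div_eq_iff hPn, mul_comm (lagInt n γ a), ← h1,
    mul_assoc _ ((m.factorial : ℝ) ^ n), ← mul_assoc ((m.factorial : ℝ) ^ n), hf]
  simp only [mul_pow]
  ring

/-- Mehta's integral for a real exponent `k > 1`. -/
lemma gaussInt_eq (n : ℕ) {k : ℝ} (hk : 1 < k) :
    (√(2 * Real.pi))⁻¹ ^ n * gaussInt n k =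
      ∏ j ∈ Finset.range n, Real.Gamma (1 + k * (j + 1)) / Real.Gamma (1 + k) := by
  induction n with
  | zero =>
    rw [gaussInt, Measure.volume_pi_eq_dirac 0]
    simp [pairProd]
  | succ n ih =>
    have hpos : ∀ x : ℝ, 0 < x → Real.Gamma x ≠ 0 := fun x hx => (Real.Gamma_pos_of_pos hx).ne'
    have h := lagInt_succ_zero n hk
    rw [lagInt_eq _ hk le_rfl, lagInt_eq _ hk (by linarith), ih, Finset.prod_div_distrib,
      Finset.prod_range_succ'] at h
    have h1 : ∀ j : ℕ, 2 * k + 1 + k * j = 1 + k * ((j + 1 : ℕ) + 1) := fun j => by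
      push_cast; ring
    have hP : ∏ j ∈ Finset.range n, Real.Gamma (1 + k * (j + 1)) ≠ 0 :=
      Finset.prod_ne_zero_iff.mpr fun j _ => hpos _ (by positivity)
    simp only [h1, Nat.cast_succ, Nat.cast_zero, mul_zero, add_zero, zero_add, Real.Gamma_one, mul_one] at h
    rw [Finset.prod_div_distrib, Finset.prod_range_succ']
    simp only [Nat.cast_succ, Nat.cast_zero, zero_add, mul_one, Finset.prod_const, Finset.card_range] at h ⊢
    have hg := hpos (1 + k) (by linarith)
    have h3 : (√(2 * Real.pi))⁻¹ ^ (n + 1) * gaussInt (n + 1) k =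
      (∏ j ∈ Finset.range n, Real.Gamma (1 + k * (j + 1 + 1))) / Real.Gamma (1 + k) ^ n :=
      mul_left_cancel₀ hP (by rw [h]; ring)
    rw [h3, pow_succ]
    field_simp

lemma integrable_gauss_mul_pairProd {γ : ℝ} (hγ : 0 ≤ γ) :
    Integrable (fun x : ι → ℝ => (∏ i, Real.exp (-x i ^ 2 / 2)) * pairProd γ x) := by
  set s : ℝ := 2 * γ * (Fintype.card ι * Fintype.card ι : ℕ)
  refine ((integrable_prod_expProfile (ι := ι) s).const_mul
    (∏ _i : ι, Real.exp (1 / 8))).mono' ?_ (Eventually.of_forall fun x => ?_)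
  · exact ((Finset.measurable_prod _ fun i _ => by fun_prop).mul
      (measurable_pairProd γ)).aestronglyMeasurable
  · have h0 : 0 ≤ ∏ i, Real.exp (-x i ^ 2 / 2) := by positivity
    rw [Real.norm_of_nonneg (mul_nonneg h0 (pairProd_nonneg γ x)), ← prodOneAddAbs_rpow_mul]
    have h1 : ∏ i, Real.exp (-x i ^ 2 / 2) ≤ ∏ i, (Real.exp (1 / 8) * Real.exp (-|x i| / 2)) := by
      refine Finset.prod_le_prod (fun i _ => by positivity) fun i _ => ?_
      rw [← Real.exp_add, Real.exp_le_exp]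
      nlinarith [sq_nonneg (|x i| - 1 / 2), sq_abs (x i)]
    rw [Finset.prod_mul_distrib] at h1
    calc _ ≤ _ := mul_le_mul h1 (pairProd_le hγ x) (pairProd_nonneg γ x) (by positivity)
      _ = _ := by ring

/-- The unnormalized standard Gaussian measure on `ι → ℝ`. -/
noncomputable def gaussMeasure (ι : Type*) [Fintype ι] : Measure (ι → ℝ) :=
  volume.withDensity fun x => ENNReal.ofReal (∏ i, Real.exp (-x i ^ 2 / 2))

lemma measurable_prod_gauss {ι : Type*} [Fintype ι] :
    Measurable fun x : ι → ℝ => ENNReal.ofReal (∏ i, Real.exp (-x i ^ 2 / 2)) :=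
  (Finset.measurable_prod _ fun i _ => by fun_prop).ennreal_ofReal

lemma integral_gaussMeasure {ι E : Type*} [Fintype ι] [NormedAddCommGroup E] [NormedSpace ℝ E]
    (f : (ι → ℝ) → E) :
    ∫ x, f x ∂gaussMeasure ι = ∫ x, (∏ i, Real.exp (-x i ^ 2 / 2)) • f x := by
  rw [gaussMeasure, integral_withDensity_eq_integral_toReal_smul measurable_prod_gauss
    (Eventually.of_forall fun _ => ENNReal.ofReal_lt_top)]
  congr with x
  rw [ENNReal.toReal_ofReal (by positivity)]

lemma integrable_pairProd_gaussMeasure {γ : ℝ} (hγ : 0 ≤ γ) :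
    Integrable (pairProd γ) (gaussMeasure ι) := by
  rw [gaussMeasure, integrable_withDensity_iff_integrable_smul' measurable_prod_gauss
    (Eventually.of_forall fun _ => ENNReal.ofReal_lt_top)]
  refine (integrable_gauss_mul_pairProd hγ).congr (Eventually.of_forall fun x => ?_)
  dsimp only
  rw [smul_eq_mul, ENNReal.toReal_ofReal (by positivity)]

lemma ae_injective : ∀ᵐ x : ι → ℝ, Function.Injective x := by
  have h : ∀ i j : ι, ∀ᵐ x : ι → ℝ, i ≠ j → x i ≠ x j := by
    intro i j
    by_cases hij : i = j
    · simp [hij]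
    let L : (ι → ℝ) →ₗ[ℝ] ℝ := LinearMap.proj (R := ℝ) (φ := fun _ : ι => ℝ) i -
      LinearMap.proj (R := ℝ) (φ := fun _ : ι => ℝ) j
    have hL : LinearMap.ker L ≠ ⊤ := by
      intro hT
      have := LinearMap.mem_ker.mp (hT ▸ Submodule.mem_top : Pi.single i 1 ∈ LinearMap.ker L)
      simp [L, Ne.symm hij] at this
    have h0 := Measure.addHaar_submodule (volume : Measure (ι → ℝ)) _ hL
    filter_upwards [measure_eq_zero_iff_ae_notMem.mp h0] with x hx _ he
    exact hx (by simp [L, he])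
  filter_upwards [ae_all_iff.mpr fun i => ae_all_iff.mpr fun j => h i j] with x hx i j he
  by_contra hij
  exact hx i j hij he

lemma ae_injective_gaussMeasure : ∀ᵐ x ∂gaussMeasure ι, Function.Injective x :=
  withDensity_absolutelyContinuous _ _ ae_injective

lemma pairProd_one_pos {x : ι → ℝ} (hx : Function.Injective x) : 0 < pairProd 1 x := by
  refine Finset.prod_pos fun i _ => Finset.prod_pos fun j _ => ?_
  split_ifs with h
  · exact one_pos
  · exact Real.rpow_pos_of_pos (abs_pos.mpr (sub_ne_zero.mpr (hx.ne h))) _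

lemma exp_mul_log_pairProd_one (t : ℝ) {x : ι → ℝ} (hx : Function.Injective x) :
    Real.exp (t * Real.log (pairProd 1 x)) = pairProd t x := by
  rw [mul_comm, ← Real.rpow_def_of_pos (pairProd_one_pos hx)]
  unfold pairProd
  rw [← Real.finsetProd_rpow _ _ fun i _ => Finset.prod_nonneg fun j _ => by split_ifs <;> positivity]
  refine Finset.prod_congr rfl fun i _ => ?_
  rw [← Real.finsetProd_rpow _ _ fun j _ => by split_ifs <;> positivity]
  refine Finset.prod_congr rfl fun j _ => ?_
  split_ifs <;> simp

lemma log_pairProd_one {ι : Type*} [Fintype ι] [LinearOrder ι] {x : ι → ℝ}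
    (hx : Function.Injective x) :
    Real.log (pairProd 1 x) = 2 * ∑ p : ι × ι with p.1 < p.2, Real.log |x p.1 - x p.2| := by
  have h0 : ∀ i j : ι, (if i = j then (1 : ℝ) else |x i - x j| ^ (1 : ℝ)) ≠ 0 := fun i j => by
    split_ifs with h
    · exact one_ne_zero
    · simpa [sub_eq_zero] using hx.ne h
  unfold pairProd
  rw [Real.log_prod fun i _ => Finset.prod_ne_zero_iff.mpr fun j _ => h0 i j]
  have h1 : ∀ i j : ι, Real.log (if i = j then (1 : ℝ) else |x i - x j| ^ (1 : ℝ)) =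
      (if i < j then Real.log |x i - x j| else 0) + if j < i then Real.log |x j - x i| else 0 := by
    intro i j
    rcases lt_trichotomy i j with h | rfl | h
    · simp [h, h.ne, h.not_gt]
    · simp
    · simp [h, h.ne', h.not_gt, abs_sub_comm]
  simp_rw [Real.log_prod fun j _ => h0 _ j, h1, Finset.sum_add_distrib]
  rw [Finset.sum_comm (f := fun i j => if j < i then Real.log |x j - x i| else 0), ← two_mul,
    Finset.sum_filter, Fintype.sum_prod_type]

lemma prod_cpow_eq_exp {ι : Type*} [Fintype ι] [LinearOrder ι] {x : ι → ℝ}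
    (hx : Function.Injective x) (k : ℂ) :
    ∏ p : ι × ι with p.1 < p.2, ((|x p.1 - x p.2| : ℝ) : ℂ) ^ (2 * k) =
      Complex.exp (k * (Real.log (pairProd 1 x) : ℝ)) := by
  rw [log_pairProd_one hx]
  push_cast
  rw [Finset.mul_sum, Finset.mul_sum, Complex.exp_sum]
  refine Finset.prod_congr rfl fun p hp => ?_
  have h : |x p.1 - x p.2| ≠ 0 := by
    simpa [sub_eq_zero] using hx.ne (Finset.mem_filter.mp hp).2.ne
  rw [Complex.cpow_def_of_ne_zero (by exact_mod_cast h), ← Complex.ofReal_log (abs_nonneg _)]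
  congr 1
  ring

/-- The Mehta integral as the complex moment generating function of the logarithm of the squared
Vandermonde product. -/
noncomputable def mehtaMGF (n : ℕ) (k : ℂ) : ℂ :=
  ProbabilityTheory.complexMGF (fun x : Fin n → ℝ => Real.log (pairProd 1 x)) (gaussMeasure (Fin n)) k

lemma mehtaMGF_eq (n : ℕ) (k : ℂ) : mehtaMGF n k = ∫ x : Fin n → ℝ,
    (∏ p : Fin n × Fin n with p.1 < p.2, ((|x p.1 - x p.2| : ℝ) : ℂ) ^ (2 * k)) *
      Complex.exp (-(∑ i, ((x i : ℂ)) ^ 2) / 2) := by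
  rw [mehtaMGF, ProbabilityTheory.complexMGF, integral_gaussMeasure]
  refine integral_congr_ae ?_
  filter_upwards [ae_injective] with x hx
  rw [prod_cpow_eq_exp hx, Complex.real_smul, mul_comm, ← Real.exp_sum, Complex.ofReal_exp,
    neg_div, Finset.sum_div, ← Finset.sum_neg_distrib]
  push_cast
  simp only [neg_div]

lemma integrable_exp_mul_log_pairProd {t : ℝ} (ht : 0 ≤ t) :
    Integrable (fun x : ι → ℝ => Real.exp (t * Real.log (pairProd 1 x))) (gaussMeasure ι) := by
  refine (integrable_pairProd_gaussMeasure ht).congr ?_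
  filter_upwards [ae_injective_gaussMeasure] with x hx
  exact (exp_mul_log_pairProd_one t hx).symm

lemma mehtaMGF_ofReal (n : ℕ) (k : ℝ) : mehtaMGF n k = gaussInt n k := by
  rw [mehtaMGF, ProbabilityTheory.complexMGF_ofReal, ProbabilityTheory.mgf, gaussInt,
    integral_gaussMeasure]
  congr 1
  refine integral_congr_ae ?_
  filter_upwards [ae_injective] with x hx
  rw [exp_mul_log_pairProd_one k hx, smul_eq_mul]

lemma analyticOnNhd_mehtaMGF (n : ℕ) : AnalyticOnNhd ℂ (mehtaMGF n) {z | 0 < z.re} := by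
  refine ProbabilityTheory.analyticOnNhd_complexMGF.mono fun z hz => ?_
  exact interior_maximal (fun t ht => integrable_exp_mul_log_pairProd (le_of_lt ht)) isOpen_Ioi hz

lemma gammaRatio_re_pos {k : ℂ} (hk : 0 ≤ k.re) (j : ℕ) : 0 < (1 + k * (j + 1)).re := by
  have : (1 + k * (j + 1)).re = 1 + k.re * (j + 1) := by simp
  rw [this]
  positivity

lemma differentiableAt_prod_Gamma_div (n : ℕ) {k : ℂ} (hk : 0 ≤ k.re) :
    DifferentiableAt ℂ (fun k : ℂ => ∏ j ∈ Finset.range n,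
      Complex.Gamma (1 + k * (j + 1)) / Complex.Gamma (1 + k)) k := by
  have hG : ∀ z : ℂ, 0 < z.re → DifferentiableAt ℂ Complex.Gamma z := fun z hz =>
    Complex.differentiableAt_Gamma z fun m hm => by
      rw [hm] at hz
      simp at hz
      linarith [(Nat.cast_nonneg m : (0 : ℝ) ≤ m)]
  have h1 : 0 < (1 + k).re := by simp; linarith
  refine DifferentiableAt.fun_finsetProd fun j _ => DifferentiableAt.div ?_ ?_
    (Complex.Gamma_ne_zero_of_re_pos h1)
  · exact (hG _ (gammaRatio_re_pos hk j)).comp k (f := fun k : ℂ => 1 + k * (j + 1)) (by fun_prop)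
  · exact (hG _ h1).comp k (f := fun k : ℂ => 1 + k) (by fun_prop)

lemma mehtaMGF_eq_prod_of_re_pos (n : ℕ) {k : ℂ} (hk : 0 < k.re) :
    (((√(2 * Real.pi))⁻¹ ^ n : ℝ) : ℂ) * mehtaMGF n k =
      ∏ j ∈ Finset.range n, Complex.Gamma (1 + k * (j + 1)) / Complex.Gamma (1 + k) := by
  have hopen : IsOpen {z : ℂ | 0 < z.re} := isOpen_lt continuous_const Complex.continuous_re
  refine AnalyticOnNhd.eqOn_of_preconnected_of_frequently_eq
    (f := fun k => (((√(2 * Real.pi))⁻¹ ^ n : ℝ) : ℂ) * mehtaMGF n k) (z₀ := (2 : ℝ))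
    (analyticOnNhd_const.mul (analyticOnNhd_mehtaMGF n))
    (DifferentiableOn.analyticOnNhd (fun z hz =>
      (differentiableAt_prod_Gamma_div n (le_of_lt hz)).differentiableWithinAt) hopen)
    (convex_halfSpace_re_gt 0).isPreconnected (by simp) ?_ hk
  have hlim : Tendsto (fun x : ℝ => (x : ℂ)) (𝓝[≠] 2) (𝓝[≠] ((2 : ℝ) : ℂ)) :=
    tendsto_nhdsWithin_of_tendsto_nhds_of_eventually_within _
      (Complex.continuous_ofReal.tendsto' _ _ rfl |>.mono_left nhdsWithin_le_nhds)
      (eventually_mem_nhdsWithin.mono fun x hx => Complex.ofReal_injective.ne hx)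
  refine hlim.frequently (Eventually.frequently ?_)
  filter_upwards [nhdsWithin_le_nhds (lt_mem_nhds (by norm_num : (1 : ℝ) < 2))] with x hx
  rw [mehtaMGF_ofReal, ← Complex.ofReal_mul, gaussInt_eq n hx]
  push_cast [← Complex.Gamma_ofReal]
  rfl

lemma tendsto_mehtaMGF_add (n : ℕ) {k : ℂ} (hk : 0 ≤ k.re) :
    Tendsto (fun ε : ℝ => mehtaMGF n (k + ε)) (𝓝[>] 0) (𝓝 (mehtaMGF n k)) := by
  unfold mehtaMGF ProbabilityTheory.complexMGF
  have hm : Measurable fun x : Fin n → ℝ => Real.log (pairProd 1 x) :=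
    (measurable_pairProd 1).log
  refine tendsto_integral_filter_of_dominated_convergence
    (fun x => Real.exp (k.re * Real.log (pairProd 1 x)) +
      Real.exp ((k.re + 1) * Real.log (pairProd 1 x)))
    (Eventually.of_forall fun ε =>
      (Complex.measurable_exp.comp (hm.complex_ofReal.const_mul _)).aestronglyMeasurable) ?_
    ((integrable_exp_mul_log_pairProd hk).add (integrable_exp_mul_log_pairProd (by linarith)))
    (Eventually.of_forall fun x => ?_)
  · filter_upwards [Ioc_mem_nhdsGT one_pos] with ε hε
    refine Eventually.of_forall fun x => ?_
    rw [Complex.norm_exp]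
    simp only [Complex.mul_re, Complex.add_re, Complex.ofReal_re, Complex.ofReal_im, mul_zero,
      sub_zero]
    rcases le_total 0 (Real.log (pairProd 1 x)) with h | h
    · refine le_add_of_nonneg_of_le (Real.exp_pos _).le (Real.exp_le_exp.mpr ?_)
      exact mul_le_mul_of_nonneg_right (by linarith [hε.2]) h
    · refine le_add_of_le_of_nonneg (Real.exp_le_exp.mpr ?_) (Real.exp_pos _).le
      exact mul_le_mul_of_nonpos_right (by linarith [hε.1]) h
  · have hc : Continuous fun ε : ℝ => Complex.exp ((k + ε) * (Real.log (pairProd 1 x) : ℝ)) := by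
      fun_prop
    exact (hc.tendsto' 0 _ (by simp)).mono_left nhdsWithin_le_nhds

lemma mehtaMGF_eq_prod (n : ℕ) {k : ℂ} (hk : 0 ≤ k.re) :
    (((√(2 * Real.pi))⁻¹ ^ n : ℝ) : ℂ) * mehtaMGF n k =
      ∏ j ∈ Finset.range n, Complex.Gamma (1 + k * (j + 1)) / Complex.Gamma (1 + k) := by
  refine tendsto_nhds_unique ((tendsto_mehtaMGF_add n hk).const_mul _) ?_
  have hc : Tendsto (fun ε : ℝ => k + ε) (𝓝[>] 0) (𝓝 k) :=
    ((by fun_prop : Continuous fun ε : ℝ => k + ε).tendsto' 0 _ (by simp)).mono_left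
      nhdsWithin_le_nhds
  refine ((differentiableAt_prod_Gamma_div n hk).continuousAt.tendsto.comp hc).congr' ?_
  filter_upwards [self_mem_nhdsWithin] with ε hε
  refine (mehtaMGF_eq_prod_of_re_pos n ?_).symm
  simpa using add_pos_of_nonneg_of_pos hk hε

lemma two_pi_cpow_neg_div_two (n : ℕ) :
    ((2 * Real.pi : ℝ) : ℂ) ^ (-(n : ℂ) / 2) = (((√(2 * Real.pi))⁻¹ ^ n : ℝ) : ℂ) := by
  have h : (0 : ℝ) ≤ 2 * Real.pi := by positivity
  rw [Real.sqrt_eq_rpow, ← Real.rpow_neg h, ← Real.rpow_natCast, ← Real.rpow_mul h,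
    Complex.ofReal_cpow h]
  congr 1
  push_cast
  ring

end MehtaAux

open MeasureTheory Complex Finset

/-- The Mehta integral (Mehta conjecture, type `A_{n-1}`):
`(2π)^{-n/2} ∫_{ℝ^n} ∏_{i<j} |x_i - x_j|^{2k} e^{-|x|²/2} dx = ∏_{j=1}^n Γ(1+kj)/Γ(1+k)`
for complex `k` with `Re k ≥ 0`. -/
theorem mehta_integral (n : ℕ) (k : ℂ) (hk : 0 ≤ k.re) :
    ((2 * Real.pi : ℝ) : ℂ) ^ (-(n : ℂ) / 2) *
      ∫ x : Fin n → ℝ,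
        (∏ p ∈ Finset.univ.filter (fun p : Fin n × Fin n => p.1 < p.2),
          ((|x p.1 - x p.2| : ℝ) : ℂ) ^ (2 * k)) *
        Complex.exp (-(∑ i, ((x i : ℂ)) ^ 2) / 2)
      = ∏ j ∈ Finset.range n,
          Complex.Gamma (1 + k * (j + 1)) / Complex.Gamma (1 + k) := by
  rw [two_pi_cpow_neg_div_two, ← mehtaMGF_eq, mehtaMGF_eq_prod n hk]
end

section
/- Let W be a finite Coxeter group on ℝ^n with positive roots R_+ (normalized (α,α)=2), and for m ∈ ℤ define G_W(m) = ∫_{iξ+ℝ^n} ∏_{α∈R_+}(α,x)^{2m} dγ(x), with ξ not lying on any reflection hyperplane (and the branch for negative m as the meromorphic continuation). Then G_W(m)·G_W(−m) = (−1)^{m|R_+|}. -/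
open MeasureTheory Complex Finset

noncomputable section

/-- The standard dot product on `ℝ^n`. -/
def dotR {n : ℕ} (x y : Fin n → ℝ) : ℝ := ∑ i, x i * y i

/-- The set of orthogonal reflections `s_α : x ↦ x - (α,x)α` (for `(α,α)=2`)
in the hyperplanes orthogonal to the vectors of `R`. -/
def reflSet {n : ℕ} (R : Finset (Fin n → ℝ)) :
    Set ((Fin n → ℝ) ≃ₗ[ℝ] (Fin n → ℝ)) :=
  { e | ∃ α ∈ R, ∀ x, e x = x - dotR α x • α }

/-- The group generated by the reflections in the hyperplanes orthogonal to `R`. -/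
def coxGroup {n : ℕ} (R : Finset (Fin n → ℝ)) :
    Subgroup ((Fin n → ℝ) ≃ₗ[ℝ] (Fin n → ℝ)) :=
  Subgroup.closure (reflSet R)

/-- Data of a finite Coxeter group `W` acting on `ℝ^n`: a system `R` of positive
roots, normalised by `(α,α) = 2`, generating a finite reflection group, together
with the degrees `d j` of a system of basic homogeneous algebraically independent
generators `P j` of the algebra of `W`-invariant polynomials. -/
structure CoxeterData (n : ℕ) where
  /-- the positive roots -/
  R : Finset (Fin n → ℝ)
  norm2 : ∀ α ∈ R, dotR α α = 2
  noncollinear : ∀ α ∈ R, ∀ β ∈ R, α ≠ β → ∀ c : ℝ, β ≠ c • α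
  pos : ∃ v, ∀ α ∈ R, 0 < dotR α v
  finiteW : Finite (coxGroup R)
  stableR : ∀ e ∈ coxGroup R, ∀ α ∈ R, ((e : (Fin n → ℝ) ≃ₗ[ℝ] (Fin n → ℝ)) α ∈ R ∨
      -((e : (Fin n → ℝ) ≃ₗ[ℝ] (Fin n → ℝ)) α) ∈ R)
  /-- the degrees of the basic invariants -/
  d : Fin n → ℕ
  /-- the basic invariants -/
  P : Fin n → MvPolynomial (Fin n) ℝ
  homog : ∀ j, (P j).IsHomogeneous (d j)
  invP : ∀ j, ∀ e ∈ coxGroup R, ∀ x : Fin n → ℝ,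
    MvPolynomial.eval ((e : (Fin n → ℝ) ≃ₗ[ℝ] (Fin n → ℝ)) x) (P j) = MvPolynomial.eval x (P j)
  algInd : AlgebraicIndependent ℝ P
  gen : ∀ q : MvPolynomial (Fin n) ℝ,
    (∀ e ∈ coxGroup R, ∀ x : Fin n → ℝ,
      MvPolynomial.eval ((e : (Fin n → ℝ) ≃ₗ[ℝ] (Fin n → ℝ)) x) q = MvPolynomial.eval x q) →
    q ∈ Algebra.adjoin ℝ (Set.range P)

end

/-- A locally dominated integral of holomorphic functions depends holomorphically on the
parameter. -/
theorem differentiableAt_integral_of_dominated {X : Type*} [MeasurableSpace X] {μ : Measure X}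
    {f : ℂ → X → ℂ} {g : X → ℝ} {z : ℂ} (hg : Integrable g μ)
    (hm : ∀ᶠ w in nhds z, AEStronglyMeasurable (f w) μ)
    (hd : ∀ᶠ w in nhds z, ∀ x, DifferentiableAt ℂ (fun v => f v x) w)
    (hb : ∀ᶠ w in nhds z, ∀ x, ‖f w x‖ ≤ g x) :
    DifferentiableAt ℂ (fun w => ∫ x, f w x ∂μ) z := by
  obtain ⟨r, hr, H⟩ := Metric.eventually_nhds_iff_ball.1 (hd.and hb)
  have hr2 : 0 < r / 2 := by positivity
  have hmem : ∀ w ∈ Metric.ball z (r / 2), ∀ v ∈ Metric.closedBall w (r / 2),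
      v ∈ Metric.ball z r := by
    intro w hw v hv
    rw [Metric.mem_ball] at *
    rw [Metric.mem_closedBall] at hv
    linarith [dist_triangle v w z]
  have hderiv_bound : ∀ x, ∀ w ∈ Metric.ball z (r / 2),
      ‖deriv (fun v => f v x) w‖ ≤ g x / (r / 2) := by
    intro x w hw
    refine Complex.norm_deriv_le_of_forall_mem_sphere_norm_le hr2 ?_ ?_
    · refine DifferentiableOn.diffContOnCl ?_
      intro v hv
      exact ((H v (hmem w hw v (Metric.closure_ball_subset_closedBall hv))).1 x
        ).differentiableWithinAt
    · intro v hv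
      exact (H v (hmem w hw v (Metric.sphere_subset_closedBall hv))).2 x
  have hF' : AEStronglyMeasurable (fun x => deriv (fun v => f v x) z) μ := by
    obtain ⟨s, hs, Hs⟩ := Metric.eventually_nhds_iff_ball.1 hm
    set t := min s r / 2 with ht
    have htpos : 0 < t := by positivity
    have hts : t < s := by have := min_le_left s r; have := lt_min hs hr; linarith
    let u : ℕ → ℂ := fun j => ((t / (j + 1) : ℝ) : ℂ)
    have hu0 : ∀ j, u j ≠ 0 := fun j => by
      simp only [u, ne_eq, Complex.ofReal_eq_zero]; positivity
    have hlim : Filter.Tendsto u Filter.atTop (nhds 0) := by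
      have h1 := (tendsto_one_div_add_atTop_nhds_zero_nat (𝕜 := ℝ)).const_mul t
      have h2 := (Complex.continuous_ofReal.tendsto _).comp h1
      simp only [mul_zero, Complex.ofReal_zero] at h2
      refine h2.congr fun j => ?_
      simp only [Function.comp, u]; congr 1; ring
    refine aestronglyMeasurable_of_tendsto_ae Filter.atTop
      (f := fun j x => (u j)⁻¹ • (f (z + u j) x - f z x)) ?_ ?_
    · intro j
      suffices hj : z + u j ∈ Metric.ball z s from
        AEStronglyMeasurable.const_smul (𝕜 := ℂ) ((Hs _ hj).sub (Hs _ (Metric.mem_ball_self hs)))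
          (u j)⁻¹
      rw [Metric.mem_ball, dist_eq_norm, add_sub_cancel_left, Complex.norm_real, Real.norm_eq_abs,
        abs_of_pos (by positivity)]
      refine lt_of_le_of_lt ?_ hts
      exact div_le_self htpos.le (by linarith [(Nat.cast_nonneg j : (0 : ℝ) ≤ j)])
    · refine Filter.Eventually.of_forall fun x => ?_
      have h := ((H z (Metric.mem_ball_self hr)).1 x).hasDerivAt
      have h3 := hasDerivAt_iff_tendsto_slope_zero.1 h
      exact h3.comp (tendsto_nhdsWithin_iff.2 ⟨hlim, Filter.Eventually.of_forall hu0⟩)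
  have hfi : Integrable (f z) μ :=
    hg.mono' hm.self_of_nhds (Filter.Eventually.of_forall fun x =>
      (H z (Metric.mem_ball_self hr)).2 x)
  exact (hasDerivAt_integral_of_dominated_loc_of_deriv_le (Metric.ball_mem_nhds z hr2) hm hfi hF'
    (Filter.Eventually.of_forall hderiv_bound) (hg.div_const _)
    (Filter.Eventually.of_forall fun x w hw => ((H w (hmem w hw w
      (Metric.mem_closedBall_self hr2.le))).1 x).hasDerivAt)).2.differentiableAt

/-- A holomorphic function on a preconnected open set which is invariant under real translations
is constant. -/
theorem eq_of_real_translation_invariant {J : ℂ → ℂ} {U : Set ℂ} (hU : IsOpen U)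
    (hU' : IsPreconnected U) (hJ : DifferentiableOn ℂ J U)
    (htr : ∀ z ∈ U, ∀ r : ℝ, J (z + r) = J z) {z w : ℂ} (hz : z ∈ U) (hw : w ∈ U) :
    J z = J w := by
  refine hU.is_const_of_deriv_eq_zero hU' hJ ?_ hz hw
  intro v hv
  have h1 := (hJ.differentiableAt (hU.mem_nhds hv)).hasDerivAt
  have h2 : HasDerivAt (fun r : ℝ => v + (r : ℂ)) 1 0 :=
    (Complex.ofRealCLM.hasDerivAt (x := 0)).const_add v
  have h3 : HasDerivAt (fun r : ℝ => J (v + (r : ℂ))) (deriv J v * 1) 0 := by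
    refine HasDerivAt.comp (0 : ℝ) ?_ h2
    simpa using h1
  have h4 : (fun r : ℝ => J (v + (r : ℂ))) = fun _ => J v := funext fun r => htr v hv r
  rw [h4] at h3
  simpa using h3.unique (hasDerivAt_const (0 : ℝ) (J v))

/-- A bounded-on-the-real-line even entire function of exponential type, whose restriction to the
imaginary axis has arbitrarily small type, is constant. -/
theorem eq_of_even_of_bounded_real {h : ℂ → ℂ} (hd : Differentiable ℂ h)
    (heven : ∀ k, h (-k) = h k) {A B : ℝ} (hgrowth : ∀ k, ‖h k‖ ≤ A * Real.exp (B * ‖k‖))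
    (hreal : ∀ x : ℝ, ‖h x‖ ≤ A)
    (himag : ∀ ε > 0, ∃ M : ℝ, ∀ y : ℝ, 0 < y → ‖h (y * I)‖ ≤ M * Real.exp (ε * y)) (z w : ℂ) :
    h z = h w := by
  have key : ∀ ε > (0 : ℝ), ∀ z : ℂ, 0 ≤ z.re → ‖h (z * I)‖ ≤ A * Real.exp (ε * z.re) := by
    intro ε hε z hz
    obtain ⟨M, hM⟩ := himag ε hε
    have hre : ∀ v : ℂ, ‖Complex.exp (-(ε * v))‖ = Real.exp (-(ε * v.re)) := by
      intro v; rw [Complex.norm_exp]; simp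
    have := PhragmenLindelof.right_half_plane_of_bounded_on_real (C := A) (z := z)
      (f := fun v => Complex.exp (-(ε * v)) * h (v * I)) ?_ ?_ ?_ ?_ hz
    · rw [norm_mul, hre] at this
      have h2 := mul_le_mul_of_nonneg_left this (Real.exp_nonneg (ε * z.re))
      rw [← mul_assoc, ← Real.exp_add, add_neg_cancel, Real.exp_zero, one_mul] at h2
      linarith
    · refine Differentiable.diffContOnCl ?_
      fun_prop
    · refine ⟨1, by norm_num, B, ?_⟩
      refine Asymptotics.IsBigO.of_bound A ?_
      refine Filter.mem_inf_of_right ?_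
      intro v hv
      simp only [Set.mem_ofPred_eq] at hv ⊢
      rw [norm_mul, hre, Real.rpow_one, Real.norm_eq_abs, Real.abs_exp]
      have h1 : Real.exp (-(ε * v.re)) ≤ 1 := by
        rw [Real.exp_le_one_iff]; have := mul_pos hε hv; linarith
      have h2 := hgrowth (v * I)
      rw [norm_mul, Complex.norm_I, mul_one] at h2
      nlinarith [norm_nonneg (h (v * I)), Real.exp_nonneg (-(ε * v.re))]
    · refine ⟨M, ?_⟩
      rw [Filter.eventually_map]
      filter_upwards [Filter.eventually_gt_atTop (0 : ℝ)] with y hy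
      rw [norm_mul, hre, Complex.ofReal_re]
      have h2 := mul_le_mul_of_nonneg_left (hM y hy) (Real.exp_nonneg (-(ε * y)))
      rw [mul_left_comm, ← Real.exp_add, neg_add_cancel, Real.exp_zero, mul_one] at h2
      exact h2
    · intro x
      rw [norm_mul, hre]
      have h2 := hreal (-x)
      have h3 : (x : ℂ) * I * I = ((-x : ℝ) : ℂ) := by
        rw [mul_assoc, Complex.I_mul_I]; push_cast; ring
      rw [h3]
      simpa using h2
  have key2 : ∀ z : ℂ, 0 ≤ z.re → ‖h (z * I)‖ ≤ A := by
    intro z hz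
    have hlim : Filter.Tendsto (fun ε : ℝ => A * Real.exp (ε * z.re)) (nhdsWithin 0 (Set.Ioi 0))
        (nhds A) := by
      refine Filter.Tendsto.mono_left ?_ nhdsWithin_le_nhds
      exact Continuous.tendsto' (by fun_prop) _ _ (by simp)
    refine ge_of_tendsto hlim ?_
    filter_upwards [self_mem_nhdsWithin] with ε hε using key ε hε z hz
  have key3 : ∀ k, ‖h k‖ ≤ A := by
    intro k
    rcases le_total 0 (-(k * I)).re with h0 | h0
    · have := key2 _ h0
      rwa [neg_mul, mul_assoc, Complex.I_mul_I, mul_neg, mul_one, neg_neg] at this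
    · have := key2 (k * I) (by simpa using h0)
      rwa [mul_assoc, Complex.I_mul_I, mul_neg, mul_one, heven] at this
  refine hd.apply_eq_apply_of_bounded ?_ z w
  exact (isBounded_iff_forall_norm_le.2 ⟨A, by rintro _ ⟨k, rfl⟩; exact key3 k⟩)

section RootSystem

variable {n : ℕ}

theorem dotR_comm (x y : Fin n → ℝ) : dotR x y = dotR y x := by
  simp only [dotR, mul_comm]

theorem dotR_add (x y z : Fin n → ℝ) : dotR x (y + z) = dotR x y + dotR x z := by
  simp only [dotR, Pi.add_apply, mul_add, Finset.sum_add_distrib]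

theorem dotR_smul (x y : Fin n → ℝ) (c : ℝ) : dotR x (c • y) = c * dotR x y := by
  simp only [dotR, Pi.smul_apply, smul_eq_mul, Finset.mul_sum]
  exact Finset.sum_congr rfl fun i _ => by ring

theorem dotR_neg (x y : Fin n → ℝ) : dotR x (-y) = -dotR x y := by
  simp only [dotR, Pi.neg_apply, mul_neg, Finset.sum_neg_distrib]

theorem dotR_neg_left (x y : Fin n → ℝ) : dotR (-x) y = -dotR x y := by
  rw [dotR_comm, dotR_neg, dotR_comm]

theorem dotR_sub (x y z : Fin n → ℝ) : dotR x (y - z) = dotR x y - dotR x z := by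
  rw [sub_eq_add_neg, dotR_add, dotR_neg, sub_eq_add_neg]

theorem dotR_self_nonneg (x : Fin n → ℝ) : 0 ≤ dotR x x :=
  Finset.sum_nonneg fun i _ => mul_self_nonneg (x i)

@[fun_prop]
theorem continuous_dotR (x : Fin n → ℝ) : Continuous (dotR x) := by
  unfold dotR; fun_prop

@[fun_prop]
theorem continuous_dotR_self : Continuous fun x : Fin n → ℝ => dotR x x := by
  unfold dotR; fun_prop

/-- Pairing with a fixed vector, as a linear form. -/
def dotRLin (x : Fin n → ℝ) : (Fin n → ℝ) →ₗ[ℝ] ℝ where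
  toFun := dotR x
  map_add' := dotR_add x
  map_smul' c y := dotR_smul x y c

variable {R : Finset (Fin n → ℝ)}

theorem dotR_coxGroup (h2 : ∀ α ∈ R, dotR α α = 2) {e : (Fin n → ℝ) ≃ₗ[ℝ] (Fin n → ℝ)}
    (he : e ∈ coxGroup R) : ∀ x y, dotR (e x) (e y) = dotR x y := by
  induction he using Subgroup.closure_induction with
  | mem e he =>
    obtain ⟨α, hα, h⟩ := he
    intro x y
    rw [h, h, dotR_sub, dotR_smul, dotR_comm _ y, dotR_comm _ α, dotR_sub, dotR_sub, dotR_smul,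
      dotR_smul, h2 α hα, dotR_comm y x, dotR_comm y α]
    ring
  | one => intro x y; rfl
  | mul a b _ _ ha hb => intro x y; rw [LinearEquiv.mul_apply, LinearEquiv.mul_apply, ha, hb]
  | inv a _ ha =>
    intro x y
    rw [← ha, ← LinearEquiv.mul_apply, ← LinearEquiv.mul_apply, mul_inv_cancel]; rfl

theorem exists_reflection_mem (h2 : ∀ α ∈ R, dotR α α = 2) {α : Fin n → ℝ} (hα : α ∈ R) :
    ∃ e ∈ coxGroup R, ∀ x, e x = x - dotR α x • α := by
  have h : dotRLin α α = 2 := h2 α hα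
  exact ⟨Module.reflection h, Subgroup.subset_closure
    ⟨α, hα, fun x => Module.reflection_apply x h⟩, fun x => Module.reflection_apply x h⟩

/-- Every point can be moved into the closed fundamental chamber. -/
theorem exists_mem_chamber (h2 : ∀ α ∈ R, dotR α α = 2) [Finite (coxGroup R)]
    {v : Fin n → ℝ} (hv : ∀ α ∈ R, 0 < dotR α v) (x : Fin n → ℝ) :
    ∃ e ∈ coxGroup R, ∀ α ∈ R, 0 ≤ dotR α (e x) := by
  obtain ⟨⟨e, he⟩, hmax⟩ := Finite.exists_max fun e : coxGroup R =>
    dotR v ((e : (Fin n → ℝ) ≃ₗ[ℝ] (Fin n → ℝ)) x)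
  refine ⟨e, he, fun α hα => ?_⟩
  obtain ⟨s, hs, hs'⟩ := exists_reflection_mem h2 hα
  have h := hmax ⟨s * e, mul_mem hs he⟩
  simp only [LinearEquiv.mul_apply, hs', dotR_sub, dotR_smul] at h
  have h3 := hv α hα
  rw [dotR_comm] at h3
  by_contra! hneg
  nlinarith

theorem exists_mem_chamber_of_ne (h2 : ∀ α ∈ R, dotR α α = 2) [Finite (coxGroup R)]
    (hst : ∀ e ∈ coxGroup R, ∀ α ∈ R, e α ∈ R ∨ -(e α) ∈ R)
    {v : Fin n → ℝ} (hv : ∀ α ∈ R, 0 < dotR α v) {x : Fin n → ℝ} (hx : ∀ α ∈ R, dotR α x ≠ 0) :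
    ∃ e ∈ coxGroup R, ∀ α ∈ R, 0 < dotR α (e x) := by
  obtain ⟨e, he, h⟩ := exists_mem_chamber h2 hv x
  refine ⟨e, he, fun α hα => lt_of_le_of_ne (h α hα) fun h0 => ?_⟩
  have h1 : dotR α (e x) = dotR (e⁻¹ α) x := by
    rw [← dotR_coxGroup h2 (inv_mem he) α (e x), ← LinearEquiv.mul_apply, inv_mul_cancel]; rfl
  rw [h1] at h0
  rcases hst _ (inv_mem he) α hα with h3 | h3
  · exact hx _ h3 h0.symm
  · apply hx _ h3
    rw [dotR_neg_left, ← h0, neg_zero]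

/-- An even function of the pairings with the roots has a `W`-invariant sum over the roots. -/
theorem sum_even_coxGroup {M : Type*} [AddCommMonoid M]
    (hnc : ∀ α ∈ R, ∀ β ∈ R, α ≠ β → ∀ c : ℝ, β ≠ c • α)
    (hst : ∀ e ∈ coxGroup R, ∀ α ∈ R, e α ∈ R ∨ -(e α) ∈ R)
    {e : (Fin n → ℝ) ≃ₗ[ℝ] (Fin n → ℝ)} (he : e ∈ coxGroup R)
    (φ : (Fin n → ℝ) → M) (hφ : ∀ α, φ (-α) = φ α) :
    ∑ α ∈ R, φ (e α) = ∑ α ∈ R, φ α := by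
  classical
  let i : (Fin n → ℝ) → (Fin n → ℝ) := fun α => if e α ∈ R then e α else -(e α)
  have hi : ∀ α ∈ R, i α ∈ R := by
    intro α hα
    by_cases h : e α ∈ R
    · simp only [i, h, if_true]
    · simp only [i, h, if_false]
      exact (hst e he α hα).resolve_left h
  have hφi : ∀ α, φ (i α) = φ (e α) := by
    intro α; by_cases h : e α ∈ R <;> simp [i, h, hφ]
  have hpm : ∀ α, i α = e α ∨ i α = -(e α) := by
    intro α; by_cases h : e α ∈ R <;> simp [i, h]
  have hinj : Set.InjOn i R := by
    intro α hα β hβ hab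
    by_contra hne
    have h4 : β = α ∨ β = -α := by
      rcases hpm α with h | h <;> rcases hpm β with h' | h' <;> rw [h, h'] at hab
      · exact Or.inl (e.injective hab).symm
      · right; rw [← map_neg] at hab; rw [e.injective hab, neg_neg]
      · right; rw [← map_neg] at hab; rw [← e.injective hab]
      · left; exact (e.injective (neg_injective hab)).symm
    rcases h4 with h4 | h4
    · exact hne h4.symm
    · exact hnc α hα β hβ hne (-1) (by rw [h4, neg_one_smul])
  have himg : R.image i = R :=
    Finset.eq_of_subset_of_card_le (Finset.image_subset_iff.2 hi)
      (Finset.card_image_of_injOn hinj).ge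
  conv_rhs => rw [← himg, Finset.sum_image hinj]
  exact Finset.sum_congr rfl fun α _ => (hφi α).symm

theorem sum_even_dotR_coxGroup {M : Type*} [AddCommMonoid M] (h2 : ∀ α ∈ R, dotR α α = 2)
    (hnc : ∀ α ∈ R, ∀ β ∈ R, α ≠ β → ∀ c : ℝ, β ≠ c • α)
    (hst : ∀ e ∈ coxGroup R, ∀ α ∈ R, e α ∈ R ∨ -(e α) ∈ R)
    {e : (Fin n → ℝ) ≃ₗ[ℝ] (Fin n → ℝ)} (he : e ∈ coxGroup R)
    (φ : ℝ → ℝ → M) (hφ : ∀ a b, φ (-a) (-b) = φ a b) (x y : Fin n → ℝ) :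
    ∑ α ∈ R, φ (dotR α (e x)) (dotR α (e y)) = ∑ α ∈ R, φ (dotR α x) (dotR α y) := by
  rw [← sum_even_coxGroup hnc hst he (fun α => φ (dotR α (e x)) (dotR α (e y)))
    (fun α => by rw [dotR_neg_left, dotR_neg_left, hφ])]
  simp only [dotR_coxGroup h2 he]

theorem measurePreserving_coxGroup [Finite (coxGroup R)] {e : (Fin n → ℝ) ≃ₗ[ℝ] (Fin n → ℝ)}
    (he : e ∈ coxGroup R) : MeasurePreserving (e : (Fin n → ℝ) → (Fin n → ℝ)) := by
  have hfin : IsOfFinOrder e := by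
    have := isOfFinOrder_of_finite (⟨e, he⟩ : coxGroup R)
    exact (coxGroup R).subtype.isOfFinOrder this
  have hdet : |LinearMap.det (e : (Fin n → ℝ) →ₗ[ℝ] (Fin n → ℝ))| = 1 := by
    obtain ⟨j, hj, hj1⟩ := isOfFinOrder_iff_pow_eq_one.1 hfin
    have h := congrArg (fun u => (LinearEquiv.det u : ℝ)) hj1
    simp only [map_pow, map_one, Units.val_pow_eq_pow_val, Units.val_one,
      LinearEquiv.coe_det] at h
    have h3 := congrArg abs h
    rw [abs_pow, abs_one] at h3
    exact (pow_eq_one_iff_of_nonneg (abs_nonneg _) hj.ne').1 h3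
  have hne : LinearMap.det (e : (Fin n → ℝ) →ₗ[ℝ] (Fin n → ℝ)) ≠ 0 := by
    intro h0; rw [h0] at hdet; simp at hdet
  refine ⟨(LinearMap.continuous_of_finiteDimensional
    (e : (Fin n → ℝ) →ₗ[ℝ] (Fin n → ℝ))).measurable, ?_⟩
  have := Measure.map_linearMap_addHaar_eq_smul_addHaar (volume : Measure (Fin n → ℝ)) hne
  rw [abs_inv, hdet, inv_one, ENNReal.ofReal_one, one_smul] at this
  exact this

theorem integral_comp_coxGroup {E : Type*} [NormedAddCommGroup E] [NormedSpace ℝ E]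
    [Finite (coxGroup R)] {e : (Fin n → ℝ) ≃ₗ[ℝ] (Fin n → ℝ)}
    (he : e ∈ coxGroup R) (f : (Fin n → ℝ) → E) : ∫ x, f (e x) = ∫ x, f x :=
  (measurePreserving_coxGroup he).integral_comp
    (e.toContinuousLinearEquiv.toHomeomorph.measurableEmbedding) f

end RootSystem

section GaussianBounds

variable {n : ℕ}

/-- The `ℓ¹` norm. -/
def coordSum (x : Fin n → ℝ) : ℝ := ∑ i, |x i|

theorem coordSum_nonneg (x : Fin n → ℝ) : 0 ≤ coordSum x :=
  Finset.sum_nonneg fun i _ => abs_nonneg (x i)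

@[fun_prop]
theorem continuous_coordSum : Continuous (coordSum : (Fin n → ℝ) → ℝ) := by
  unfold coordSum; fun_prop

theorem coordSum_add_smul_le (x y : Fin n → ℝ) (a : ℝ) :
    coordSum (x + a • y) ≤ coordSum x + |a| * coordSum y := by
  simp only [coordSum, Finset.mul_sum, ← Finset.sum_add_distrib]
  refine Finset.sum_le_sum fun i _ => ?_
  rw [← abs_mul]
  exact abs_add_le _ _

theorem abs_dotR_le (x y : Fin n → ℝ) : |dotR x y| ≤ coordSum x * coordSum y := by
  refine (Finset.abs_sum_le_sum_abs _ _).trans ?_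
  rw [coordSum, Finset.sum_mul]
  refine Finset.sum_le_sum fun i _ => ?_
  rw [abs_mul]
  exact mul_le_mul_of_nonneg_left
    (Finset.single_le_sum (f := fun i => |y i|) (fun j _ => abs_nonneg (y j)) (Finset.mem_univ i))
    (abs_nonneg _)

theorem neg_dotR_add_smul_le (x y : Fin n → ℝ) (a : ℝ) :
    -dotR (x + a • y) (x + a • y) ≤ -dotR x x / 2 + a ^ 2 * dotR y y := by
  simp only [dotR, neg_div, Finset.sum_div, Finset.mul_sum, ← Finset.sum_neg_distrib,
    ← Finset.sum_add_distrib]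
  refine Finset.sum_le_sum fun i _ => ?_
  simp only [Pi.add_apply, Pi.smul_apply, smul_eq_mul]
  nlinarith [sq_nonneg (x i + 2 * (a * y i))]

theorem integrable_exp_neg_mul_dotR {c : ℝ} (hc : 0 < c) :
    Integrable fun x : Fin n → ℝ => Real.exp (-c * dotR x x) := by
  have h : (fun x : Fin n → ℝ => Real.exp (-c * dotR x x)) =
      fun x => ∏ i, Real.exp (-c * x i ^ 2) := by
    funext x
    rw [← Real.exp_sum, dotR, Finset.mul_sum]
    simp only [pow_two]
  rw [h]
  exact Integrable.fintype_prod (f := fun _ t => Real.exp (-c * t ^ 2)) fun _ =>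
    integrable_exp_neg_mul_sq hc

theorem integrable_exp_coordSum_sub_dotR (a b : ℝ) {c : ℝ} (hc : 0 < c) :
    Integrable fun x : Fin n → ℝ => Real.exp (a + b * coordSum x - c * dotR x x) := by
  refine ((integrable_exp_neg_mul_dotR (n := n) (half_pos hc)).const_mul
    (Real.exp (a + n * (b ^ 2 / (2 * c))))).mono' ?_ ?_
  · exact (by fun_prop : Continuous fun x : Fin n → ℝ =>
      Real.exp (a + b * coordSum x - c * dotR x x)).aestronglyMeasurable
  · refine Filter.Eventually.of_forall fun x => ?_
    rw [Real.norm_eq_abs, Real.abs_exp, ← Real.exp_add, Real.exp_le_exp]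
    have h : b * coordSum x - c * dotR x x ≤ n * (b ^ 2 / (2 * c)) + -(c / 2) * dotR x x := by
      have h1 : ∀ i, b * |x i| - c * (x i * x i) ≤ b ^ 2 / (2 * c) + -(c / 2) * (x i * x i) := by
        intro i
        have h2 : b * |x i| ≤ b ^ 2 / (2 * c) + c / 2 * (|x i| * |x i|) := by
          rw [div_add' _ _ _ (by positivity), le_div_iff₀ (by positivity)]
          nlinarith [sq_nonneg (b - c * |x i|)]
        rw [abs_mul_abs_self] at h2
        linarith
      calc b * coordSum x - c * dotR x x = ∑ i, (b * |x i| - c * (x i * x i)) := by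
            rw [coordSum, dotR, Finset.mul_sum, Finset.mul_sum, Finset.sum_sub_distrib]
        _ ≤ ∑ i, (b ^ 2 / (2 * c) + -(c / 2) * (x i * x i)) := Finset.sum_le_sum fun i _ => h1 i
        _ = _ := by
            rw [Finset.sum_add_distrib, ← Finset.mul_sum, dotR]
            simp
    linarith

theorem integral_exp_dotR_sub (ξ : Fin n → ℝ) :
    ∫ x : Fin n → ℝ, Real.exp (dotR ξ x - dotR x x / 2) =
      Real.exp (dotR ξ ξ / 2) * ∫ x : Fin n → ℝ, Real.exp (-(dotR x x / 2)) := by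
  rw [← integral_add_right_eq_self _ ξ, ← integral_const_mul]
  refine integral_congr_ae (Filter.Eventually.of_forall fun x => ?_)
  simp only [← Real.exp_add]
  congr 1
  rw [dotR_add, dotR_add, dotR_comm (x + ξ) x, dotR_comm (x + ξ) ξ, dotR_add, dotR_add,
    dotR_comm ξ x]
  ring

theorem gaussian_integral_eq :
    ∫ x : Fin n → ℝ, Real.exp (-(dotR x x / 2)) = √(2 * Real.pi) ^ n := by
  have h : (fun x : Fin n → ℝ => Real.exp (-(dotR x x / 2))) =
      fun x => ∏ i, Real.exp (-(1 / 2) * x i ^ 2) := by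
    funext x
    rw [← Real.exp_sum, dotR, Finset.sum_div, ← Finset.sum_neg_distrib]
    congr 1
    exact Finset.sum_congr rfl fun i _ => by ring
  rw [h, integral_fintype_prod_volume_eq_pow fun t : ℝ => Real.exp (-(1 / 2) * t ^ 2),
    integral_gaussian, Fintype.card_fin]
  congr 2
  ring

end GaussianBounds

section ShiftedIntegral

variable {n : ℕ}

/-- The logarithm `∑ log ((α, x + iξ) / i)` of the product of the roots. -/
noncomputable def rootLog (R : Finset (Fin n → ℝ)) (ξ x : Fin n → ℝ) : ℂ :=
  ∑ α ∈ R, Complex.log ((dotR α ξ : ℝ) - (dotR α x : ℝ) * I)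

/-- The integrand `∏ ((α, x + iξ) / i) ^ (2k) * exp (- (x + iξ)² / 2)`. -/
noncomputable def shiftedIntegrand (R : Finset (Fin n → ℝ)) (ξ : Fin n → ℝ) (k : ℂ)
    (x : Fin n → ℝ) : ℂ :=
  Complex.exp (2 * k * rootLog R ξ x - (∑ i, ((x i : ℂ) + (ξ i : ℝ) * I) ^ 2) / 2)

/-- The integral of `∏ ((α, z) / i) ^ (2k) * exp (- z² / 2)` over the contour `iξ + ℝⁿ`. -/
noncomputable def shiftedIntegral (R : Finset (Fin n → ℝ)) (ξ : Fin n → ℝ) (k : ℂ) : ℂ :=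
  ∫ x, shiftedIntegrand R ξ k x

/-- The part of the bound for `rootLog` which does not depend on the real part. -/
noncomputable def rootLogBound (R : Finset (Fin n → ℝ)) (ξ : Fin n → ℝ) : ℝ :=
  ∑ α ∈ R, (coordSum α * coordSum ξ + (dotR α ξ)⁻¹ + Real.pi)

variable {R : Finset (Fin n → ℝ)} {ξ : Fin n → ℝ}

theorem rootLogBound_nonneg (hξ : ∀ α ∈ R, 0 < dotR α ξ) : 0 ≤ rootLogBound R ξ :=
  Finset.sum_nonneg fun α hα => by
    have h1 := coordSum_nonneg α
    have h2 := coordSum_nonneg ξ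
    have h3 := hξ α hα
    have h4 := Real.pi_pos
    positivity

theorem sum_coordSum_nonneg : 0 ≤ ∑ α ∈ R, coordSum α :=
  Finset.sum_nonneg fun α _ => coordSum_nonneg α

theorem norm_log_le_of_re_pos {a b : ℝ} (ha : 0 < a) :
    ‖Complex.log ((a : ℂ) - b * I)‖ ≤ |a| + |b| + a⁻¹ + Real.pi := by
  set z : ℂ := (a : ℂ) - b * I with hz
  have hza : a ≤ ‖z‖ := by
    have h := Complex.re_le_norm z
    simpa [hz] using h
  have hz0 : 0 < ‖z‖ := ha.trans_le hza
  have hzb : ‖z‖ ≤ |a| + |b| := by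
    refine (norm_sub_le _ _).trans ?_
    simp
  have h1 : ‖Complex.log z‖ ≤ |Real.log ‖z‖| + |arg z| := by
    have h := Complex.norm_le_abs_re_add_abs_im (Complex.log z)
    rwa [Complex.log_re, Complex.log_im] at h
  have h2 : |Real.log ‖z‖| ≤ |a| + |b| + a⁻¹ := by
    have h3 : a⁻¹ ≥ ‖z‖⁻¹ := inv_anti₀ ha hza
    rw [abs_le]
    constructor
    · have h4 := Real.log_le_self (inv_nonneg.2 hz0.le)
      rw [Real.log_inv] at h4
      have := abs_nonneg a; have := abs_nonneg b
      linarith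
    · have h4 := Real.log_le_self hz0.le
      have := inv_pos.2 ha
      linarith
  linarith [Complex.abs_arg_le_pi z]

theorem norm_rootLog_le (hξ : ∀ α ∈ R, 0 < dotR α ξ) (x : Fin n → ℝ) :
    ‖rootLog R ξ x‖ ≤ rootLogBound R ξ + (∑ α ∈ R, coordSum α) * coordSum x := by
  rw [rootLogBound, Finset.sum_mul, ← Finset.sum_add_distrib]
  refine (norm_sum_le _ _).trans (Finset.sum_le_sum fun α hα => ?_)
  have h := norm_log_le_of_re_pos (b := dotR α x) (hξ α hα)
  have := abs_dotR_le α x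
  have := abs_dotR_le α ξ
  linarith

theorem re_sum_sq (ξ x : Fin n → ℝ) :
    (∑ i, ((x i : ℂ) + (ξ i : ℝ) * I) ^ 2).re = dotR x x - dotR ξ ξ := by
  rw [Complex.re_sum, dotR, dotR, ← Finset.sum_sub_distrib]
  refine Finset.sum_congr rfl fun i _ => ?_
  simp [pow_two]

theorem norm_shiftedIntegrand (R : Finset (Fin n → ℝ)) (ξ : Fin n → ℝ) (k : ℂ)
    (x : Fin n → ℝ) : ‖shiftedIntegrand R ξ k x‖ =
      Real.exp ((2 * k * rootLog R ξ x).re + dotR ξ ξ / 2 - dotR x x / 2) := by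
  rw [shiftedIntegrand, Complex.norm_exp, Complex.sub_re, Complex.div_ofNat_re, re_sum_sq]
  congr 1
  ring

theorem norm_shiftedIntegrand_le (hξ : ∀ α ∈ R, 0 < dotR α ξ) (k : ℂ) (x : Fin n → ℝ) :
    ‖shiftedIntegrand R ξ k x‖ ≤
      Real.exp (2 * ‖k‖ * (rootLogBound R ξ + (∑ α ∈ R, coordSum α) * coordSum x) +
        dotR ξ ξ / 2 - dotR x x / 2) := by
  rw [norm_shiftedIntegrand, Real.exp_le_exp]
  have h := Complex.re_le_norm (2 * k * rootLog R ξ x)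
  rw [norm_mul, norm_mul, Complex.norm_ofNat] at h
  have := mul_le_mul_of_nonneg_left (norm_rootLog_le hξ x)
    (by positivity : (0 : ℝ) ≤ 2 * ‖k‖)
  linarith

theorem sub_mul_I_mem_slitPlane {a b : ℝ} (ha : 0 < a) : (a : ℂ) - b * I ∈ slitPlane := by
  rw [Complex.mem_slitPlane_iff]
  left
  simpa using ha

theorem continuous_shiftedIntegrand (hξ : ∀ α ∈ R, 0 < dotR α ξ) (k : ℂ) :
    Continuous (shiftedIntegrand R ξ k) := by
  have h : Continuous (rootLog R ξ) := by
    refine continuous_finsetSum _ fun α hα => ?_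
    exact Continuous.clog (by fun_prop) fun x => sub_mul_I_mem_slitPlane (hξ α hα)
  unfold shiftedIntegrand
  fun_prop

theorem differentiable_shiftedIntegral (hξ : ∀ α ∈ R, 0 < dotR α ξ) :
    Differentiable ℂ (shiftedIntegral R ξ) := by
  intro k
  refine differentiableAt_integral_of_dominated (g := fun x =>
    Real.exp ((2 * (‖k‖ + 1) * rootLogBound R ξ + dotR ξ ξ / 2) +
      (2 * (‖k‖ + 1) * ∑ α ∈ R, coordSum α) * coordSum x - 1 / 2 * dotR x x))
    (integrable_exp_coordSum_sub_dotR _ _ (by norm_num)) ?_ ?_ ?_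
  · exact Filter.Eventually.of_forall fun w =>
      (continuous_shiftedIntegrand hξ w).aestronglyMeasurable
  · refine Filter.Eventually.of_forall fun w x => ?_
    unfold shiftedIntegrand
    fun_prop
  · have h : ∀ᶠ w in nhds k, ‖w‖ < ‖k‖ + 1 :=
      continuous_norm.continuousAt.eventually_lt continuousAt_const (by simp)
    filter_upwards [h] with w hw x
    refine (norm_shiftedIntegrand_le hξ w x).trans ?_
    rw [Real.exp_le_exp]
    have h1 : 0 ≤ rootLogBound R ξ + (∑ α ∈ R, coordSum α) * coordSum x :=
      add_nonneg (rootLogBound_nonneg hξ)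
        (mul_nonneg sum_coordSum_nonneg (coordSum_nonneg x))
    nlinarith [mul_le_mul_of_nonneg_right hw.le h1]

theorem shiftedIntegral_eq_of_chamber {ξ' : Fin n → ℝ} (hξ : ∀ α ∈ R, 0 < dotR α ξ)
    (hξ' : ∀ α ∈ R, 0 < dotR α ξ') (k : ℂ) :
    shiftedIntegral R ξ k = shiftedIntegral R ξ' k := by
  set η := ξ' - ξ with hη
  let U : Set ℂ := {c | ∀ α ∈ R, 0 < dotR α ξ + c.im * dotR α η}
  have hUopen : IsOpen U := by
    have : U = ⋂ α ∈ R, {c : ℂ | 0 < dotR α ξ + c.im * dotR α η} := by ext; simp [U]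
    rw [this]
    exact isOpen_biInter_finset fun α _ => isOpen_lt (by fun_prop) (by fun_prop)
  have hUconv : Convex ℝ U := by
    intro c hc d hd a b ha hb hab α hα
    have h1 := hc α hα
    have h2 := hd α hα
    have h3 : dotR α ξ + (a • c + b • d).im * dotR α η =
        a * (dotR α ξ + c.im * dotR α η) + b * (dotR α ξ + d.im * dotR α η) := by
      simp only [Complex.add_im, Complex.real_smul, Complex.mul_im, Complex.ofReal_re,
        Complex.ofReal_im, zero_mul, add_zero]
      linear_combination (-(dotR α ξ)) * hab
    rw [h3]
    rcases ha.eq_or_lt with h0 | h0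
    · rw [← h0, zero_add] at hab
      rw [← h0, hab]; linarith
    · nlinarith [mul_pos h0 h1, mul_nonneg hb h2.le]
  have hU0 : (0 : ℂ) ∈ U := fun α hα => by simpa using hξ α hα
  have hU1 : I ∈ U := fun α hα => by
    have := hξ' α hα
    simp only [Complex.I_im, one_mul, hη, dotR_sub]
    linarith
  have hpos : ∀ c ∈ U, ∀ α ∈ R, 0 < dotR α (ξ + c.im • η) := fun c hc α hα => by
    rw [dotR_add, dotR_smul]; exact hc α hα
  let f : ℂ → (Fin n → ℝ) → ℂ := fun c x => Complex.exp (2 * k *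
    (∑ α ∈ R, Complex.log ((dotR α ξ : ℝ) - ((dotR α x : ℝ) + c * (dotR α η : ℝ)) * I)) -
    (∑ i, ((x i : ℂ) + c * (η i : ℝ) + (ξ i : ℝ) * I) ^ 2) / 2)
  have hf : ∀ c x, f c x = shiftedIntegrand R (ξ + c.im • η) k (x + c.re • η) := by
    intro c x
    have hI : (I : ℂ) * I = -1 := Complex.I_mul_I
    simp only [f, shiftedIntegrand, rootLog]
    congr 3
    · refine Finset.sum_congr rfl fun α _ => ?_
      congr 1
      rw [dotR_add, dotR_smul, dotR_add, dotR_smul]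
      conv_lhs => rw [← Complex.re_add_im c]
      push_cast
      linear_combination (-(c.im : ℂ) * (dotR α η : ℂ)) * hI
    · refine Finset.sum_congr rfl fun i _ => ?_
      congr 1
      conv_lhs => rw [← Complex.re_add_im c]
      simp only [Pi.add_apply, Pi.smul_apply, smul_eq_mul]
      push_cast
      ring
  let J : ℂ → ℂ := fun c => ∫ x, f c x
  have hJ : ∀ c, J c = shiftedIntegral R (ξ + c.im • η) k := by
    intro c
    simp only [J, hf]
    exact integral_add_right_eq_self (shiftedIntegrand R (ξ + c.im • η) k) (c.re • η)
  have hJd : DifferentiableOn ℂ J U := by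
    intro c₀ hc₀
    refine DifferentiableAt.differentiableWithinAt ?_
    let T : ℂ → ℝ := fun c => 2 * ‖k‖ * (rootLogBound R (ξ + c.im • η) +
      (∑ α ∈ R, coordSum α) * (|c.re| * coordSum η)) +
      dotR (ξ + c.im • η) (ξ + c.im • η) / 2 + c.re ^ 2 * dotR η η / 2
    have hT : ContinuousAt T c₀ := by
      have h1 : ContinuousAt (fun c : ℂ => rootLogBound R (ξ + c.im • η)) c₀ := by
        refine tendsto_finsetSum _ fun α hα => ?_
        have h2 : Continuous fun c : ℂ => coordSum α * coordSum (ξ + c.im • η) := by fun_prop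
        have h3 : Continuous fun c : ℂ => dotR α (ξ + c.im • η) :=
          (continuous_dotR α).comp (by fun_prop)
        exact ((h2.continuousAt).add (h3.continuousAt.inv₀ (hpos c₀ hc₀ α hα).ne')).add
          continuousAt_const
      have h4 : Continuous fun c : ℂ => dotR (ξ + c.im • η) (ξ + c.im • η) :=
        continuous_dotR_self.comp (by fun_prop : Continuous fun c : ℂ => ξ + c.im • η)
      have h5 := h4.continuousAt (x := c₀)
      fun_prop
    refine differentiableAt_integral_of_dominated (g := fun x =>
      Real.exp ((T c₀ + 1) + (2 * ‖k‖ * ∑ α ∈ R, coordSum α) * coordSum x - 1 / 4 * dotR x x))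
      (integrable_exp_coordSum_sub_dotR _ _ (by norm_num)) ?_ ?_ ?_
    · filter_upwards [hUopen.mem_nhds hc₀] with c hc
      rw [funext (hf c)]
      exact ((continuous_shiftedIntegrand (hpos c hc) k).comp
        (continuous_id.add continuous_const)).aestronglyMeasurable
    · filter_upwards [hUopen.mem_nhds hc₀] with c hc x
      have h1 : DifferentiableAt ℂ (fun c : ℂ => ∑ α ∈ R, Complex.log
          ((dotR α ξ : ℝ) - ((dotR α x : ℝ) + c * (dotR α η : ℝ)) * I)) c := by
        refine DifferentiableAt.fun_sum fun α hα => ?_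
        refine DifferentiableAt.clog (by fun_prop) ?_
        rw [Complex.mem_slitPlane_iff]
        left
        simpa using hc α hα
      have h2 : DifferentiableAt ℂ (fun c : ℂ =>
          (∑ i, ((x i : ℂ) + c * (η i : ℝ) + (ξ i : ℝ) * I) ^ 2) / 2) c := by fun_prop
      exact ((h1.const_mul (2 * k)).sub h2).cexp
    · filter_upwards [hUopen.mem_nhds hc₀,
        hT.eventually_lt continuousAt_const (lt_add_one (T c₀))] with c hc hTc x
      rw [hf]
      refine (norm_shiftedIntegrand_le (hpos c hc) k _).trans ?_
      rw [Real.exp_le_exp]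
      have h1 := neg_dotR_add_smul_le x η c.re
      have h2 := mul_le_mul_of_nonneg_left (coordSum_add_smul_le x η c.re)
        (mul_nonneg (norm_nonneg k) (sum_coordSum_nonneg (R := R)))
      have hTc' : 2 * ‖k‖ * (rootLogBound R (ξ + c.im • η) +
          (∑ α ∈ R, coordSum α) * (|c.re| * coordSum η)) +
          dotR (ξ + c.im • η) (ξ + c.im • η) / 2 + c.re ^ 2 * dotR η η / 2 < T c₀ + 1 := hTc
      linarith
  have h := eq_of_real_translation_invariant hUopen hUconv.isPreconnected hJd
    (fun z _ r => by rw [hJ, hJ]; simp) hU0 hU1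
  rw [hJ, hJ] at h
  simpa [hη] using h

end ShiftedIntegral

section AbsIntegral

variable {n : ℕ} {R : Finset (Fin n → ℝ)}

theorem ae_dotR_ne_zero (h2 : ∀ α ∈ R, dotR α α = 2) :
    ∀ᵐ x : Fin n → ℝ, ∀ α ∈ R, dotR α x ≠ 0 := by
  rw [Filter.eventually_all_finset]
  intro α hα
  have h : volume ((LinearMap.ker (dotRLin α) : Submodule ℝ (Fin n → ℝ)) : Set (Fin n → ℝ)) = 0 := by
    refine Measure.addHaar_submodule _ _ fun htop => ?_
    have h1 : α ∈ LinearMap.ker (dotRLin α) := by rw [htop]; trivial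
    have h3 : dotR α α = 0 := h1
    rw [h2 α hα] at h3
    norm_num at h3
  refine measure_mono_null (fun x hx => ?_) h
  have h1 : dotR α x = 0 := by simpa using hx
  exact h1

/-- The logarithm of the absolute value of the product of the roots. -/
noncomputable def absLog (R : Finset (Fin n → ℝ)) (x : Fin n → ℝ) : ℝ :=
  ∑ α ∈ R, Real.log (dotR α x)

theorem measurable_absLog : Measurable (absLog R) :=
  Finset.measurable_fun_sum _ fun α _ => (continuous_dotR α).measurable.log

theorem absLog_le (x : Fin n → ℝ) : absLog R x ≤ (∑ α ∈ R, coordSum α) * coordSum x := by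
  rw [absLog, Finset.sum_mul]
  refine Finset.sum_le_sum fun α _ => ?_
  rw [← Real.log_abs]
  exact (Real.log_le_self (abs_nonneg _)).trans (abs_dotR_le α x)

theorem absLog_smul {r : ℝ} (hr : 0 < r) {x : Fin n → ℝ} (hx : ∀ α ∈ R, dotR α x ≠ 0) :
    absLog R (r • x) = #R * Real.log r + absLog R x := by
  have h : absLog R (r • x) = ∑ α ∈ R, (Real.log r + Real.log (dotR α x)) :=
    Finset.sum_congr rfl fun α hα => by rw [dotR_smul, Real.log_mul hr.ne' (hx α hα)]
  rw [h, Finset.sum_add_distrib, Finset.sum_const, nsmul_eq_mul, absLog]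

/-- The integral of `∏ |(α, x)| ^ (2k) * exp (- x² / 2)` over `ℝⁿ`. -/
noncomputable def absIntegral (R : Finset (Fin n → ℝ)) (k : ℂ) : ℂ :=
  ∫ x : Fin n → ℝ, Complex.exp (2 * k * absLog R x - (dotR x x / 2 : ℝ))

theorem norm_absIntegrand (k : ℂ) (x : Fin n → ℝ) :
    ‖Complex.exp (2 * k * absLog R x - (dotR x x / 2 : ℝ))‖ =
      Real.exp (2 * k.re * absLog R x - dotR x x / 2) := by
  rw [Complex.norm_exp]
  congr 1
  simp

theorem measurable_absIntegrand (k : ℂ) : Measurable fun x : Fin n → ℝ =>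
    Complex.exp (2 * k * absLog R x - (dotR x x / 2 : ℝ)) := by
  have h1 := measurable_absLog (R := R)
  have h2 : Measurable fun x : Fin n → ℝ => dotR x x := continuous_dotR_self.measurable
  fun_prop

theorem integrable_exp_absLog {a : ℝ} (ha : 0 ≤ a) :
    Integrable fun x : Fin n → ℝ => Real.exp (2 * a * absLog R x - dotR x x / 2) := by
  refine (integrable_exp_coordSum_sub_dotR 0 (2 * a * ∑ α ∈ R, coordSum α)
    (by norm_num : (0 : ℝ) < 1 / 2)).mono' ?_ ?_
  · have h1 := measurable_absLog (R := R)
    have h2 : Measurable fun x : Fin n → ℝ => dotR x x := continuous_dotR_self.measurable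
    exact Measurable.aestronglyMeasurable (by fun_prop)
  · refine Filter.Eventually.of_forall fun x => ?_
    rw [Real.norm_eq_abs, Real.abs_exp, Real.exp_le_exp]
    have := mul_le_mul_of_nonneg_left (absLog_le (R := R) x) (by positivity : (0 : ℝ) ≤ 2 * a)
    linarith

theorem norm_absIntegral_le (k : ℂ) : ‖absIntegral R k‖ ≤
    ∫ x : Fin n → ℝ, Real.exp (2 * k.re * absLog R x - dotR x x / 2) := by
  refine (norm_integral_le_integral_norm _).trans_eq ?_
  simp only [norm_absIntegrand]

theorem differentiableAt_absIntegral {k : ℂ} (hk : 0 < k.re) :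
    DifferentiableAt ℂ (absIntegral R) k := by
  refine differentiableAt_integral_of_dominated (g := fun x =>
    Real.exp (0 + (2 * (k.re + 1) * ∑ α ∈ R, coordSum α) * coordSum x - 1 / 2 * dotR x x))
    (integrable_exp_coordSum_sub_dotR _ _ (by norm_num)) ?_ ?_ ?_
  · exact Filter.Eventually.of_forall fun w => (measurable_absIntegrand w).aestronglyMeasurable
  · refine Filter.Eventually.of_forall fun w x => ?_
    fun_prop
  · have h0 : ∀ᶠ w in nhds k, 0 < w.re :=
      continuousAt_const.eventually_lt Complex.continuous_re.continuousAt hk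
    have h1 : ∀ᶠ w in nhds k, w.re < k.re + 1 :=
      Complex.continuous_re.continuousAt.eventually_lt continuousAt_const (by simp)
    filter_upwards [h0, h1] with w hw0 hw1 x
    rw [norm_absIntegrand, Real.exp_le_exp]
    have h3 := mul_le_mul_of_nonneg_left (absLog_le (R := R) x) hw0.le
    have h4 := mul_le_mul_of_nonneg_right hw1.le
      (mul_nonneg (sum_coordSum_nonneg (R := R)) (coordSum_nonneg x))
    nlinarith

/-- Rotating the rays from the origin gives exponential decay in the imaginary direction. -/
theorem norm_absIntegral_mul_I_le (h2 : ∀ α ∈ R, dotR α α = 2) {θ : ℝ}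
    (hθ : |θ| < Real.pi / 4) (y : ℝ) :
    ‖absIntegral R (y * I)‖ ≤ Real.exp (-(2 * θ * #R * y)) *
      ∫ x : Fin n → ℝ, Real.exp (-(Real.cos (2 * θ) / 2) * dotR x x) := by
  let U : Set ℂ := {c | c.im < Real.pi / 4} ∩ {c | -(Real.pi / 4) < c.im}
  have hUopen : IsOpen U :=
    (isOpen_lt Complex.continuous_im continuous_const).inter
      (isOpen_lt continuous_const Complex.continuous_im)
  have hUconv : Convex ℝ U :=
    (convex_halfSpace_im_lt _).inter (convex_halfSpace_im_gt _)
  set k : ℂ := y * I with hk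
  let f : ℂ → (Fin n → ℝ) → ℂ := fun c x => Complex.exp (c * (2 * k * #R + n) +
    2 * k * absLog R x - Complex.exp (2 * c) * (dotR x x / 2 : ℝ))
  have hfn : ∀ c x, ‖f c x‖ = Real.exp ((c * (2 * k * #R + n)).re -
      Real.exp (2 * c.re) * Real.cos (2 * c.im) / 2 * dotR x x) := by
    intro c x
    simp only [f]
    rw [Complex.norm_exp]
    congr 1
    rw [Complex.sub_re, Complex.add_re, Complex.re_mul_ofReal (Complex.exp (2 * c)),
      Complex.exp_re, Complex.re_mul_ofReal (2 * k)]
    have h1 : (2 * k).re = 0 := by simp [hk]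
    have h2 : (2 * c).re = 2 * c.re := by simp
    have h3 : (2 * c).im = 2 * c.im := by simp
    rw [h1, h2, h3]
    ring
  let J : ℂ → ℂ := fun c => ∫ x, f c x
  have hcos : ∀ c ∈ U, 0 < Real.cos (2 * c.im) := fun c hc =>
    Real.cos_pos_of_mem_Ioo ⟨by have := hc.2; simp only [Set.mem_ofPred_eq] at this; linarith,
      by have := hc.1; simp only [Set.mem_ofPred_eq] at this; linarith⟩
  have hJd : DifferentiableOn ℂ J U := by
    intro c₀ hc₀
    refine DifferentiableAt.differentiableWithinAt ?_
    have hB : 0 < Real.exp (2 * c₀.re) * Real.cos (2 * c₀.im) / 2 :=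
      half_pos (mul_pos (Real.exp_pos _) (hcos c₀ hc₀))
    set B := Real.exp (2 * c₀.re) * Real.cos (2 * c₀.im) / 2 with hBdef
    refine differentiableAt_integral_of_dominated (g := fun x =>
      Real.exp (((c₀ * (2 * k * #R + n)).re + 1) + 0 * coordSum x - B / 2 * dotR x x))
      (integrable_exp_coordSum_sub_dotR _ _ (half_pos hB)) ?_ ?_ ?_
    · refine Filter.Eventually.of_forall fun c => Measurable.aestronglyMeasurable ?_
      have h1 := measurable_absLog (R := R)
      have h2 : Measurable fun x : Fin n → ℝ => dotR x x := continuous_dotR_self.measurable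
      fun_prop
    · refine Filter.Eventually.of_forall fun c x => ?_
      fun_prop
    · have h1 : Continuous fun c : ℂ => (c * (2 * k * #R + n)).re := by fun_prop
      have h2 : Continuous fun c : ℂ => Real.exp (2 * c.re) * Real.cos (2 * c.im) / 2 := by
        fun_prop
      filter_upwards [h1.continuousAt.eventually_lt continuousAt_const
        (lt_add_one (c₀ * (2 * k * #R + n)).re),
        continuousAt_const.eventually_lt h2.continuousAt (half_lt_self hB)] with c hc1 hc2 x
      rw [hfn, Real.exp_le_exp]
      have h3 := mul_le_mul_of_nonneg_right hc2.le (dotR_self_nonneg x)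
      rw [← hBdef] at h3
      linarith
  have htr : ∀ z ∈ U, ∀ r : ℝ, J (z + r) = J z := by
    intro z _ r
    have h1 := Measure.integral_comp_smul (volume : Measure (Fin n → ℝ)) (f z) (Real.exp r)
    rw [Module.finrank_fin_fun, abs_of_pos (by positivity)] at h1
    have h3 : J (z + r) = ∫ x, ((Real.exp r ^ n : ℝ) : ℂ) * f z (Real.exp r • x) := by
      refine integral_congr_ae ?_
      filter_upwards [ae_dotR_ne_zero h2] with x hx
      simp only [f]
      rw [absLog_smul (Real.exp_pos r) hx, Real.log_exp, dotR_smul, dotR_comm (Real.exp r • x) x, dotR_smul,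
        ← Real.exp_nat_mul, Complex.ofReal_exp, ← Complex.exp_add, mul_add (2 : ℂ) z,
        Complex.exp_add (2 * z)]
      congr 1
      have h4 : Complex.exp (2 * (r : ℂ)) = Complex.exp r * Complex.exp r := by
        rw [← Complex.exp_add]; ring_nf
      rw [h4]
      push_cast
      ring
    rw [h3, integral_const_mul, h1, Complex.real_smul, ← mul_assoc, ← Complex.ofReal_mul,
      mul_inv_cancel₀ (by positivity), Complex.ofReal_one, one_mul]
  obtain ⟨hθ1, hθ2⟩ := abs_lt.1 hθ
  have h0U : (0 : ℂ) ∈ U := by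
    have := Real.pi_pos
    constructor <;> simp only [Set.mem_ofPred_eq, Complex.zero_im] <;> linarith
  have hθU : (θ * I : ℂ) ∈ U := by
    constructor <;> simp only [Set.mem_ofPred_eq, Complex.mul_im, Complex.ofReal_re, Complex.I_im,
      Complex.ofReal_im, Complex.I_re] <;> linarith
  have hJ := eq_of_real_translation_invariant hUopen hUconv.isPreconnected hJd htr h0U hθU
  have hJ0 : J 0 = absIntegral R k := by simp [J, f, absIntegral]
  rw [← hJ0, hJ]
  refine (norm_integral_le_integral_norm _).trans_eq ?_
  rw [← integral_const_mul]
  refine integral_congr_ae (Filter.Eventually.of_forall fun x => ?_)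
  simp only [hfn, ← Real.exp_add]
  congr 1
  simp [hk]
  ring

end AbsIntegral

section SignSum

variable {n : ℕ} {R : Finset (Fin n → ℝ)}

/-- The sum of the signs of the roots at a point. -/
noncomputable def signSum (R : Finset (Fin n → ℝ)) (x : Fin n → ℝ) : ℝ :=
  ∑ α ∈ R, Real.sign (dotR α x)

theorem measurable_sign : Measurable Real.sign := by
  have h : Real.sign = fun r : ℝ => if r < 0 then -1 else if 0 < r then 1 else 0 := by
    funext r; rfl
  rw [h]
  exact Measurable.ite measurableSet_Iio measurable_const
    (Measurable.ite measurableSet_Ioi measurable_const measurable_const)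

theorem measurable_signSum : Measurable (signSum R) :=
  Finset.measurable_fun_sum _ fun α _ => measurable_sign.comp (continuous_dotR α).measurable

theorem abs_signSum_le (x : Fin n → ℝ) : |signSum R x| ≤ #R := by
  refine (Finset.abs_sum_le_sum_abs _ _).trans ?_
  refine (Finset.sum_le_card_nsmul _ _ 1 fun α _ => ?_).trans_eq (by simp)
  rcases Real.sign_apply_eq (dotR α x) with h | h | h <;> rw [h] <;> norm_num

theorem signSum_neg (x : Fin n → ℝ) : signSum R (-x) = -signSum R x := by
  simp only [signSum, dotR_neg, Real.sign_neg, Finset.sum_neg_distrib]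

theorem signSum_coxGroup_eq (h2 : ∀ α ∈ R, dotR α α = 2)
    (hst : ∀ e ∈ coxGroup R, ∀ α ∈ R, e α ∈ R ∨ -(e α) ∈ R)
    {e : (Fin n → ℝ) ≃ₗ[ℝ] (Fin n → ℝ)} (he : e ∈ coxGroup R)
    {x y : Fin n → ℝ} (hx : ∀ α ∈ R, 0 < dotR α x) (hy : ∀ α ∈ R, 0 < dotR α y) :
    signSum R (e x) = signSum R (e y) := by
  refine Finset.sum_congr rfl fun α hα => ?_
  have h1 : ∀ z, dotR α (e z) = dotR (e⁻¹ α) z := fun z => by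
    rw [← dotR_coxGroup h2 (inv_mem he) α (e z), ← LinearEquiv.mul_apply, inv_mul_cancel]; rfl
  rw [h1, h1]
  rcases hst _ (inv_mem he) α hα with h3 | h3
  · rw [Real.sign_of_pos (hx _ h3), Real.sign_of_pos (hy _ h3)]
  · have h4 := hx _ h3
    have h5 := hy _ h3
    rw [dotR_neg_left] at h4 h5
    rw [Real.sign_of_neg (by linarith), Real.sign_of_neg (by linarith)]

/-- The distribution of `signSum` on a generic orbit does not depend on the orbit. -/
theorem sum_comp_signSum [Fintype (coxGroup R)] {M : Type*} [AddCommMonoid M]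
    (h2 : ∀ α ∈ R, dotR α α = 2)
    (hst : ∀ e ∈ coxGroup R, ∀ α ∈ R, e α ∈ R ∨ -(e α) ∈ R)
    {v x : Fin n → ℝ} (hv : ∀ α ∈ R, 0 < dotR α v) (hx : ∀ α ∈ R, dotR α x ≠ 0) (φ : ℝ → M) :
    ∑ e : coxGroup R, φ (signSum R ((e : (Fin n → ℝ) ≃ₗ[ℝ] (Fin n → ℝ)) x)) =
      ∑ e : coxGroup R, φ (signSum R ((e : (Fin n → ℝ) ≃ₗ[ℝ] (Fin n → ℝ)) v)) := by
  obtain ⟨g, hg, hgx⟩ := exists_mem_chamber_of_ne h2 hst hv hx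
  refine Fintype.sum_equiv (Equiv.mulRight (⟨g, hg⟩⁻¹ : coxGroup R)) _ _ fun e => ?_
  rw [Equiv.coe_mulRight]
  have h : (e : (Fin n → ℝ) ≃ₗ[ℝ] (Fin n → ℝ)) x =
      ((e * ⟨g, hg⟩⁻¹ : coxGroup R) : (Fin n → ℝ) ≃ₗ[ℝ] (Fin n → ℝ)) (g x) := by
    rw [Subgroup.coe_mul, InvMemClass.coe_inv, ← LinearEquiv.mul_apply, mul_assoc, inv_mul_cancel,
      mul_one]
  rw [h, signSum_coxGroup_eq h2 hst (e * ⟨g, hg⟩⁻¹ : coxGroup R).2 hgx hv]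

theorem norm_exp_signSum_le (k : ℂ) (x : Fin n → ℝ) :
    ‖Complex.exp (-(Real.pi * k * signSum R x) * I)‖ ≤ Real.exp (Real.pi * #R * |k.im|) := by
  have h : (-(Real.pi * k * signSum R x) * I : ℂ).re = Real.pi * (k.im * signSum R x) := by
    simp [mul_assoc]
  rw [Complex.norm_exp, Real.exp_le_exp, h, mul_assoc]
  refine mul_le_mul_of_nonneg_left ((le_abs_self _).trans ?_) Real.pi_pos.le
  rw [abs_mul, mul_comm]
  exact mul_le_mul_of_nonneg_right (abs_signSum_le x) (abs_nonneg _)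

/-- The average of `exp (- π i k σ)` over the orbit of a chamber. -/
noncomputable def signAverage (R : Finset (Fin n → ℝ)) [Fintype (coxGroup R)]
    (v : Fin n → ℝ) (k : ℂ) : ℂ :=
  (Fintype.card (coxGroup R) : ℂ)⁻¹ * ∑ e : coxGroup R, Complex.exp
    (-(Real.pi * k * signSum R ((e : (Fin n → ℝ) ≃ₗ[ℝ] (Fin n → ℝ)) v)) * I)

variable [Fintype (coxGroup R)] {v : Fin n → ℝ}

theorem differentiable_signAverage : Differentiable ℂ (signAverage R v) := by
  unfold signAverage
  fun_prop

theorem signAverage_neg (h2 : ∀ α ∈ R, dotR α α = 2)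
    (hst : ∀ e ∈ coxGroup R, ∀ α ∈ R, e α ∈ R ∨ -(e α) ∈ R)
    (hv : ∀ α ∈ R, 0 < dotR α v) (k : ℂ) :
    signAverage R v (-k) = signAverage R v k := by
  have h := sum_comp_signSum h2 hst hv (x := -v)
    (fun α hα => by rw [dotR_neg, neg_ne_zero]; exact (hv α hα).ne')
    (fun s => Complex.exp (-(Real.pi * k * s) * I))
  rw [signAverage, signAverage, ← h]
  congr 1
  refine Finset.sum_congr rfl fun e _ => ?_
  rw [map_neg, signSum_neg]
  congr 1
  push_cast
  ring

theorem norm_signAverage_le (k : ℂ) :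
    ‖signAverage R v k‖ ≤ Real.exp (Real.pi * #R * |k.im|) := by
  have hc : (0 : ℝ) < Fintype.card (coxGroup R) := Nat.cast_pos.2 Fintype.card_pos
  rw [signAverage, norm_mul, norm_inv, Complex.norm_natCast, inv_mul_le_iff₀ hc]
  refine (norm_sum_le_of_le _ fun e _ => norm_exp_signSum_le k _).trans_eq ?_
  simp

theorem signAverage_mul_I_ne_zero (y : ℝ) : signAverage R v (y * I) ≠ 0 := by
  refine mul_ne_zero (inv_ne_zero (Nat.cast_ne_zero.2 Fintype.card_ne_zero)) ?_
  have h : ∑ e : coxGroup R, Complex.exp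
      (-(Real.pi * (y * I) * signSum R ((e : (Fin n → ℝ) ≃ₗ[ℝ] (Fin n → ℝ)) v)) * I) =
      ((∑ e : coxGroup R, Real.exp
        (Real.pi * y * signSum R ((e : (Fin n → ℝ) ≃ₗ[ℝ] (Fin n → ℝ)) v)) : ℝ) : ℂ) := by
    push_cast
    refine Finset.sum_congr rfl fun e _ => ?_
    congr 1
    linear_combination (-(Real.pi * y *
      signSum R ((e : (Fin n → ℝ) ≃ₗ[ℝ] (Fin n → ℝ)) v) : ℂ)) * Complex.I_mul_I
  rw [h, Complex.ofReal_ne_zero]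
  exact (Finset.sum_pos (fun e _ => Real.exp_pos _) Finset.univ_nonempty).ne'

theorem exp_sign_mul_int {a : ℝ} (ha : a ≠ 0) (m : ℤ) :
    Complex.exp (-(Real.pi * m * Real.sign a) * I) = (-1) ^ m := by
  rw [← Complex.exp_pi_mul_I, ← Complex.exp_int_mul]
  rcases lt_or_gt_of_ne ha with h | h
  · rw [Real.sign_of_neg h]
    congr 1; push_cast; ring
  · rw [Real.sign_of_pos h]
    refine Complex.exp_eq_exp_iff_exists_int.2 ⟨-m, ?_⟩
    push_cast; ring

theorem signAverage_int (h2 : ∀ α ∈ R, dotR α α = 2)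
    (hst : ∀ e ∈ coxGroup R, ∀ α ∈ R, e α ∈ R ∨ -(e α) ∈ R)
    (hv : ∀ α ∈ R, 0 < dotR α v) (m : ℤ) :
    signAverage R v m = (-1) ^ (m * #R) := by
  have h : ∀ e : coxGroup R, Complex.exp
      (-(Real.pi * m * signSum R ((e : (Fin n → ℝ) ≃ₗ[ℝ] (Fin n → ℝ)) v)) * I) =
      (-1) ^ (m * #R) := by
    rintro ⟨e, he⟩
    have hne : ∀ α ∈ R, dotR α (e v) ≠ 0 := by
      intro α hα
      have h1 : dotR α (e v) = dotR (e⁻¹ α) v := by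
        rw [← dotR_coxGroup h2 (inv_mem he) α (e v), ← LinearEquiv.mul_apply, inv_mul_cancel]; rfl
      rw [h1]
      rcases hst _ (inv_mem he) α hα with h3 | h3
      · exact (hv _ h3).ne'
      · have h4 := hv _ h3
        rw [dotR_neg_left] at h4
        exact (neg_pos.1 h4).ne
    have h5 : (-(Real.pi * m * signSum R (e v)) * I : ℂ) =
        ∑ α ∈ R, -(Real.pi * m * Real.sign (dotR α (e v))) * I := by
      rw [signSum, ← Finset.sum_mul, Finset.sum_neg_distrib, ← Finset.mul_sum]
      push_cast; rfl
    rw [h5, Complex.exp_sum, Finset.prod_congr rfl fun α hα => exp_sign_mul_int (hne α hα) m,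
      Finset.prod_const, zpow_mul, zpow_natCast]
  rw [signAverage, Finset.sum_congr rfl fun e _ => h e, Finset.sum_const, Finset.card_univ,
    nsmul_eq_mul, ← mul_assoc, inv_mul_cancel₀ (Nat.cast_ne_zero.2 Fintype.card_ne_zero), one_mul]

end SignSum

section BoundaryValue

variable {n : ℕ} {R : Finset (Fin n → ℝ)} {ξ : Fin n → ℝ}

theorem log_neg_mul_I {a : ℝ} (ha : a ≠ 0) :
    Complex.log (-(a * I)) = Real.log a - Real.pi / 2 * Real.sign a * I := by
  have h1 : ∀ r : ℝ, 0 < r → Complex.log (-(r * I)) = Real.log r - Real.pi / 2 * I := by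
    intro r hr
    rw [← mul_neg, Complex.log_ofReal_mul hr (by simp), Complex.log_neg_I]
    ring
  rcases lt_or_gt_of_ne ha with h | h
  · rw [Real.sign_of_neg h, show (-(a * I) : ℂ) = ((-a : ℝ) : ℂ) * I by push_cast; ring,
      Complex.log_ofReal_mul (neg_pos.2 h) I_ne_zero, Complex.log_I, Real.log_neg_eq_log]
    push_cast; ring
  · rw [Real.sign_of_pos h, h1 a h]
    push_cast; ring

theorem tendsto_rootLog {x : Fin n → ℝ} (hx : ∀ α ∈ R, dotR α x ≠ 0) :
    Filter.Tendsto (fun t : ℝ => rootLog R (t • ξ) x) (nhds 0)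
      (nhds (absLog R x - Real.pi / 2 * signSum R x * I)) := by
  have h : (absLog R x - Real.pi / 2 * signSum R x * I : ℂ) =
      ∑ α ∈ R, Complex.log (-(dotR α x * I)) := by
    rw [Finset.sum_congr rfl fun α hα => log_neg_mul_I (hx α hα), Finset.sum_sub_distrib,
      ← Finset.sum_mul, ← Finset.mul_sum, absLog, signSum]
    push_cast; rfl
  rw [h]
  refine tendsto_finsetSum _ fun α hα => ?_
  have h1 : Filter.Tendsto (fun t : ℝ => ((dotR α (t • ξ) : ℝ) : ℂ) - (dotR α x : ℝ) * I) (nhds 0)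
      (nhds (-(dotR α x * I))) := by
    have h2 : Continuous fun t : ℝ => ((dotR α (t • ξ) : ℝ) : ℂ) - (dotR α x : ℝ) * I := by
      simp only [dotR_smul]; fun_prop
    have h3 := h2.tendsto 0
    simp only [dotR_smul, zero_mul, Complex.ofReal_zero, zero_sub] at h3
    simpa only [dotR_smul] using h3
  refine h1.clog ?_
  rw [Complex.mem_slitPlane_iff]
  right
  simpa using hx α hα

theorem norm_shiftedIntegrand_smul_le {k : ℂ} (hk : 0 ≤ k.re)
    {t : ℝ} (ht : 0 < t) (ht1 : t ≤ 1) (x : Fin n → ℝ) :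
    ‖shiftedIntegrand R (t • ξ) k x‖ ≤ Real.exp
      ((2 * k.re * ((∑ α ∈ R, coordSum α) * coordSum ξ) + 2 * |k.im| * (Real.pi * #R) +
        dotR ξ ξ / 2) + (2 * k.re * ∑ α ∈ R, coordSum α) * coordSum x - 1 / 2 * dotR x x) := by
  rw [norm_shiftedIntegrand, Real.exp_le_exp]
  set L := rootLog R (t • ξ) x with hL
  have him : |L.im| ≤ Real.pi * #R := by
    rw [hL, rootLog, Complex.im_sum]
    refine (Finset.abs_sum_le_sum_abs _ _).trans ?_
    refine (Finset.sum_le_card_nsmul _ _ Real.pi fun α _ => ?_).trans_eq (by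
      rw [nsmul_eq_mul, mul_comm])
    rw [Complex.log_im]
    exact Complex.abs_arg_le_pi _
  have hre : L.re ≤ (∑ α ∈ R, coordSum α) * coordSum ξ + (∑ α ∈ R, coordSum α) * coordSum x := by
    rw [hL, rootLog, Complex.re_sum, Finset.sum_mul, Finset.sum_mul, ← Finset.sum_add_distrib]
    refine Finset.sum_le_sum fun α hα => ?_
    rw [Complex.log_re]
    refine (Real.log_le_self (norm_nonneg _)).trans ((norm_sub_le _ _).trans ?_)
    rw [norm_mul, Complex.norm_I, mul_one, Complex.norm_real, Complex.norm_real,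
      Real.norm_eq_abs, Real.norm_eq_abs, dotR_smul, abs_mul, abs_of_pos ht]
    have h1 := abs_dotR_le α ξ
    have h2 := abs_dotR_le α x
    have h3 := mul_le_mul_of_nonneg_right ht1 (abs_nonneg (dotR α ξ))
    linarith
  have h1 : (2 * k * L).re = 2 * k.re * L.re - 2 * (k.im * L.im) := by
    simp [mul_assoc]; ring
  have h2 : -(k.im * L.im) ≤ |k.im| * (Real.pi * #R) :=
    (neg_le_abs _).trans (by
      rw [abs_mul]; exact mul_le_mul_of_nonneg_left him (abs_nonneg _))
  have h3 := mul_le_mul_of_nonneg_left hre hk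
  have h4 : dotR (t • ξ) (t • ξ) ≤ dotR ξ ξ := by
    rw [dotR_smul, dotR_comm, dotR_smul, ← mul_assoc]
    have := dotR_self_nonneg ξ
    have h5 : t * t ≤ 1 := by nlinarith
    nlinarith
  rw [h1]
  linarith

theorem shiftedIntegral_eq_boundary (h2 : ∀ α ∈ R, dotR α α = 2)
    (hξ : ∀ α ∈ R, 0 < dotR α ξ) {k : ℂ} (hk : 0 ≤ k.re) :
    shiftedIntegral R ξ k = ∫ x : Fin n → ℝ,
      Complex.exp (2 * k * absLog R x - (dotR x x / 2 : ℝ)) *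
        Complex.exp (-(Real.pi * k * signSum R x) * I) := by
  have h0 : ∀ᶠ t : ℝ in nhdsWithin 0 (Set.Ioi 0), 0 < t ∧ t ≤ 1 := by
    filter_upwards [Ioo_mem_nhdsGT (zero_lt_one : (0 : ℝ) < 1)] with t ht
    exact ⟨ht.1, ht.2.le⟩
  have hlim := tendsto_integral_filter_of_dominated_convergence
    (μ := (volume : Measure (Fin n → ℝ)))
    (F := fun (t : ℝ) x => shiftedIntegrand R (t • ξ) k x) (l := nhdsWithin 0 (Set.Ioi 0))
    (f := fun x => Complex.exp (2 * k * absLog R x - (dotR x x / 2 : ℝ)) *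
        Complex.exp (-(Real.pi * k * signSum R x) * I)) _ ?_
    (h0.mono fun t ht => Filter.Eventually.of_forall
      (norm_shiftedIntegrand_smul_le hk ht.1 ht.2))
    (integrable_exp_coordSum_sub_dotR _ _ (by norm_num)) ?_
  · refine tendsto_nhds_unique (tendsto_const_nhds.congr' ?_) hlim
    filter_upwards [h0] with t ht
    exact shiftedIntegral_eq_of_chamber hξ
      (fun α hα => by rw [dotR_smul]; exact mul_pos ht.1 (hξ α hα)) k
  · filter_upwards [h0] with t ht
    exact (continuous_shiftedIntegrand
      (fun α hα => by rw [dotR_smul]; exact mul_pos ht.1 (hξ α hα)) k).aestronglyMeasurable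
  · filter_upwards [ae_dotR_ne_zero h2] with x hx
    refine Filter.Tendsto.mono_left ?_ nhdsWithin_le_nhds
    have h1 := tendsto_rootLog (ξ := ξ) hx
    have h3 : Filter.Tendsto (fun t : ℝ => (∑ i, ((x i : ℂ) + ((t • ξ) i : ℝ) * I) ^ 2) / 2)
        (nhds 0) (nhds ((dotR x x / 2 : ℝ) : ℂ)) := by
      have h4 : Continuous fun t : ℝ => (∑ i, ((x i : ℂ) + ((t • ξ) i : ℝ) * I) ^ 2) / 2 := by
        simp only [Pi.smul_apply, smul_eq_mul]; fun_prop
      have h5 := h4.tendsto 0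
      simpa [dotR, pow_two] using h5
    have h6 := ((h1.const_mul (2 * k)).sub h3).cexp
    rw [← Complex.exp_add]
    have h7 : 2 * k * absLog R x - (dotR x x / 2 : ℝ) + -(Real.pi * k * signSum R x) * I =
        2 * k * (absLog R x - Real.pi / 2 * signSum R x * I) - (dotR x x / 2 : ℝ) := by ring
    rw [h7]
    exact h6

theorem shiftedIntegral_eq_mul_signAverage [Fintype (coxGroup R)] (h2 : ∀ α ∈ R, dotR α α = 2)
    (hnc : ∀ α ∈ R, ∀ β ∈ R, α ≠ β → ∀ c : ℝ, β ≠ c • α)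
    (hst : ∀ e ∈ coxGroup R, ∀ α ∈ R, e α ∈ R ∨ -(e α) ∈ R)
    (hξ : ∀ α ∈ R, 0 < dotR α ξ) {k : ℂ} (hk : 0 ≤ k.re) :
    shiftedIntegral R ξ k = absIntegral R k * signAverage R ξ k := by
  let g : (Fin n → ℝ) → ℂ := fun x => Complex.exp (2 * k * absLog R x - (dotR x x / 2 : ℝ))
  let s : (Fin n → ℝ) → ℂ := fun x => Complex.exp (-(Real.pi * k * signSum R x) * I)
  have hinv : ∀ e : coxGroup R, shiftedIntegral R ξ k =
      ∫ x, g x * s ((e : (Fin n → ℝ) ≃ₗ[ℝ] (Fin n → ℝ)) x) := by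
    rintro ⟨e, he⟩
    rw [shiftedIntegral_eq_boundary h2 hξ hk, ← integral_comp_coxGroup he]
    congr 1
    funext x
    have h1 : absLog R (e x) = absLog R x :=
      sum_even_dotR_coxGroup h2 hnc hst he (fun a _ => Real.log a)
        (fun a _ => Real.log_neg_eq_log a) x x
    rw [h1, dotR_coxGroup h2 he]
  have hfi : ∀ e ∈ (Finset.univ : Finset (coxGroup R)),
      Integrable fun x => g x * s ((e : (Fin n → ℝ) ≃ₗ[ℝ] (Fin n → ℝ)) x) := by
    rintro ⟨e, he⟩ -
    refine ((integrable_exp_absLog (R := R) hk).mul_const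
      (Real.exp (Real.pi * #R * |k.im|))).mono' ?_ ?_
    · have h1 := measurable_signSum (R := R)
      have h3 : Measurable s := by simp only [s]; fun_prop
      exact ((measurable_absIntegrand k).mul
        (h3.comp (measurePreserving_coxGroup he).measurable)).aestronglyMeasurable
    · refine Filter.Eventually.of_forall fun x => ?_
      rw [norm_mul, norm_absIntegrand]
      exact mul_le_mul_of_nonneg_left (norm_exp_signSum_le k _) (Real.exp_pos _).le
  have hsum : (Fintype.card (coxGroup R) : ℂ) * shiftedIntegral R ξ k =
      absIntegral R k * ∑ e : coxGroup R, s ((e : (Fin n → ℝ) ≃ₗ[ℝ] (Fin n → ℝ)) ξ) := by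
    have h1 : (Fintype.card (coxGroup R) : ℂ) * shiftedIntegral R ξ k =
        ∑ e : coxGroup R, ∫ x, g x * s ((e : (Fin n → ℝ) ≃ₗ[ℝ] (Fin n → ℝ)) x) := by
      rw [Finset.sum_congr rfl fun e _ => (hinv e).symm, Finset.sum_const, Finset.card_univ,
        nsmul_eq_mul]
    rw [h1, ← integral_finsetSum _ hfi, absIntegral, ← integral_mul_const]
    refine integral_congr_ae ?_
    filter_upwards [ae_dotR_ne_zero h2] with x hx
    rw [← Finset.mul_sum]
    congr 1
    exact sum_comp_signSum h2 hst hξ hx fun r => Complex.exp (-(Real.pi * k * r) * I)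
  have hc : (Fintype.card (coxGroup R) : ℂ) ≠ 0 := Nat.cast_ne_zero.2 Fintype.card_ne_zero
  rw [signAverage, mul_left_comm, ← hsum, inv_mul_cancel_left₀ hc]

end BoundaryValue

section CriticalPoint

variable {n : ℕ} {R : Finset (Fin n → ℝ)}

/-- The Macdonald-Mehta density has a critical point in the fundamental chamber. -/
theorem exists_critical_point {v : Fin n → ℝ} (hv : ∀ α ∈ R, 0 < dotR α v) :
    ∃ y₀, (∀ α ∈ R, 0 < dotR α y₀) ∧ ∀ y, ∑ α ∈ R, dotR α y / dotR α y₀ = dotR y₀ y := by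
  let ψ : (Fin n → ℝ) → ℝ := fun y => (∏ α ∈ R, max 0 (dotR α y)) * Real.exp (-(dotR y y / 2))
  have hψc : Continuous ψ := by
    refine Continuous.mul (continuous_finsetProd _ fun α _ => ?_) (by fun_prop)
    exact continuous_const.max (continuous_dotR α)
  have hψpos : ∀ y, (∀ α ∈ R, 0 < dotR α y) → ψ y = Real.exp (absLog R y - dotR y y / 2) := by
    intro y hy
    rw [sub_eq_add_neg, Real.exp_add, absLog, Real.exp_sum]
    simp only [ψ]
    congr 1
    refine Finset.prod_congr rfl fun α hα => ?_
    rw [Real.exp_log (hy α hα), max_eq_right (hy α hα).le]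
  have hψv : 0 < ψ v := by rw [hψpos v hv]; exact Real.exp_pos _
  set b := ∑ α ∈ R, coordSum α with hb
  have hle : ∀ y, ψ y ≤ Real.exp (n * b ^ 2 - ‖y‖ ^ 2 / 4) := by
    intro y
    have h1 : ∏ α ∈ R, max 0 (dotR α y) ≤ Real.exp (b * coordSum y) := by
      rw [hb, Finset.sum_mul, Real.exp_sum]
      refine Finset.prod_le_prod (fun α _ => le_max_left _ _) fun α _ => ?_
      have h2 := abs_dotR_le α y
      have h3 := le_abs_self (dotR α y)
      have h4 := Real.add_one_le_exp (coordSum α * coordSum y)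
      exact max_le (Real.exp_pos _).le (by linarith)
    have h2 : b * coordSum y ≤ n * b ^ 2 + dotR y y / 4 := by
      have h3 : (n * b ^ 2 : ℝ) = ∑ _i : Fin n, b ^ 2 := by simp
      rw [h3, coordSum, dotR, Finset.mul_sum, Finset.sum_div, ← Finset.sum_add_distrib]
      refine Finset.sum_le_sum fun i _ => ?_
      have h4 := abs_mul_abs_self (y i)
      nlinarith [sq_nonneg (b - |y i| / 2)]
    have h5 : ‖y‖ ^ 2 ≤ dotR y y := by
      rw [← Real.le_sqrt (norm_nonneg _) (dotR_self_nonneg y)]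
      refine (pi_norm_le_iff_of_nonneg (Real.sqrt_nonneg _)).2 fun i => ?_
      rw [Real.norm_eq_abs]
      refine Real.abs_le_sqrt ?_
      rw [pow_two]
      exact Finset.single_le_sum (f := fun i => y i * y i) (fun j _ => mul_self_nonneg (y j))
        (Finset.mem_univ i)
    refine (mul_le_mul_of_nonneg_right h1 (Real.exp_pos _).le).trans ?_
    rw [← Real.exp_add, Real.exp_le_exp]
    linarith
  have hev : ∀ᶠ y in Filter.cocompact (Fin n → ℝ), ψ y ≤ ψ v := by
    have h1 : Filter.Tendsto (fun y : Fin n → ℝ => ‖y‖ ^ 2 / 4) (Filter.cocompact _)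
        Filter.atTop :=
      ((Filter.tendsto_pow_atTop two_ne_zero).comp
        (tendsto_norm_cocompact_atTop (E := Fin n → ℝ))).atTop_div_const (by norm_num)
    filter_upwards [h1.eventually_ge_atTop (n * b ^ 2 - Real.log (ψ v))] with y hy
    refine (hle y).trans ?_
    rw [← Real.le_log_iff_exp_le hψv]
    linarith
  obtain ⟨y₀, hy₀⟩ := hψc.exists_forall_ge' v hev
  have hψ0 : 0 < ψ y₀ := hψv.trans_le (hy₀ v)
  have hpos : ∀ α ∈ R, 0 < dotR α y₀ := by
    intro α hα
    by_contra! hneg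
    have h0 : max 0 (dotR α y₀) = 0 := max_eq_left hneg
    have h1 : ψ y₀ = 0 := by
      simp only [ψ]
      rw [Finset.prod_eq_zero hα h0, zero_mul]
    exact hψ0.ne' h1
  refine ⟨y₀, hpos, fun y => ?_⟩
  let u : ℝ → ℝ := fun t => absLog R (y₀ + t • y) - dotR (y₀ + t • y) (y₀ + t • y) / 2
  have hu : ∀ t, u t = (∑ α ∈ R, Real.log (dotR α y₀ + t * dotR α y)) -
      (dotR y₀ y₀ + 2 * (t * dotR y₀ y) + t * (t * dotR y y)) / 2 := by
    intro t
    simp only [u, absLog, dotR_add, dotR_smul, dotR_comm (y₀ + t • y)]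
    rw [dotR_comm y y₀]
    ring
  have hmax : IsLocalMax u 0 := by
    have h1 : ∀ᶠ t : ℝ in nhds 0, ∀ α ∈ R, 0 < dotR α (y₀ + t • y) := by
      rw [Filter.eventually_all_finset]
      intro α hα
      have h2 : Continuous fun t : ℝ => dotR α (y₀ + t • y) :=
        (continuous_dotR α).comp (by fun_prop)
      refine continuousAt_const.eventually_lt h2.continuousAt ?_
      simpa using hpos α hα
    filter_upwards [h1] with t ht
    have h2 := hy₀ (y₀ + t • y)
    rw [hψpos _ ht, hψpos _ hpos, Real.exp_le_exp] at h2
    simpa [u] using h2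
  have hderiv : HasDerivAt u ((∑ α ∈ R, dotR α y / dotR α y₀) - dotR y₀ y) 0 := by
    have h1 : HasDerivAt (fun t : ℝ => ∑ α ∈ R, Real.log (dotR α y₀ + t * dotR α y))
        (∑ α ∈ R, dotR α y / dotR α y₀) 0 := by
      refine HasDerivAt.fun_sum fun α hα => ?_
      have h2 : HasDerivAt (fun t : ℝ => dotR α y₀ + t * dotR α y) (dotR α y) 0 := by
        simpa using ((hasDerivAt_id (0 : ℝ)).mul_const (dotR α y)).const_add (dotR α y₀)
      have h3 := h2.log (by simpa using (hpos α hα).ne')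
      simpa using h3
    have h4 : HasDerivAt (fun t : ℝ =>
        (dotR y₀ y₀ + 2 * (t * dotR y₀ y) + t * (t * dotR y y)) / 2) (dotR y₀ y) 0 := by
      have h5 := hasDerivAt_id (0 : ℝ)
      have h6 := ((((h5.mul_const (dotR y₀ y)).const_mul 2).const_add (dotR y₀ y₀)).add
        (h5.mul (h5.mul_const (dotR y y)))).div_const 2
      exact h6.congr_deriv (by simp)
    rw [funext hu]
    exact h1.sub h4
  exact sub_eq_zero.1 (hmax.hasDerivAt_eq_zero hderiv)

theorem exists_chamber_point_bound {v : Fin n → ℝ} (hv : ∀ α ∈ R, 0 < dotR α v) {a : ℝ}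
    (ha : 0 < a) : ∃ ξ, (∀ α ∈ R, 0 < dotR α ξ) ∧ ∀ y, (∀ α ∈ R, 0 < dotR α y) →
      2 * a * absLog R y ≤ 2 * a * absLog R ξ + dotR ξ y - dotR ξ ξ := by
  obtain ⟨y₀, hy₀, h⟩ := exists_critical_point hv
  have hc : 0 < √(2 * a) := Real.sqrt_pos.2 (by linarith)
  have hcc : √(2 * a) * √(2 * a) = 2 * a := Real.mul_self_sqrt (by linarith)
  set c := √(2 * a) with hcdef
  have hξ : ∀ α ∈ R, 0 < dotR α (c • y₀) := fun α hα => by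
    rw [dotR_smul]; exact mul_pos hc (hy₀ α hα)
  refine ⟨c • y₀, hξ, fun y hy => ?_⟩
  have hcard : dotR y₀ y₀ = #R := by
    rw [← h y₀, Finset.sum_congr rfl fun α hα => div_self (hy₀ α hα).ne']
    simp
  have h1 : absLog R y - absLog R (c • y₀) ≤ c⁻¹ * dotR y₀ y - #R := by
    have h2 : (c⁻¹ * dotR y₀ y - #R : ℝ) = ∑ α ∈ R, (dotR α y / dotR α (c • y₀) - 1) := by
      rw [Finset.sum_sub_distrib, ← h y, Finset.mul_sum]
      simp only [Finset.sum_const, nsmul_eq_mul, mul_one, dotR_smul]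
      congr 1
      refine Finset.sum_congr rfl fun α hα => ?_
      have := (hy₀ α hα).ne'
      field_simp
    rw [h2, absLog, absLog, ← Finset.sum_sub_distrib]
    refine Finset.sum_le_sum fun α hα => ?_
    rw [← Real.log_div (hy α hα).ne' (hξ α hα).ne']
    exact Real.log_le_sub_one_of_pos (div_pos (hy α hα) (hξ α hα))
  have h3 := mul_le_mul_of_nonneg_left h1 (by linarith : (0 : ℝ) ≤ 2 * a)
  have h4 : 2 * a * (c⁻¹ * dotR y₀ y - #R) = dotR (c • y₀) y - dotR (c • y₀) (c • y₀) := by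
    rw [dotR_smul, dotR_comm (c • y₀) y, dotR_comm (c • y₀) y₀, dotR_smul, dotR_smul, hcard,
      ← hcc, dotR_comm y y₀]
    field_simp
  linarith

set_option maxHeartbeats 1000000 in
theorem absIntegral_le_of_chamber_point [Fintype (coxGroup R)] (h2 : ∀ α ∈ R, dotR α α = 2)
    (hnc : ∀ α ∈ R, ∀ β ∈ R, α ≠ β → ∀ c : ℝ, β ≠ c • α)
    (hst : ∀ e ∈ coxGroup R, ∀ α ∈ R, e α ∈ R ∨ -(e α) ∈ R)
    {ξ : Fin n → ℝ} (hξ : ∀ α ∈ R, 0 < dotR α ξ) {a : ℝ} (ha : 0 ≤ a)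
    (hb : ∀ y, (∀ α ∈ R, 0 < dotR α y) →
      2 * a * absLog R y ≤ 2 * a * absLog R ξ + dotR ξ y - dotR ξ ξ) :
    ∫ x : Fin n → ℝ, Real.exp (2 * a * absLog R x - dotR x x / 2) ≤
      Fintype.card (coxGroup R) * (Real.exp (2 * a * absLog R ξ - dotR ξ ξ / 2) *
        ∫ x : Fin n → ℝ, Real.exp (-(dotR x x / 2))) := by
  let g : (Fin n → ℝ) → ℝ := fun x => Real.exp (2 * a * absLog R ξ - dotR ξ ξ) *
    Real.exp (dotR ξ x - dotR x x / 2)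
  have hg : Integrable g := by
    refine Integrable.const_mul ((integrable_exp_coordSum_sub_dotR 0 (coordSum ξ)
      (by norm_num : (0 : ℝ) < 1 / 2)).mono' ?_ ?_) _
    · exact (by fun_prop : Continuous fun x : Fin n → ℝ =>
        Real.exp (dotR ξ x - dotR x x / 2)).aestronglyMeasurable
    · refine Filter.Eventually.of_forall fun x => ?_
      rw [Real.norm_eq_abs, Real.abs_exp, Real.exp_le_exp]
      have := (le_abs_self _).trans (abs_dotR_le ξ x)
      linarith
  have hge : ∀ e : coxGroup R,
      Integrable fun x => g ((e : (Fin n → ℝ) ≃ₗ[ℝ] (Fin n → ℝ)) x) := fun e =>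
    (measurePreserving_coxGroup e.2).integrable_comp_of_integrable hg
  calc ∫ x : Fin n → ℝ, Real.exp (2 * a * absLog R x - dotR x x / 2)
      ≤ ∫ x, ∑ e : coxGroup R, g ((e : (Fin n → ℝ) ≃ₗ[ℝ] (Fin n → ℝ)) x) := by
        refine integral_mono_ae (integrable_exp_absLog ha)
          (integrable_finsetSum _ fun e _ => hge e) ?_
        filter_upwards [ae_dotR_ne_zero h2] with x hx
        obtain ⟨e, he, hex⟩ := exists_mem_chamber_of_ne h2 hst hξ hx
        have h3 : absLog R (e x) = absLog R x :=
          sum_even_dotR_coxGroup h2 hnc hst he (fun a _ => Real.log a)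
            (fun a _ => Real.log_neg_eq_log a) x x
        have h4 : Real.exp (2 * a * absLog R x - dotR x x / 2) ≤ g (e x) := by
          simp only [g]
          rw [← Real.exp_add, Real.exp_le_exp, dotR_coxGroup h2 he x x, ← h3]
          linarith [hb _ hex]
        exact h4.trans (Finset.single_le_sum
          (f := fun e : coxGroup R => g ((e : (Fin n → ℝ) ≃ₗ[ℝ] (Fin n → ℝ)) x))
          (fun e _ => by positivity) (Finset.mem_univ ⟨e, he⟩))
    _ = Fintype.card (coxGroup R) * ∫ x, g x := by
        rw [integral_finsetSum _ fun e _ => hge e,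
          Finset.sum_congr rfl fun e _ => integral_comp_coxGroup e.2 g]
        simp
    _ = _ := by
        congr 1
        simp only [g]
        rw [integral_const_mul, integral_exp_dotR_sub, ← mul_assoc, ← Real.exp_add]
        congr 2
        ring

theorem norm_shiftedIntegral_neg_le {ξ : Fin n → ℝ} (hξ : ∀ α ∈ R, 0 < dotR α ξ) {k : ℂ}
    (hk : 0 ≤ k.re) : ‖shiftedIntegral R ξ (-k)‖ ≤
      Real.exp (-(2 * k.re * absLog R ξ) + dotR ξ ξ / 2 + Real.pi * #R * |k.im|) *
        ∫ x : Fin n → ℝ, Real.exp (-(dotR x x / 2)) := by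
  rw [← integral_const_mul]
  refine norm_integral_le_of_norm_le ?_ (Filter.Eventually.of_forall fun x => ?_)
  · refine Integrable.const_mul ?_ _
    have h := integrable_exp_neg_mul_dotR (n := n) (by norm_num : (0 : ℝ) < 1 / 2)
    refine h.congr (Filter.Eventually.of_forall fun x => ?_)
    simp only
    congr 1
    ring
  rw [norm_shiftedIntegrand, ← Real.exp_add, Real.exp_le_exp]
  set L := rootLog R ξ x with hL
  have him : |L.im| ≤ Real.pi / 2 * #R := by
    rw [hL, rootLog, Complex.im_sum]
    refine (Finset.abs_sum_le_sum_abs _ _).trans ?_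
    refine (Finset.sum_le_card_nsmul _ _ (Real.pi / 2) fun α hα => ?_).trans_eq (by
      rw [nsmul_eq_mul, mul_comm])
    rw [Complex.log_im, Complex.abs_arg_le_pi_div_two_iff]
    simpa using (hξ α hα).le
  have hre : absLog R ξ ≤ L.re := by
    rw [hL, rootLog, Complex.re_sum]
    refine Finset.sum_le_sum fun α hα => ?_
    rw [Complex.log_re]
    refine Real.log_le_log (hξ α hα) ?_
    have h := Complex.re_le_norm (((dotR α ξ : ℝ) : ℂ) - (dotR α x : ℝ) * I)
    simpa using h
  have h1 : (2 * -k * L).re = -(2 * k.re * L.re) + 2 * (k.im * L.im) := by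
    simp [mul_assoc]; ring
  have h3 : k.im * L.im ≤ |k.im| * (Real.pi / 2 * #R) :=
    (le_abs_self _).trans (by
      rw [abs_mul]; exact mul_le_mul_of_nonneg_left him (abs_nonneg _))
  have h4 := mul_le_mul_of_nonneg_left hre hk
  rw [h1]
  linarith

theorem norm_absIntegral_mul_shiftedIntegral_neg_le [Fintype (coxGroup R)]
    (h2 : ∀ α ∈ R, dotR α α = 2)
    (hnc : ∀ α ∈ R, ∀ β ∈ R, α ≠ β → ∀ c : ℝ, β ≠ c • α)
    (hst : ∀ e ∈ coxGroup R, ∀ α ∈ R, e α ∈ R ∨ -(e α) ∈ R)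
    {v : Fin n → ℝ} (hv : ∀ α ∈ R, 0 < dotR α v) {k : ℂ} (hk : 0 < k.re) :
    ‖absIntegral R k * shiftedIntegral R v (-k)‖ ≤ Fintype.card (coxGroup R) *
      (∫ x : Fin n → ℝ, Real.exp (-(dotR x x / 2))) ^ 2 * Real.exp (Real.pi * #R * |k.im|) := by
  obtain ⟨ξ, hξ, hb⟩ := exists_chamber_point_bound hv hk
  rw [shiftedIntegral_eq_of_chamber hv hξ, norm_mul]
  have h1 := (norm_absIntegral_le (R := R) k).trans
    (absIntegral_le_of_chamber_point h2 hnc hst hξ hk.le hb)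
  have h3 := norm_shiftedIntegral_neg_le hξ hk.le
  refine (mul_le_mul h1 h3 (norm_nonneg _) ((norm_nonneg _).trans h1)).trans_eq ?_
  set Z := ∫ x : Fin n → ℝ, Real.exp (-(dotR x x / 2))
  have h4 : Real.exp (Real.pi * #R * |k.im|) =
      Real.exp (2 * k.re * absLog R ξ - dotR ξ ξ / 2) *
        Real.exp (-(2 * k.re * absLog R ξ) + dotR ξ ξ / 2 + Real.pi * #R * |k.im|) := by
    rw [← Real.exp_add]; congr 1; ring
  rw [h4]
  ring

end CriticalPoint

section Reflection

variable {n : ℕ} {R : Finset (Fin n → ℝ)}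

theorem absIntegral_zero :
    absIntegral R 0 = ((∫ x : Fin n → ℝ, Real.exp (-(dotR x x / 2)) : ℝ) : ℂ) := by
  rw [absIntegral, ← integral_complex_ofReal]
  congr 1
  funext x
  push_cast
  congr 1
  ring

/-- The reflection relation for all complex parameters. -/
theorem shiftedIntegral_mul_shiftedIntegral_neg [Fintype (coxGroup R)]
    (h2 : ∀ α ∈ R, dotR α α = 2)
    (hnc : ∀ α ∈ R, ∀ β ∈ R, α ≠ β → ∀ c : ℝ, β ≠ c • α)
    (hst : ∀ e ∈ coxGroup R, ∀ α ∈ R, e α ∈ R ∨ -(e α) ∈ R)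
    {v : Fin n → ℝ} (hv : ∀ α ∈ R, 0 < dotR α v) (k : ℂ) :
    shiftedIntegral R v k * shiftedIntegral R v (-k) =
      ((∫ x : Fin n → ℝ, Real.exp (-(dotR x x / 2)) : ℝ) : ℂ) ^ 2 * signAverage R v k := by
  classical
  set Z := ∫ x : Fin n → ℝ, Real.exp (-(dotR x x / 2)) with hZ
  set p := signAverage R v with hp
  set E := shiftedIntegral R v with hE
  set F := absIntegral R with hF
  have hEF : ∀ k : ℂ, 0 ≤ k.re → E k = F k * p k := fun k hk =>
    shiftedIntegral_eq_mul_signAverage h2 hnc hst hv hk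
  have hpn : ∀ k, p (-k) = p k := signAverage_neg h2 hst hv
  have hp0 : ∀ k : ℂ, k.re = 0 → p k ≠ 0 := by
    intro k hk
    have h1 : k = (k.im : ℝ) * I := by
      conv_lhs => rw [← Complex.re_add_im k, hk]
      simp
    rw [h1]
    exact signAverage_mul_I_ne_zero _
  let h : ℂ → ℂ := fun k => if 0 ≤ k.re then F k * E (-k) else F (-k) * E k
  have hpos : ∀ k : ℂ, 0 ≤ k.re → h k = F k * E (-k) := fun k hk => if_pos hk
  have hneg : ∀ k : ℂ, k.re ≤ 0 → h k = F (-k) * E k := by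
    intro k hk
    rcases hk.lt_or_eq with h0 | h0
    · exact if_neg h0.not_ge
    · rw [hpos k h0.ge, hEF k h0.ge, hEF (-k) (by simp [h0]), hpn]
      ring
  have heven : ∀ k, h (-k) = h k := by
    intro k
    rcases le_total 0 k.re with h0 | h0
    · rw [hneg (-k) (by simpa using h0), hpos k h0, neg_neg]
    · rw [hpos (-k) (by simpa using h0), hneg k h0, neg_neg]
  have hprod : ∀ k, h k * p k = E k * E (-k) := by
    intro k
    rcases le_total 0 k.re with h0 | h0
    · rw [hpos k h0, hEF k h0]; ring
    · rw [hneg k h0, hEF (-k) (by simpa using h0), hpn]; ring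
  have hd : Differentiable ℂ h := by
    intro k
    have hE' : Differentiable ℂ E := differentiable_shiftedIntegral hv
    have hp' : Differentiable ℂ p := differentiable_signAverage
    rcases lt_trichotomy k.re 0 with h0 | h0 | h0
    · have h1 : DifferentiableAt ℂ (fun k => F (-k) * E k) k := by
        refine DifferentiableAt.mul ?_ (hE' k)
        exact (differentiableAt_absIntegral (R := R) (k := -k) (by simpa using h0)).comp k
          differentiableAt_id.neg
      refine h1.congr_of_eventuallyEq ?_
      filter_upwards [Complex.continuous_re.continuousAt.eventually_lt continuousAt_const h0]
        with w hw
      exact hneg w hw.le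
    · have h1 : DifferentiableAt ℂ (fun k => E k * E (-k) / p k) k := by
        have := hp0 k h0
        fun_prop (disch := assumption)
      refine h1.congr_of_eventuallyEq ?_
      filter_upwards [hp'.continuous.continuousAt.eventually_ne (hp0 k h0)] with w hw
      rw [eq_div_iff hw, hprod]
    · have h1 : DifferentiableAt ℂ (fun k => F k * E (-k)) k := by
        have h3 : DifferentiableAt ℂ F k := differentiableAt_absIntegral h0
        exact h3.mul (hE'.comp differentiable_neg k)
      refine h1.congr_of_eventuallyEq ?_
      filter_upwards [continuousAt_const.eventually_lt Complex.continuous_re.continuousAt h0]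
        with w hw
      exact hpos w hw.le
  have himag : ∀ θ : ℝ, |θ| < Real.pi / 4 → ∀ y : ℝ, ‖h (y * I)‖ ≤
      (∫ x : Fin n → ℝ, Real.exp (-(Real.cos (2 * θ) / 2) * dotR x x)) ^ 2 *
        Real.exp (Real.pi * #R * |y| - 4 * θ * #R * y) := by
    intro θ hθ y
    have h1 := norm_absIntegral_mul_I_le h2 hθ y
    have h3 := norm_absIntegral_mul_I_le h2 (θ := -θ) (by rwa [abs_neg]) (-y)
    have h4 := norm_signAverage_le (R := R) (v := v) (-(y * I))
    rw [mul_neg (2 : ℝ), Real.cos_neg] at h3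
    have h5 : (((-y : ℝ) : ℂ) * I) = -(y * I) := by push_cast; ring
    rw [h5] at h3
    rw [hpos _ (by simp), hEF _ (by simp), norm_mul, norm_mul]
    have h6 : |(-((y : ℂ) * I)).im| = |y| := by simp
    rw [h6] at h4
    refine (mul_le_mul h1 (mul_le_mul h3 h4 (norm_nonneg _) ((norm_nonneg _).trans h3))
      (by positivity) ((norm_nonneg _).trans h1)).trans_eq ?_
    have h7 : Real.exp (Real.pi * #R * |y| - 4 * θ * #R * y) =
        Real.exp (-(2 * θ * #R * y)) * (Real.exp (-(-(2 * θ) * #R * -y)) *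
          Real.exp (Real.pi * #R * |y|)) := by
      rw [← Real.exp_add, ← Real.exp_add]; congr 1; ring
    rw [h7]
    ring
  set A : ℝ := Fintype.card (coxGroup R) * Z ^ 2 with hA
  have hbound : ∀ k, ‖h k‖ ≤ A * Real.exp (Real.pi * #R * |k.im|) := by
    have hp1 : ∀ k : ℂ, 0 < k.re → ‖h k‖ ≤ A * Real.exp (Real.pi * #R * |k.im|) := by
      intro k h0
      rw [hpos k h0.le]
      exact norm_absIntegral_mul_shiftedIntegral_neg_le h2 hnc hst hv h0
    intro k
    rcases lt_trichotomy k.re 0 with h0 | h0 | h0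
    · rw [← heven, ← abs_neg, ← Complex.neg_im]
      exact hp1 (-k) (by simpa using h0)
    · have h1 : k = (k.im : ℝ) * I := by
        conv_lhs => rw [← Complex.re_add_im k, h0]
        simp
      have h3 := himag 0 (by rw [abs_zero]; positivity) k.im
      rw [← h1] at h3
      refine h3.trans ?_
      have h4 : ∫ x : Fin n → ℝ, Real.exp (-(Real.cos (2 * 0) / 2) * dotR x x) = Z := by
        rw [hZ, mul_zero, Real.cos_zero]
        congr 1
        funext x
        congr 1
        ring
      rw [h4, hA]
      have h5 : (1 : ℝ) ≤ Fintype.card (coxGroup R) := by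
        exact_mod_cast Nat.one_le_iff_ne_zero.2 Fintype.card_ne_zero
      have h6 : Real.pi * #R * |k.im| - 4 * 0 * #R * k.im = Real.pi * #R * |k.im| := by ring
      rw [h6]
      refine mul_le_mul_of_nonneg_right ?_ (Real.exp_pos _).le
      nlinarith [sq_nonneg Z]
    · exact hp1 k h0
  have hA0 : 0 ≤ A := by positivity
  have hconst : h k = h 0 := by
    refine eq_of_even_of_bounded_real hd heven (A := A) (B := Real.pi * #R) (fun k => ?_)
      (fun x => ?_) (fun ε hε => ?_) k 0
    · refine (hbound k).trans (mul_le_mul_of_nonneg_left ?_ hA0)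
      exact Real.exp_le_exp.2 (mul_le_mul_of_nonneg_left (Complex.abs_im_le_norm k)
        (by positivity))
    · simpa using hbound x
    · set δ := min (ε / (4 * (#R + 1))) (Real.pi / 4) with hδ
      have hδ0 : 0 < δ := lt_min (by positivity) (by positivity)
      have hδ1 : δ ≤ Real.pi / 4 := min_le_right _ _
      have hδ2 : 4 * δ * #R ≤ ε := by
        have h1 : δ ≤ ε / (4 * (#R + 1)) := min_le_left _ _
        rw [le_div_iff₀ (by positivity)] at h1
        nlinarith
      refine ⟨_, fun y hy => (himag (Real.pi / 4 - δ) ?_ y).trans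
        (mul_le_mul_of_nonneg_left (Real.exp_le_exp.2 ?_) (sq_nonneg _))⟩
      · rw [abs_lt]; constructor <;> linarith
      · rw [abs_of_pos hy]
        have := mul_le_mul_of_nonneg_right hδ2 hy.le
        linarith
  have h00 : h 0 = (Z : ℂ) ^ 2 := by
    have h1 : p 0 = 1 := by
      have := signAverage_int h2 hst hv 0
      simpa using this
    rw [hpos 0 le_rfl, neg_zero, hEF 0 le_rfl, h1, mul_one, hF, absIntegral_zero, ← hZ, pow_two]
  rw [← hprod, hconst, h00]

theorem sum_sq_eq (x ξ : Fin n → ℝ) : ∑ i, ((x i : ℂ) + (ξ i : ℝ) * I) ^ 2 =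
    (dotR x x - dotR ξ ξ : ℝ) + 2 * (dotR x ξ : ℝ) * I := by
  simp only [dotR]
  push_cast
  rw [← Finset.sum_sub_distrib, Finset.mul_sum, Finset.sum_mul, ← Finset.sum_add_distrib]
  refine Finset.sum_congr rfl fun i _ => ?_
  linear_combination ((ξ i : ℂ) ^ 2) * Complex.I_mul_I

theorem zpow_mul_exp_eq_shiftedIntegrand {ξ : Fin n → ℝ} (hξ : ∀ α ∈ R, 0 < dotR α ξ) (l : ℤ)
    (x : Fin n → ℝ) :
    (∏ α ∈ R, (((dotR α x : ℝ) : ℂ) + (dotR α ξ : ℝ) * I) ^ (2 * l)) *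
      Complex.exp (-(∑ i, ((x i : ℂ) + (ξ i : ℝ) * I) ^ 2) / 2) =
      (-1) ^ (l * #R) * shiftedIntegrand R ξ l x := by
  have h1 : ∀ α ∈ R, (((dotR α x : ℝ) : ℂ) + (dotR α ξ : ℝ) * I) ^ (2 * l) =
      (-1) ^ l * Complex.exp (2 * l * Complex.log ((dotR α ξ : ℝ) - (dotR α x : ℝ) * I)) := by
    intro α hα
    have h2 : ((dotR α x : ℝ) : ℂ) + (dotR α ξ : ℝ) * I =
        I * ((dotR α ξ : ℝ) - (dotR α x : ℝ) * I) := by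
      linear_combination (dotR α x : ℂ) * Complex.I_mul_I
    have h3 : (2 * l : ℂ) = ((2 * l : ℤ) : ℂ) := by push_cast; ring
    rw [h2, mul_zpow, zpow_mul, h3, Complex.exp_int_mul,
      Complex.exp_log (Complex.slitPlane_ne_zero (sub_mul_I_mem_slitPlane (hξ α hα)))]
    congr 2
    exact Complex.I_sq
  rw [Finset.prod_congr rfl h1, Finset.prod_mul_distrib, Finset.prod_const, ← Complex.exp_sum,
    ← Finset.mul_sum, shiftedIntegrand, rootLog, zpow_mul, zpow_natCast, mul_assoc,
    ← Complex.exp_add]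
  congr 2
  ring

theorem integral_eq_shiftedIntegral [Finite (coxGroup R)] (h2 : ∀ α ∈ R, dotR α α = 2)
    (hnc : ∀ α ∈ R, ∀ β ∈ R, α ≠ β → ∀ c : ℝ, β ≠ c • α)
    (hst : ∀ e ∈ coxGroup R, ∀ α ∈ R, e α ∈ R ∨ -(e α) ∈ R)
    {v ξ : Fin n → ℝ} (hv : ∀ α ∈ R, 0 < dotR α v) (hξ : ∀ α ∈ R, dotR α ξ ≠ 0) (l : ℤ) :
    ∫ x : Fin n → ℝ, (∏ α ∈ R, (((dotR α x : ℝ) : ℂ) + (dotR α ξ : ℝ) * I) ^ (2 * l)) *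
      Complex.exp (-(∑ i, ((x i : ℂ) + (ξ i : ℝ) * I) ^ 2) / 2) =
      (-1) ^ (l * #R) * shiftedIntegral R v l := by
  obtain ⟨e, he, heξ⟩ := exists_mem_chamber_of_ne h2 hst hv hξ
  rw [shiftedIntegral_eq_of_chamber hv heξ, shiftedIntegral, ← integral_const_mul,
    ← integral_comp_coxGroup he fun x => (-1) ^ (l * #R) * shiftedIntegrand R (e ξ) l x]
  congr 1
  funext x
  rw [← zpow_mul_exp_eq_shiftedIntegrand heξ, sum_sq_eq, sum_sq_eq]
  simp only [dotR_coxGroup h2 he]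
  congr 1
  have h := sum_even_dotR_coxGroup (M := Additive ℂ) h2 hnc hst he
    (fun a b => Additive.ofMul (((a : ℂ) + b * I) ^ (2 * l)))
    (fun a b => by
      rw [← (even_two_mul l).neg_zpow ((a : ℂ) + b * I)]
      congr 2
      push_cast
      ring) x ξ
  exact (congrArg Additive.toMul h).symm

theorem cpow_neg_half_sq_mul_gaussian (n : ℕ) :
    (((2 * Real.pi : ℝ) : ℂ) ^ (-(n : ℂ) / 2)) ^ 2 *
      ((∫ x : Fin n → ℝ, Real.exp (-(dotR x x / 2)) : ℝ) : ℂ) ^ 2 = 1 := by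
  have h0 : (2 * Real.pi : ℝ) ≠ 0 := by positivity
  have h1 : ((2 * Real.pi : ℝ) : ℂ) ≠ 0 := Complex.ofReal_ne_zero.2 h0
  rw [gaussian_integral_eq, pow_two, ← Complex.cpow_add _ _ h1, add_halves, Complex.cpow_neg,
    Complex.cpow_natCast, ← Complex.ofReal_pow (_ ^ n), ← pow_mul, mul_comm n 2, pow_mul,
    Real.sq_sqrt (by positivity), Complex.ofReal_pow]
  exact inv_mul_cancel₀ (pow_ne_zero _ h1)

end Reflection


/-- The reflection relation `G_W(m)·G_W(−m) = (−1)^{m|R_+|}` for the Macdonald-Mehta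
type integrals `G_W(m) = ∫_{iξ+ℝ^n} ∏_{α∈R_+}(α,x)^{2m} dγ(x)`, `m ∈ ℤ`, over a
contour `iξ + ℝ^n` with `ξ` off all reflection hyperplanes. -/
theorem macdonald_mehta_reflection (n : ℕ) (C : CoxeterData n) (m : ℤ)
    (ξ : Fin n → ℝ) (hξ : ∀ α ∈ C.R, dotR α ξ ≠ 0) :
    (let G : ℤ → ℂ := fun l =>
      ((2 * Real.pi : ℝ) : ℂ) ^ (-(n : ℂ) / 2) *
        ∫ x : Fin n → ℝ,
          (∏ α ∈ C.R, (((dotR α x : ℝ) : ℂ) + (dotR α ξ : ℝ) * Complex.I) ^ (2 * l)) *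
          Complex.exp (-(∑ i, ((x i : ℂ) + (ξ i : ℝ) * Complex.I) ^ 2) / 2)
    G m * G (-m)) = (-1 : ℂ) ^ (m * C.R.card) := by
  have := C.finiteW
  have := Fintype.ofFinite (coxGroup C.R)
  obtain ⟨v, hv⟩ := C.pos
  have h1 := shiftedIntegral_mul_shiftedIntegral_neg C.norm2 C.noncollinear C.stableR hv m
  rw [signAverage_int C.norm2 C.stableR hv] at h1
  have h2 := cpow_neg_half_sq_mul_gaussian n
  have h3 : (-1 : ℂ) ^ (m * #C.R) * (-1) ^ (-m * #C.R) = 1 := by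
    rw [← zpow_add₀ (by norm_num), neg_mul, add_neg_cancel, zpow_zero]
  simp only [integral_eq_shiftedIntegral C.norm2 C.noncollinear C.stableR hv hξ, Int.cast_neg]
  set c := ((2 * Real.pi : ℝ) : ℂ) ^ (-(n : ℂ) / 2)
  set Z := ((∫ x : Fin n → ℝ, Real.exp (-(dotR x x / 2)) : ℝ) : ℂ)
  calc c * ((-1) ^ (m * #C.R) * shiftedIntegral C.R v m) *
        (c * ((-1) ^ (-m * #C.R) * shiftedIntegral C.R v (-m)))
      = c ^ 2 * ((-1) ^ (m * #C.R) * (-1) ^ (-m * #C.R)) *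
          (shiftedIntegral C.R v m * shiftedIntegral C.R v (-m)) := by ring
    _ = c ^ 2 * Z ^ 2 * (-1) ^ (m * #C.R) := by rw [h3, h1]; ring
    _ = (-1) ^ (m * #C.R) := by rw [h2, one_mul]
end

section
/- For a finite Coxeter group W on ℝ^n with degrees d_1,…,d_n of basic invariants, the product of the degrees equals the order of the group: ∏_{j=1}^n d_j = |W|. -/
open MeasureTheory Complex Finset

/-- The exponent vectors of weighted degree at most `k`. -/
def weightLE {n : ℕ} (d : Fin n → ℕ) (k : ℕ) : Set (Fin n →₀ ℕ) :=
  {a | Finsupp.weight d a ≤ k}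

lemma weight_eq_sum {n : ℕ} (d : Fin n → ℕ) (a : Fin n →₀ ℕ) :
    Finsupp.weight d a = ∑ i, a i * d i := by
  rw [Finsupp.weight_apply, Finsupp.sum_fintype _ _ (by simp)]
  simp

lemma finite_weightLE {n : ℕ} {d : Fin n → ℕ} (hd : ∀ i, d i ≠ 0) (k : ℕ) :
    Finite (weightLE d k) :=
  Finsupp.finite_of_nat_weight_le d hd k

lemma card_weightLE_one_le_mul {n : ℕ} {d : Fin n → ℕ} (hd : ∀ i, d i ≠ 0) (k : ℕ) :
    Nat.card (weightLE (1 : Fin n → ℕ) k) ≤ (∏ i, d i) * Nat.card (weightLE d k) := by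
  have := finite_weightLE hd k
  have h : Nat.card ((∀ i, Fin (d i)) × weightLE d k) = (∏ i, d i) * Nat.card (weightLE d k) := by
    simp [Nat.card_prod]
  rw [← h]
  have hmem (b : weightLE (1 : Fin n → ℕ) k) :
      Finsupp.equivFunOnFinite.symm (fun i => b.1 i / d i) ∈ weightLE d k := by
    have hb := b.2
    simp only [weightLE, Set.mem_ofPred_eq, weight_eq_sum] at hb ⊢
    refine le_trans (Finset.sum_le_sum fun i _ => ?_) hb
    simpa using Nat.div_mul_le_self (b.1 i) (d i)
  refine Nat.card_le_card_of_injective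
    (fun b => (fun i => ⟨b.1 i % d i, Nat.mod_lt _ (Nat.pos_of_ne_zero (hd i))⟩, ⟨_, hmem b⟩)) ?_
  intro b b' h
  simp only [Prod.mk.injEq, Subtype.mk.injEq, EmbeddingLike.apply_eq_iff_eq] at h
  ext i
  have h1 := congrFun h.1 i
  have h2 := congrFun h.2 i
  simp only [Fin.mk.injEq] at h1
  rw [← Nat.div_add_mod (b.1 i) (d i), ← Nat.div_add_mod (b'.1 i) (d i), h1, h2]

lemma mul_card_weightLE_le {n : ℕ} (d : Fin n → ℕ) (k : ℕ) :
    (∏ i, d i) * Nat.card (weightLE d k) ≤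
      Nat.card (weightLE (1 : Fin n → ℕ) (k + ∑ i, d i)) := by
  have := finite_weightLE (d := (1 : Fin n → ℕ)) (by simp) (k + ∑ i, d i)
  have h : Nat.card ((∀ i, Fin (d i)) × weightLE d k) = (∏ i, d i) * Nat.card (weightLE d k) := by
    simp [Nat.card_prod]
  rw [← h]
  have hmem (p : (∀ i, Fin (d i)) × weightLE d k) :
      Finsupp.equivFunOnFinite.symm (fun i => p.2.1 i * d i + (p.1 i : ℕ)) ∈
        weightLE (1 : Fin n → ℕ) (k + ∑ i, d i) := by
    have hb := p.2.2
    simp only [weightLE, Set.mem_ofPred_eq, weight_eq_sum] at hb ⊢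
    simp only [Finsupp.equivFunOnFinite_symm_apply_apply, Pi.one_apply, mul_one,
      Finset.sum_add_distrib]
    exact add_le_add hb (Finset.sum_le_sum fun i _ => (p.1 i).2.le)
  refine Nat.card_le_card_of_injective (fun p => ⟨_, hmem p⟩) ?_
  rintro ⟨r, a⟩ ⟨r', a'⟩ h
  simp only [Subtype.mk.injEq, EmbeddingLike.apply_eq_iff_eq] at h
  have hr : r = r' := by
    ext i
    have := congrArg (· % d i) (congrFun h i)
    simpa [Nat.mod_eq_of_lt (r i).2, Nat.mod_eq_of_lt (r' i).2] using this
  subst hr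
  refine Prod.ext rfl (Subtype.ext (Finsupp.ext fun i => ?_))
  have := congrFun h i
  exact Nat.eq_of_mul_eq_mul_right ((Nat.zero_le _).trans_lt (r i).2) (Nat.add_right_cancel this)

lemma card_weightLE_one_le_pow (n k : ℕ) :
    Nat.card (weightLE (1 : Fin n → ℕ) k) ≤ (k + 1) ^ n := by
  have h : Nat.card (Fin n → Fin (k + 1)) = (k + 1) ^ n := by simp
  rw [← h]
  have hlt (b : weightLE (1 : Fin n → ℕ) k) (i : Fin n) : b.1 i < k + 1 := by
    have hb := b.2
    simp only [weightLE, Set.mem_ofPred_eq, weight_eq_sum, Pi.one_apply, mul_one] at hb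
    exact Nat.lt_succ_of_le
      ((Finset.single_le_sum (f := fun i => b.1 i) (fun _ _ => Nat.zero_le _)
        (Finset.mem_univ i)).trans hb)
  refine Nat.card_le_card_of_injective (fun b i => (⟨b.1 i, hlt b i⟩ : Fin (k + 1))) ?_
  intro b b' h
  ext i
  simpa using congrFun h i

lemma card_weightLE_pos {n : ℕ} {d : Fin n → ℕ} (hd : ∀ i, d i ≠ 0) (k : ℕ) :
    0 < Nat.card (weightLE d k) := by
  have := finite_weightLE hd k
  have : Nonempty (weightLE d k) := ⟨⟨0, by simp [weightLE]⟩⟩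
  exact Nat.card_pos

/-- A sequence of polynomial growth cannot grow by a factor exceeding `1` along steps of bounded
length. -/
lemma le_of_mul_le_mul_shift {N : ℕ → ℕ} {n p q c : ℕ} (h0 : 0 < N 0)
    (hN : ∀ k, N k ≤ (k + 1) ^ n) (h : ∀ k, p * N k ≤ q * N (k + c)) : p ≤ q := by
  by_contra! hlt
  have hiter (j : ℕ) : p ^ j * N 0 ≤ q ^ j * N (j * c) := by
    induction j with
    | zero => simp
    | succ j ih =>
      calc p ^ (j + 1) * N 0 = p * (p ^ j * N 0) := by ring
        _ ≤ p * (q ^ j * N (j * c)) := by gcongr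
        _ = q ^ j * (p * N (j * c)) := by ring
        _ ≤ q ^ j * (q * N (j * c + c)) := Nat.mul_le_mul_left _ (h _)
        _ = q ^ (j + 1) * N ((j + 1) * c) := by rw [Nat.succ_mul]; ring
  have hq : 0 < q := by
    by_contra! hq
    have := h 0
    obtain rfl : q = 0 := by omega
    have := Nat.mul_pos hlt h0
    omega
  have hq' : (0 : ℝ) < q := by exact_mod_cast hq
  have hr : (1 : ℝ) < p / q := by rw [one_lt_div hq']; exact_mod_cast hlt
  have hlim := (tendsto_pow_const_div_const_pow_of_one_lt n hr).const_mul (((c + 1 : ℕ) : ℝ) ^ n)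
  rw [mul_zero] at hlim
  obtain ⟨j, hj, hj1⟩ := ((hlim.eventually_lt_const zero_lt_one).and
    (Filter.eventually_ge_atTop 1)).exists
  have hp : (0 : ℝ) < p := by exact_mod_cast hq.trans hlt
  have hnat : p ^ j ≤ q ^ j * ((c + 1) ^ n * j ^ n) := by
    calc p ^ j ≤ p ^ j * N 0 := Nat.le_mul_of_pos_right _ h0
      _ ≤ q ^ j * N (j * c) := hiter j
      _ ≤ q ^ j * (j * c + 1) ^ n := by gcongr; exact hN _
      _ ≤ q ^ j * ((c + 1) * j) ^ n := by gcongr; nlinarith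
      _ = _ := by rw [mul_pow]
  have hreal : (p : ℝ) ^ j ≤ q ^ j * (((c + 1 : ℕ) : ℝ) ^ n * j ^ n) := by exact_mod_cast hnat
  rw [div_pow, ← mul_div_assoc, div_lt_one (by positivity), lt_div_iff₀ (by positivity)] at hj
  linarith

namespace MvPolynomial

variable {n : ℕ}

lemma isHomogeneous_aeval_monomial {d : Fin n → ℕ} {P : Fin n → MvPolynomial (Fin n) ℝ}
    (hP : ∀ j, (P j).IsHomogeneous (d j)) (a : Fin n →₀ ℕ) (c : ℝ) :
    (aeval P (monomial a c)).IsHomogeneous (Finsupp.weight d a) := by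
  rw [aeval_monomial, Finsupp.prod_fintype _ _ (by simp), weight_eq_sum]
  exact (IsHomogeneous.prod _ _ _ fun i _ => by
    simpa [mul_comm] using (hP i).pow (a i)).C_mul c

lemma homogeneousComponent_aeval {d : Fin n → ℕ} {P : Fin n → MvPolynomial (Fin n) ℝ}
    (hP : ∀ j, (P j).IsHomogeneous (d j)) (k : ℕ) (q : MvPolynomial (Fin n) ℝ) :
    homogeneousComponent k (aeval P q) = aeval P (weightedHomogeneousComponent d k q) := by
  induction q using MvPolynomial.induction_on' with
  | monomial a c =>
    rw [homogeneousComponent_of_mem (isHomogeneous_aeval_monomial hP a c),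
      weightedHomogeneousComponent_of_mem (isWeightedHomogeneous_monomial d a c rfl)]
    split_ifs <;> simp
  | add p q hp hq => rw [map_add, map_add, hp, hq, map_add, map_add]

lemma mem_restrictSupport_weightLE_one {k : ℕ} {f : MvPolynomial (Fin n) ℝ} :
    f ∈ restrictSupport ℝ (weightLE 1 k) ↔ f.totalDegree ≤ k := by
  rw [← mem_restrictTotalDegree, restrictTotalDegree]
  congr! 2
  ext a
  simp [weightLE, weight_eq_sum, Finsupp.sum_fintype]

/-- The polynomials in `P` of weighted degree at most `k`, where `P j` has weight `d j`. -/
noncomputable def generatedLE (d : Fin n → ℕ) (P : Fin n → MvPolynomial (Fin n) ℝ) (k : ℕ) :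
    Submodule ℝ (MvPolynomial (Fin n) ℝ) :=
  (restrictSupport ℝ (weightLE d k)).map (aeval P).toLinearMap

lemma mem_generatedLE_iff {d : Fin n → ℕ} {P : Fin n → MvPolynomial (Fin n) ℝ}
    (hP : ∀ j, (P j).IsHomogeneous (d j)) (hind : AlgebraicIndependent ℝ P) {k : ℕ}
    {f : MvPolynomial (Fin n) ℝ} :
    f ∈ generatedLE d P k ↔ f ∈ Algebra.adjoin ℝ (Set.range P) ∧ f.totalDegree ≤ k := by
  rw [Algebra.adjoin_range_eq_range_aeval]
  constructor
  · intro hf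
    refine ⟨?_, ?_⟩
    · obtain ⟨q, -, rfl⟩ := hf
      exact ⟨q, rfl⟩
    · rw [← mem_restrictTotalDegree]
      refine (?_ : generatedLE d P k ≤ _) hf
      rw [generatedLE, restrictSupport_eq_span, Submodule.map_span_le]
      rintro _ ⟨a, ha, rfl⟩
      rw [mem_restrictTotalDegree]
      exact (isHomogeneous_aeval_monomial hP a 1).totalDegree_le.trans ha
  · rintro ⟨⟨q, rfl⟩, hq⟩
    refine ⟨q, fun a ha => ?_, rfl⟩
    by_contra hak
    have hlt : k < Finsupp.weight d a := not_le.mp hak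
    have h0 := homogeneousComponent_eq_zero (Finsupp.weight d a) _ (hq.trans_lt hlt)
    erw [homogeneousComponent_aeval hP] at h0
    have h1 := (injective_iff_map_eq_zero _).mp hind _ h0
    have h2 := coeff_weightedHomogeneousComponent (w := d) (Finsupp.weight d a) q a
    rw [h1, if_pos rfl, coeff_zero] at h2
    exact (mem_support_iff.mp ha) h2.symm

lemma finrank_restrictSupport (s : Set (Fin n →₀ ℕ)) :
    Module.finrank ℝ (restrictSupport ℝ s) = Nat.card s :=
  Module.finrank_eq_nat_card_basis (basisRestrictSupport ℝ s)

lemma finite_restrictSupport (s : Set (Fin n →₀ ℕ)) [Finite s] :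
    Module.Finite ℝ (restrictSupport ℝ s) :=
  Module.Finite.of_basis (basisRestrictSupport ℝ s)

lemma finrank_generatedLE {d : Fin n → ℕ} {P : Fin n → MvPolynomial (Fin n) ℝ}
    (hind : AlgebraicIndependent ℝ P) (k : ℕ) :
    Module.finrank ℝ (generatedLE d P k) = Nat.card (weightLE d k) := by
  rw [← finrank_restrictSupport]
  exact (Submodule.equivMapOfInjective (aeval P).toLinearMap hind _).symm.finrank_eq

/-- Precomposition of a polynomial function with a linear map. -/
noncomputable def compLinear (e : (Fin n → ℝ) →ₗ[ℝ] (Fin n → ℝ)) :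
    MvPolynomial (Fin n) ℝ →ₐ[ℝ] MvPolynomial (Fin n) ℝ :=
  aeval fun i => ∑ j, C (e (Pi.single j 1) i) * X j

@[simp]
lemma eval_compLinear (e : (Fin n → ℝ) →ₗ[ℝ] (Fin n → ℝ)) (x : Fin n → ℝ)
    (f : MvPolynomial (Fin n) ℝ) : eval x (compLinear e f) = eval (e x) f := by
  induction f using MvPolynomial.induction_on with
  | C a => simp [compLinear]
  | add p q hp hq => simp [hp, hq]
  | mul_X p i hp =>
    simp only [map_mul, hp, eval_X]
    congr 1
    conv_rhs => rw [LinearMap.pi_apply_eq_sum_univ e x]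
    have h (j : Fin n) : (fun k => if j = k then (1 : ℝ) else 0) = Pi.single j 1 := by
      ext k
      simp [Pi.single_apply, eq_comm]
    simp [compLinear, h, mul_comm]

lemma totalDegree_compLinear_le (e : (Fin n → ℝ) →ₗ[ℝ] (Fin n → ℝ))
    (f : MvPolynomial (Fin n) ℝ) : (compLinear e f).totalDegree ≤ f.totalDegree := by
  rw [← f.support_sum_monomial_coeff, map_sum, support_sum_monomial_coeff]
  refine totalDegree_finsetSum_le fun a ha => ?_
  have h1 (i : Fin n) :
      (∑ j, C (e (Pi.single j 1) i) * X j : MvPolynomial (Fin n) ℝ).IsHomogeneous 1 :=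
    IsHomogeneous.sum _ _ _ fun j _ => isHomogeneous_C_mul_X _ _
  refine (IsHomogeneous.totalDegree_le
    (isHomogeneous_aeval_monomial (d := fun _ => 1) h1 a _)).trans ?_
  have := le_totalDegree ha
  simpa [weight_eq_sum, Finsupp.sum_fintype] using this

lemma compLinear_injective :
    Function.Injective (compLinear : ((Fin n → ℝ) →ₗ[ℝ] (Fin n → ℝ)) → _) := by
  intro e e' h
  refine LinearMap.ext fun x => _root_.funext fun i => ?_
  have := congrArg (eval x) (DFunLike.congr_fun h (X i))
  simpa using this

/-- Finitely many distinct linear maps have distinct pullbacks of a suitable polynomial. -/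
lemma exists_injective_compLinear {ι : Type*} [Finite ι]
    {φ : ι → (Fin n → ℝ) →ₗ[ℝ] (Fin n → ℝ)} (hφ : Function.Injective φ) :
    ∃ l : MvPolynomial (Fin n) ℝ, Function.Injective fun i => compLinear (φ i) l := by
  by_contra! hl
  let p : {x : ι × ι // x.1 ≠ x.2} → Subspace ℝ (MvPolynomial (Fin n) ℝ) := fun x =>
    LinearMap.ker ((compLinear (φ x.1.1)).toLinearMap - (compLinear (φ x.1.2)).toLinearMap)
  have hcov : ⋃ i, (p i : Set (MvPolynomial (Fin n) ℝ)) = Set.univ := by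
    refine Set.eq_univ_of_forall fun l => ?_
    have := hl l
    simp only [Function.Injective, not_forall] at this
    obtain ⟨i, j, h, hne⟩ := this
    exact Set.mem_iUnion.mpr ⟨⟨(i, j), hne⟩, by simpa [p, sub_eq_zero] using h⟩
  obtain ⟨⟨⟨i, j⟩, hne⟩, htop⟩ := Subspace.exists_eq_top_of_iUnion_eq_univ hcov
  refine hne (hφ (compLinear_injective (AlgHom.ext fun f => ?_)))
  have : f ∈ p ⟨(i, j), hne⟩ := htop ▸ Submodule.mem_top
  simpa [p, sub_eq_zero] using this

lemma totalDegree_mul_pow_le {m : ℕ} {f l : MvPolynomial (Fin n) ℝ} {k : ℕ}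
    (hf : f.totalDegree ≤ k) (i : Fin m) :
    (f * l ^ (i : ℕ)).totalDegree ≤ k + m * l.totalDegree :=
  (totalDegree_mul _ _).trans <| add_le_add hf <|
    (totalDegree_pow _ _).trans <| Nat.mul_le_mul_right _ i.2.le

end MvPolynomial

namespace CoxeterData

open MvPolynomial

variable {n : ℕ} (C : CoxeterData n)

lemma d_ne_zero (j : Fin n) : C.d j ≠ 0 := by
  intro h
  have hj := C.homog j
  rw [h, ← totalDegree_zero_iff_isHomogeneous, totalDegree_eq_zero_iff_eq_C] at hj
  refine C.algInd.transcendental j ?_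
  rw [hj]
  exact isAlgebraic_algebraMap _

/-- The action of the reflection group on polynomials by precomposition. -/
noncomputable def act (w : coxGroup C.R) : MvPolynomial (Fin n) ℝ →ₐ[ℝ] MvPolynomial (Fin n) ℝ :=
  compLinear (w.1 : (Fin n → ℝ) →ₗ[ℝ] (Fin n → ℝ))

@[simp]
lemma eval_act (w : coxGroup C.R) (x : Fin n → ℝ) (f : MvPolynomial (Fin n) ℝ) :
    eval x (C.act w f) = eval (w.1 x) f :=
  eval_compLinear _ _ _

lemma mem_adjoin_iff {f : MvPolynomial (Fin n) ℝ} :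
    f ∈ Algebra.adjoin ℝ (Set.range C.P) ↔ ∀ w, C.act w f = f := by
  constructor
  · intro hf w
    refine (AlgHom.mem_equalizer (C.act w) (AlgHom.id ℝ _) f).mp (?_ : f ∈ _)
    refine Algebra.adjoin_le ?_ hf
    rintro _ ⟨j, rfl⟩
    refine (AlgHom.mem_equalizer (C.act w) (AlgHom.id ℝ _) _).mpr ?_
    exact MvPolynomial.funext fun x => by simpa using C.invP j w.1 w.2 x
  · intro hf
    refine C.gen f fun e he x => ?_
    rw [← C.eval_act ⟨e, he⟩, hf]

lemma exists_separating :
    ∃ l : MvPolynomial (Fin n) ℝ, Function.Injective fun w => C.act w l := by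
  have := C.finiteW
  refine exists_injective_compLinear
    (φ := fun w : coxGroup C.R => (w.1 : (Fin n → ℝ) →ₗ[ℝ] (Fin n → ℝ))) fun w w' h => ?_
  exact Subtype.ext (LinearEquiv.toLinearMap_injective h)

lemma sum_act_mem_adjoin [Fintype (coxGroup C.R)] (f : MvPolynomial (Fin n) ℝ) :
    ∑ w, C.act w f ∈ Algebra.adjoin ℝ (Set.range C.P) := by
  refine C.mem_adjoin_iff.mpr fun w => MvPolynomial.funext fun x => ?_
  simp only [eval_act, map_sum]
  exact Fintype.sum_equiv (Equiv.mulRight w) _ _ fun _ => rfl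

lemma exists_shift_bounds : ∃ c : ℕ, ∀ k,
    Nat.card (coxGroup C.R) * Nat.card (weightLE C.d k) ≤
      Nat.card (weightLE (1 : Fin n → ℕ) (k + c)) ∧
    Nat.card (weightLE (1 : Fin n → ℕ) k) ≤
      Nat.card (coxGroup C.R) * Nat.card (weightLE C.d (k + c)) := by
  have := C.finiteW
  have := Fintype.ofFinite (coxGroup C.R)
  obtain ⟨l, hl⟩ := C.exists_separating
  set m := Nat.card (coxGroup C.R) with hm
  let g : Fin m ≃ coxGroup C.R := (Finite.equivFin _).symm
  have hgl : Function.Injective fun j => C.act (g j) l := hl.comp g.injective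
  refine ⟨m * l.totalDegree, fun k => ⟨?_, ?_⟩⟩
  · have := finite_weightLE (d := (1 : Fin n → ℕ)) (by simp) (k + m * l.totalDegree)
    have := finite_restrictSupport (weightLE (1 : Fin n → ℕ) (k + m * l.totalDegree))
    have := finite_weightLE C.d_ne_zero k
    have := finite_restrictSupport (weightLE C.d k)
    have : Module.Finite ℝ (generatedLE C.d C.P k) := Module.Finite.map _ _
    let F : (Fin m → generatedLE C.d C.P k) →ₗ[ℝ] MvPolynomial (Fin n) ℝ :=
      ∑ i : Fin m, LinearMap.mulRight ℝ (l ^ (i : ℕ)) ∘ₗ (generatedLE C.d C.P k).subtype ∘ₗ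
        LinearMap.proj i
    have hF (a) : F a = ∑ i, (a i).1 * l ^ (i : ℕ) := by simp [F, LinearMap.sum_apply]
    have hmem (a) : F a ∈ restrictSupport ℝ (weightLE 1 (k + m * l.totalDegree)) := by
      rw [mem_restrictSupport_weightLE_one, hF]
      exact totalDegree_finsetSum_le fun i _ => totalDegree_mul_pow_le
        ((mem_generatedLE_iff C.homog C.algInd).mp (a i).2).2 i
    have hinj : Function.Injective (F.codRestrict _ hmem) := by
      rw [injective_iff_map_eq_zero]
      intro a ha
      have ha : F a = 0 := congrArg Subtype.val ha
      rw [hF] at ha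
      have hz := Matrix.eq_zero_of_forall_index_sum_mul_pow_eq_zero
        (v := fun i => (a i).1) hgl fun j => by
          have h := congrArg (C.act (g j)) ha
          simp only [map_sum, map_mul, map_pow, map_zero] at h
          rw [← h]
          refine Finset.sum_congr rfl fun i _ => ?_
          rw [C.mem_adjoin_iff.mp ((mem_generatedLE_iff C.homog C.algInd).mp (a i).2).1]
      exact funext fun i => Subtype.ext (congrFun hz i)
    have h := LinearMap.finrank_le_finrank_of_injective hinj
    rwa [Module.finrank_pi_fintype, Finset.sum_const, Finset.card_univ, Fintype.card_fin,
      smul_eq_mul, finrank_generatedLE C.algInd, finrank_restrictSupport] at h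
  · have := finite_weightLE C.d_ne_zero (k + m * l.totalDegree)
    have := finite_restrictSupport (weightLE C.d (k + m * l.totalDegree))
    have : Module.Finite ℝ (generatedLE C.d C.P (k + m * l.totalDegree)) := Module.Finite.map _ _
    let G (i : Fin m) : restrictSupport ℝ (weightLE (1 : Fin n → ℕ) k) →ₗ[ℝ]
        MvPolynomial (Fin n) ℝ :=
      (∑ w, (C.act w).toLinearMap) ∘ₗ LinearMap.mulRight ℝ (l ^ (i : ℕ)) ∘ₗ Submodule.subtype _
    have hG (i f) : G i f = ∑ w, C.act w (f.1 * l ^ (i : ℕ)) := by simp [G]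
    have hmem (i f) : G i f ∈ generatedLE C.d C.P (k + m * l.totalDegree) := by
      rw [mem_generatedLE_iff C.homog C.algInd, hG]
      exact ⟨C.sum_act_mem_adjoin _, totalDegree_finsetSum_le fun w _ =>
        (totalDegree_compLinear_le _ _).trans
          (totalDegree_mul_pow_le (mem_restrictSupport_weightLE_one.mp f.2) i)⟩
    have hinj : Function.Injective (LinearMap.pi fun i => (G i).codRestrict _ (hmem i)) := by
      rw [injective_iff_map_eq_zero]
      intro f hf
      have hz := Matrix.eq_zero_of_forall_pow_sum_mul_pow_eq_zero
        (v := fun j => C.act (g j) f.1) hgl fun i => by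
          have h : G i f = 0 := congrArg Subtype.val (congrFun hf i)
          rw [hG, ← g.sum_comp] at h
          simpa using h
      have h1 := congrFun hz (g.symm 1)
      refine Subtype.ext (MvPolynomial.funext fun x => ?_)
      simpa using congrArg (eval x) h1
    have h := LinearMap.finrank_le_finrank_of_injective hinj
    rwa [Module.finrank_pi_fintype, Finset.sum_const, Finset.card_univ, Fintype.card_fin,
      smul_eq_mul, finrank_generatedLE C.algInd, finrank_restrictSupport] at h

end CoxeterData

/-- For a finite Coxeter group the product of the degrees of the basic invariants
equals the order of the group: `∏ d_j = |W|`. -/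
theorem degrees_prod_eq_card (n : ℕ) (C : CoxeterData n) :
    (∏ j, C.d j) = Nat.card (coxGroup C.R) := by
  obtain ⟨c, hc⟩ := C.exists_shift_bounds
  have h0 := card_weightLE_pos (d := (1 : Fin n → ℕ)) (by simp) 0
  apply le_antisymm
  · refine le_of_mul_le_mul_shift (c := c + ∑ j, C.d j) h0 (card_weightLE_one_le_pow n)
      fun k => ?_
    calc _ ≤ (∏ j, C.d j) * (Nat.card (coxGroup C.R) * Nat.card (weightLE C.d (k + c))) :=
          Nat.mul_le_mul_left _ (hc k).2
      _ = Nat.card (coxGroup C.R) * ((∏ j, C.d j) * Nat.card (weightLE C.d (k + c))) :=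
          Nat.mul_left_comm _ _ _
      _ ≤ _ := Nat.mul_le_mul_left _ (by
          rw [← add_assoc]; exact mul_card_weightLE_le C.d (k + c))
  · refine le_of_mul_le_mul_shift (c := c) h0 (card_weightLE_one_le_pow n) fun k => ?_
    calc _ ≤ Nat.card (coxGroup C.R) * ((∏ j, C.d j) * Nat.card (weightLE C.d k)) :=
          Nat.mul_le_mul_left _ (card_weightLE_one_le_mul C.d_ne_zero k)
      _ = (∏ j, C.d j) * (Nat.card (coxGroup C.R) * Nat.card (weightLE C.d k)) :=
          Nat.mul_left_comm _ _ _
      _ ≤ _ := Nat.mul_le_mul_left _ (hc k).1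
end
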